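/- arXiv:1307.0047 — 2 statements merged into one kernel-verified Lean document; each statement's English description precedes it below -/
import Mathlib

section
/- Let n ≥ 5, a ≥ 0 and p > (n+4+2a)/(n-4). There exists a constant C = C(n,p,a) such that for every smooth stable solution u of Δ²u = |x|^a |u|^{p-1} u on ℝ^n and every r > 0: ∫_{B_r(0)} |∇u|² dx ≤ C r^{n − 2β − 2}, where β = (4+a)/(p-1). -/
open MeasureTheory Metric Set Filter
open scoped RealInnerProductSpace Topology

noncomputable section

/-- The Laplacian of `u : ℝⁿ → ℝ` at `x`, as the sum of the pure second
partial derivatives in the coordinate directions. -/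
def lap (n : ℕ) (u : EuclideanSpace ℝ (Fin n) → ℝ) (x : EuclideanSpace ℝ (Fin n)) : ℝ :=
  ∑ i : Fin n, iteratedFDeriv ℝ 2 u x ![EuclideanSpace.single i 1, EuclideanSpace.single i 1]

/-- `u` solves `Δ²u = |x|^a |u|^(p-1) u` pointwise on `Ω`. -/
def IsSolutionOn (n : ℕ) (a p : ℝ) (u : EuclideanSpace ℝ (Fin n) → ℝ)
    (Ω : Set (EuclideanSpace ℝ (Fin n))) : Prop :=
  ∀ x ∈ Ω, lap n (lap n u) x = ‖x‖ ^ a * |u x| ^ (p - 1) * u x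

/-- `u` is a stable solution on `Ω`:
`p ∫ |x|^a |u|^(p-1) ψ² ≤ ∫ (Δψ)²` for every test function `ψ ∈ C_c^∞(Ω)`. -/
def StableOn (n : ℕ) (a p : ℝ) (u : EuclideanSpace ℝ (Fin n) → ℝ)
    (Ω : Set (EuclideanSpace ℝ (Fin n))) : Prop :=
  ∀ ψ : EuclideanSpace ℝ (Fin n) → ℝ, ContDiff ℝ (⊤ : ℕ∞) ψ → HasCompactSupport ψ →
    tsupport ψ ⊆ Ω →
    p * ∫ x, ‖x‖ ^ a * |u x| ^ (p - 1) * ψ x ^ 2 ≤ ∫ x, lap n ψ x ^ 2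

/-- Surface integral of `f` over the sphere `∂B_r(x)`, with respect to the
`(n-1)`-dimensional Hausdorff measure. -/
def sphInt (n : ℕ) (x : EuclideanSpace ℝ (Fin n)) (r : ℝ)
    (f : EuclideanSpace ℝ (Fin n) → ℝ) : ℝ :=
  ∫ y in sphere x r, f y ∂(Measure.hausdorffMeasure ((n : ℝ) - 1))

/-- Radial derivative of `u` at `y`, relative to the center `x`. -/
def radDeriv (n : ℕ) (x : EuclideanSpace ℝ (Fin n))
    (u : EuclideanSpace ℝ (Fin n) → ℝ) (y : EuclideanSpace ℝ (Fin n)) : ℝ :=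
  ⟪gradient u y, ‖y - x‖⁻¹ • (y - x)⟫

/-- `ℓ₁ = (β+2)(n-4-β) + β(n-2-β)` with `β = (4+a)/(p-1)`. -/
def ell1 (n : ℕ) (a p : ℝ) : ℝ :=
  let β : ℝ := (4 + a) / (p - 1)
  (β + 2) * ((n : ℝ) - 4 - β) + β * ((n : ℝ) - 2 - β)

/-- `ℓ₂ = β(β+2)(n-4-β)(n-2-β)` with `β = (4+a)/(p-1)`. -/
def ell2 (n : ℕ) (a p : ℝ) : ℝ :=
  let β : ℝ := (4 + a) / (p - 1)
  β * (β + 2) * ((n : ℝ) - 4 - β) * ((n : ℝ) - 2 - β)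

/-- The constant `c(n,p,a) = 2(ρ - γ - 1)`, `ρ = n-1-2β`, `γ = β(β-n+2)`. -/
def cConst (n : ℕ) (a p : ℝ) : ℝ :=
  let β : ℝ := (4 + a) / (p - 1)
  2 * (((n : ℝ) - 1 - 2 * β) - β * (β - (n : ℝ) + 2) - 1)

/-- The rescaled energy `E(r; x, u)` from the monotonicity formula. -/
def energyE (n : ℕ) (a p : ℝ) (u : EuclideanSpace ℝ (Fin n) → ℝ)
    (x : EuclideanSpace ℝ (Fin n)) (r : ℝ) : ℝ :=
  let β : ℝ := (4 + a) / (p - 1)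
  r ^ (2 * β + 4 - (n : ℝ)) *
      (∫ y in ball x r,
        (1 / 2) * lap n u y ^ 2 - (1 / (p + 1)) * ‖y‖ ^ a * |u y| ^ (p + 1))
    + β / 2 * ((n : ℝ) - 2 - β) *
        deriv (fun ρ : ℝ => ρ ^ (2 * β + 1 - (n : ℝ)) * sphInt n x ρ fun y => u y ^ 2) r
    + β / 2 * ((n : ℝ) - 2 - β) *
        deriv (fun ρ : ℝ => ρ ^ (2 * β + 2 - (n : ℝ)) * sphInt n x ρ fun y => u y ^ 2) r
    + r ^ 3 / 2 *
        deriv (fun ρ : ℝ => ρ ^ (2 * β + 1 - (n : ℝ)) *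
          sphInt n x ρ fun y => (β * ρ⁻¹ * u y + radDeriv n x u y) ^ 2) r
    + 1 / 2 *
        deriv (fun ρ : ℝ => ρ ^ (2 * β + 4 - (n : ℝ)) *
          sphInt n x ρ fun y => ‖gradient u y‖ ^ 2 - radDeriv n x u y ^ 2) r
    + 1 / 2 * r ^ (2 * β + 3 - (n : ℝ)) *
        (sphInt n x r fun y => ‖gradient u y‖ ^ 2 - radDeriv n x u y ^ 2)

end

/-- The `i`-th partial derivative of `f`. -/
noncomputable def partialDeriv {n : ℕ} (i : Fin n) (f : EuclideanSpace ℝ (Fin n) → ℝ)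
    (x : EuclideanSpace ℝ (Fin n)) : ℝ :=
  fderiv ℝ f x (EuclideanSpace.single i 1)

/-- The pointwise inner product of the gradients of `f` and `g`. -/
noncomputable def gradDot {n : ℕ} (f g : EuclideanSpace ℝ (Fin n) → ℝ)
    (x : EuclideanSpace ℝ (Fin n)) : ℝ :=
  ∑ i, partialDeriv i f x * partialDeriv i g x

section Calculus

variable {n : ℕ} {f g h : EuclideanSpace ℝ (Fin n) → ℝ}

theorem contDiff_partialDeriv (hf : ContDiff ℝ (⊤ : ℕ∞) f) (i : Fin n) :
    ContDiff ℝ (⊤ : ℕ∞) (partialDeriv i f) :=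
  (hf.fderiv_right (m := (⊤ : ℕ∞)) (by simp)).clm_apply contDiff_const

theorem contDiff_gradDot (hf : ContDiff ℝ (⊤ : ℕ∞) f) (hg : ContDiff ℝ (⊤ : ℕ∞) g) :
    ContDiff ℝ (⊤ : ℕ∞) (gradDot f g) :=
  ContDiff.sum fun i _ => (contDiff_partialDeriv hf i).mul (contDiff_partialDeriv hg i)

theorem partialDeriv_mul (hf : ContDiff ℝ (⊤ : ℕ∞) f) (hg : ContDiff ℝ (⊤ : ℕ∞) g) (i : Fin n) :
    partialDeriv i (fun x => f x * g x) =
      fun x => f x * partialDeriv i g x + g x * partialDeriv i f x := by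
  funext x
  have h1 := hf.contDiffAt.differentiableAt (x := x) (by simp)
  have h2 := hg.contDiffAt.differentiableAt (x := x) (by simp)
  simp [partialDeriv, fderiv_fun_mul h1 h2]

theorem partialDeriv_add (hf : ContDiff ℝ (⊤ : ℕ∞) f) (hg : ContDiff ℝ (⊤ : ℕ∞) g) (i : Fin n) :
    partialDeriv i (fun x => f x + g x) =
      fun x => partialDeriv i f x + partialDeriv i g x := by
  funext x
  have h1 := hf.contDiffAt.differentiableAt (x := x) (by simp)
  have h2 := hg.contDiffAt.differentiableAt (x := x) (by simp)
  simp [partialDeriv, fderiv_fun_add h1 h2]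

theorem lap_eq_sum_partialDeriv (hf : ContDiff ℝ (⊤ : ℕ∞) f) (x : EuclideanSpace ℝ (Fin n)) :
    lap n f x = ∑ i, partialDeriv i (partialDeriv i f) x := by
  refine Finset.sum_congr rfl fun i _ => ?_
  have hd : DifferentiableAt ℝ (fderiv ℝ f) x :=
    (hf.fderiv_right (m := (⊤ : ℕ∞)) (by simp)).contDiffAt.differentiableAt (by simp)
  rw [iteratedFDeriv_two_apply]
  change _ = fderiv ℝ (fun y => fderiv ℝ f y (EuclideanSpace.single i 1)) x _
  rw [fderiv_clm_apply hd (differentiableAt_const _)]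
  simp

theorem contDiff_lap (hf : ContDiff ℝ (⊤ : ℕ∞) f) : ContDiff ℝ (⊤ : ℕ∞) (lap n f) := by
  rw [funext (lap_eq_sum_partialDeriv hf)]
  exact ContDiff.sum fun i _ => contDiff_partialDeriv (contDiff_partialDeriv hf i) i

theorem hasCompactSupport_lap (hf : ContDiff ℝ (⊤ : ℕ∞) f) (hc : HasCompactSupport f) :
    HasCompactSupport (lap n f) := by
  refine HasCompactSupport.of_support_subset_isCompact hc fun x hx => ?_
  contrapose! hx
  have (i : Fin n) : partialDeriv i (partialDeriv i f) x = 0 :=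
    image_eq_zero_of_notMem_tsupport fun h =>
      hx (tsupport_fderiv_apply_subset ℝ _ (tsupport_fderiv_apply_subset ℝ _ h))
  simp [lap_eq_sum_partialDeriv hf, this]

theorem lap_mul (hf : ContDiff ℝ (⊤ : ℕ∞) f) (hg : ContDiff ℝ (⊤ : ℕ∞) g)
    (x : EuclideanSpace ℝ (Fin n)) :
    lap n (fun x => f x * g x) x = f x * lap n g x + 2 * gradDot f g x + g x * lap n f x := by
  rw [lap_eq_sum_partialDeriv (hf.mul hg), lap_eq_sum_partialDeriv hf, lap_eq_sum_partialDeriv hg,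
    gradDot, Finset.mul_sum, Finset.mul_sum, Finset.mul_sum, ← Finset.sum_add_distrib,
    ← Finset.sum_add_distrib]
  refine Finset.sum_congr rfl fun i _ => ?_
  have hf' := contDiff_partialDeriv hf i
  have hg' := contDiff_partialDeriv hg i
  rw [partialDeriv_mul hf hg, partialDeriv_add (hf.mul hg') (hg.mul hf'), partialDeriv_mul hf hg',
    partialDeriv_mul hg hf']
  ring

theorem gradDot_mul_right (hg : ContDiff ℝ (⊤ : ℕ∞) g) (hh : ContDiff ℝ (⊤ : ℕ∞) h)
    (x : EuclideanSpace ℝ (Fin n)) :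
    gradDot f (fun x => g x * h x) x = g x * gradDot f h x + h x * gradDot f g x := by
  simp only [gradDot, Finset.mul_sum, ← Finset.sum_add_distrib]
  refine Finset.sum_congr rfl fun i _ => ?_
  rw [partialDeriv_mul hg hh]
  ring

theorem gradDot_self_nonneg (f : EuclideanSpace ℝ (Fin n) → ℝ) (x : EuclideanSpace ℝ (Fin n)) :
    0 ≤ gradDot f f x :=
  Finset.sum_nonneg fun _ _ => mul_self_nonneg _

theorem gradDot_sq_le (f g : EuclideanSpace ℝ (Fin n) → ℝ) (x : EuclideanSpace ℝ (Fin n)) :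
    gradDot f g x ^ 2 ≤ gradDot f f x * gradDot g g x := by
  simpa [gradDot, sq] using Finset.sum_mul_sq_le_sq_mul_sq Finset.univ
    (fun i => partialDeriv i f x) (fun i => partialDeriv i g x)

theorem norm_gradient_sq (f : EuclideanSpace ℝ (Fin n) → ℝ) (x : EuclideanSpace ℝ (Fin n)) :
    ‖gradient f x‖ ^ 2 = gradDot f f x := by
  rw [EuclideanSpace.norm_sq_eq]
  refine Finset.sum_congr rfl fun i _ => ?_
  have : gradient f x i = partialDeriv i f x := by
    rw [partialDeriv, ← InnerProductSpace.toDual_symm_apply (𝕜 := ℝ), EuclideanSpace.inner_single_right]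
    simp [gradient]
  rw [this, Real.norm_eq_abs, sq_abs, sq]

theorem integral_mul_partialDeriv (hf : ContDiff ℝ (⊤ : ℕ∞) f) (hg : ContDiff ℝ (⊤ : ℕ∞) g)
    (hc : HasCompactSupport f) (i : Fin n) :
    ∫ x, f x * partialDeriv i g x = -∫ x, partialDeriv i f x * g x := by
  have hf' : HasCompactSupport (partialDeriv i f) := hc.fderiv_apply (𝕜 := ℝ) _
  exact integral_mul_fderiv_eq_neg_fderiv_mul_of_integrable
    (((contDiff_partialDeriv hf i).continuous.mul hg.continuous).integrable_of_hasCompactSupport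
      hf'.mul_right)
    ((hf.continuous.mul (contDiff_partialDeriv hg i).continuous).integrable_of_hasCompactSupport
      hc.mul_right)
    ((hf.continuous.mul hg.continuous).integrable_of_hasCompactSupport hc.mul_right)
    (fun x _ => hf.contDiffAt.differentiableAt (by simp))
    (fun x _ => hg.contDiffAt.differentiableAt (by simp))

theorem integral_mul_lap (hf : ContDiff ℝ (⊤ : ℕ∞) f) (hg : ContDiff ℝ (⊤ : ℕ∞) g)
    (hc : HasCompactSupport f) :
    ∫ x, f x * lap n g x = ∫ x, lap n f x * g x := by
  have hc1 (i : Fin n) : HasCompactSupport (partialDeriv i f) := hc.fderiv_apply (𝕜 := ℝ) _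
  have hc2 (i : Fin n) : HasCompactSupport (partialDeriv i (partialDeriv i f)) :=
    (hc1 i).fderiv_apply (𝕜 := ℝ) _
  simp only [lap_eq_sum_partialDeriv hf, lap_eq_sum_partialDeriv hg, Finset.mul_sum,
    Finset.sum_mul]
  rw [integral_finsetSum, integral_finsetSum]
  · refine Finset.sum_congr rfl fun i _ => ?_
    rw [integral_mul_partialDeriv hf (contDiff_partialDeriv hg i) hc,
      integral_mul_partialDeriv (contDiff_partialDeriv hf i) hg (hc1 i), neg_neg]
  · exact fun i _ => ((contDiff_partialDeriv (contDiff_partialDeriv hf i) i).continuous.mul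
      hg.continuous).integrable_of_hasCompactSupport (hc2 i).mul_right
  · exact fun i _ => (hf.continuous.mul (contDiff_partialDeriv (contDiff_partialDeriv hg i)
      i).continuous).integrable_of_hasCompactSupport hc.mul_right

theorem integral_gradDot_self_mul (hf : ContDiff ℝ (⊤ : ℕ∞) f) (hg : ContDiff ℝ (⊤ : ℕ∞) g)
    (hc : HasCompactSupport g) :
    ∫ x, gradDot f f x * g x = ∫ x, (-(f x * lap n f x * g x) + 1 / 2 * f x ^ 2 * lap n g x) := by
  have key := integral_mul_lap hg (hf.mul hf) hc
  have hl := (contDiff_lap hf).continuous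
  have hG := (contDiff_gradDot hf hf).continuous
  have hlg := hasCompactSupport_lap hg hc
  have h1 : Integrable fun x => gradDot f f x * g x :=
    (hG.mul hg.continuous).integrable_of_hasCompactSupport hc.mul_left
  have h2 : Integrable fun x => f x * lap n f x * g x :=
    ((hf.continuous.mul hl).mul hg.continuous).integrable_of_hasCompactSupport hc.mul_left
  have h3 : Integrable fun x => 1 / 2 * f x ^ 2 * lap n g x :=
    ((continuous_const.mul (hf.continuous.pow 2)).mul
      (contDiff_lap hg).continuous).integrable_of_hasCompactSupport hlg.mul_left
  have e1 : ∀ x, g x * lap n (fun x => f x * f x) x =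
      2 * (f x * lap n f x * g x) + 2 * (gradDot f f x * g x) := fun x => by
    rw [lap_mul hf hf]; ring
  have e2 : ∀ x, lap n g x * (f x * f x) = 2 * (1 / 2 * f x ^ 2 * lap n g x) := fun x => by ring
  simp only [e1, e2] at key
  rw [integral_add (h2.const_mul 2) (h1.const_mul 2), integral_const_mul, integral_const_mul,
    integral_const_mul] at key
  have h4 : Integrable fun x => -(f x * lap n f x * g x) := h2.neg
  rw [integral_add h4 h3, integral_neg]
  linarith

end Calculus

section Cutoff

variable {n : ℕ} {φ h q : EuclideanSpace ℝ (Fin n) → ℝ}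

theorem exists_partialDeriv_pow_mul (hφ : ContDiff ℝ (⊤ : ℕ∞) φ) (hh : ContDiff ℝ (⊤ : ℕ∞) h)
    (k : ℕ) (i : Fin n) : ∃ q : EuclideanSpace ℝ (Fin n) → ℝ, ContDiff ℝ (⊤ : ℕ∞) q ∧
      partialDeriv i (fun x => φ x ^ (k + 1) * h x) = fun x => φ x ^ k * q x := by
  refine ⟨fun x => φ x * partialDeriv i h x + (k + 1) * h x * partialDeriv i φ x,
    (hφ.mul (contDiff_partialDeriv hh i)).add ((contDiff_const.mul hh).mul
      (contDiff_partialDeriv hφ i)), ?_⟩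
  rw [partialDeriv_mul (hφ.pow _) hh]
  funext x
  have hd := hφ.contDiffAt.differentiableAt (x := x) (by simp)
  have : partialDeriv i (fun x => φ x ^ (k + 1)) x = (k + 1) * φ x ^ k * partialDeriv i φ x := by
    simp [partialDeriv, fderiv_fun_pow (k + 1) hd]
  rw [this]
  ring

theorem exists_lap_pow_mul (hφ : ContDiff ℝ (⊤ : ℕ∞) φ) (hh : ContDiff ℝ (⊤ : ℕ∞) h)
    (k : ℕ) : ∃ q : EuclideanSpace ℝ (Fin n) → ℝ, ContDiff ℝ (⊤ : ℕ∞) q ∧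
      lap n (fun x => φ x ^ (k + 2) * h x) = fun x => φ x ^ k * q x := by
  choose q hq hq' using exists_partialDeriv_pow_mul hφ hh (k + 1)
  choose s hs hs' using fun i => exists_partialDeriv_pow_mul hφ (hq i) k i
  refine ⟨fun x => ∑ i, s i x, ContDiff.sum fun i _ => hs i, ?_⟩
  funext x
  rw [lap_eq_sum_partialDeriv ((hφ.pow _).mul hh), Finset.mul_sum]
  refine Finset.sum_congr rfl fun i _ => ?_
  rw [hq' i, hs' i]

theorem exists_gradDot_pow (hφ : ContDiff ℝ (⊤ : ℕ∞) φ) (k : ℕ) :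
    ∃ q : EuclideanSpace ℝ (Fin n) → ℝ, ContDiff ℝ (⊤ : ℕ∞) q ∧
      gradDot (fun x => φ x ^ (k + 1)) (fun x => φ x ^ (k + 1)) =
        fun x => φ x ^ (2 * k) * q x := by
  choose q hq hq' using
    exists_partialDeriv_pow_mul hφ (contDiff_const (c := (1 : ℝ))) k
  simp only [mul_one] at hq'
  refine ⟨fun x => ∑ i, q i x * q i x, ContDiff.sum fun i _ => (hq i).mul (hq i), ?_⟩
  funext x
  rw [gradDot, Finset.mul_sum]
  refine Finset.sum_congr rfl fun i _ => ?_
  rw [hq' i]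
  ring

theorem exists_abs_pow_mul_le (hc : HasCompactSupport φ) (h0 : ∀ x, 0 ≤ φ x) (hq : Continuous q)
    {k : ℕ} (hk : k ≠ 0) : ∃ K : ℝ, ∀ x, |φ x ^ k * q x| ≤ K * φ x ^ k := by
  obtain ⟨K, hK⟩ := hc.isCompact.exists_bound_of_continuousOn hq.continuousOn
  refine ⟨K, fun x => ?_⟩
  by_cases hx : x ∈ tsupport φ
  · rw [abs_mul, abs_of_nonneg (pow_nonneg (h0 x) k), mul_comm]
    exact mul_le_mul_of_nonneg_right (hK x hx) (pow_nonneg (h0 x) k)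
  · simp [image_eq_zero_of_notMem_tsupport hx, hk]

/-- `φ` is a smooth cutoff function between the balls of radius `1` and `2`, such that the
derivatives of its power `φ ^ (k + 2)` are controlled by lower powers of `φ`. -/
structure IsPowerCutoff {n : ℕ} (k : ℕ) (K : ℝ) (φ : EuclideanSpace ℝ (Fin n) → ℝ) : Prop where
  contDiff : ContDiff ℝ (⊤ : ℕ∞) φ
  hasCompactSupport : HasCompactSupport φ
  nonneg : ∀ x, 0 ≤ φ x
  le_one : ∀ x, φ x ≤ 1
  eq_one : ∀ x ∈ ball (0 : EuclideanSpace ℝ (Fin n)) 1, φ x = 1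
  eq_zero : ∀ x ∉ ball (0 : EuclideanSpace ℝ (Fin n)) 2, φ x = 0
  const_nonneg : 0 ≤ K
  gradDot_le : ∀ x, gradDot (fun y => φ y ^ (k + 2)) (fun y => φ y ^ (k + 2)) x ≤
    K * φ x ^ (2 * k + 2)
  abs_lap_le : ∀ x, |lap n (fun y => φ y ^ (k + 2)) x| ≤ K * φ x ^ k
  abs_lap_gradDot_le : ∀ x,
    |lap n (gradDot (fun y => φ y ^ (k + 2)) (fun y => φ y ^ (k + 2))) x| ≤ K * φ x ^ (2 * k)
  abs_lap_sq_le : ∀ x, |lap n (fun y => (φ y ^ (k + 2)) ^ 2) x| ≤ K * φ x ^ (2 * k)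

theorem exists_isPowerCutoff (n : ℕ) {k : ℕ} (hk : k ≠ 0) :
    ∃ (K : ℝ) (φ : EuclideanSpace ℝ (Fin n) → ℝ), IsPowerCutoff k K φ := by
  let b : ContDiffBump (0 : EuclideanSpace ℝ (Fin n)) := ⟨1, 2, one_pos, one_lt_two⟩
  have hφ : ContDiff ℝ (⊤ : ℕ∞) b := b.contDiff
  have hc : HasCompactSupport b := b.hasCompactSupport
  have h0 : ∀ x, 0 ≤ b x := fun x => b.nonneg
  obtain ⟨q₁, hq₁, e₁⟩ := exists_gradDot_pow hφ (k + 1)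
  obtain ⟨q₂, hq₂, e₂⟩ := exists_lap_pow_mul hφ (contDiff_const (c := (1 : ℝ))) k
  obtain ⟨q₃, hq₃, e₃⟩ := exists_lap_pow_mul hφ hq₁ (2 * k)
  obtain ⟨q₄, hq₄, e₄⟩ := exists_lap_pow_mul hφ (hφ.pow 2) (2 * k)
  obtain ⟨K₁, hK₁⟩ := exists_abs_pow_mul_le hc h0 hq₁.continuous (k := 2 * k + 2) (by lia)
  obtain ⟨K₂, hK₂⟩ := exists_abs_pow_mul_le hc h0 hq₂.continuous hk
  obtain ⟨K₃, hK₃⟩ := exists_abs_pow_mul_le hc h0 hq₃.continuous (k := 2 * k) (by lia)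
  obtain ⟨K₄, hK₄⟩ := exists_abs_pow_mul_le hc h0 hq₄.continuous (k := 2 * k) (by lia)
  have mono {K : ℝ} (hK : K ≤ |K₁| + |K₂| + |K₃| + |K₄|) (m : ℕ) (x) :
      K * b x ^ m ≤ (|K₁| + |K₂| + |K₃| + |K₄|) * b x ^ m :=
    mul_le_mul_of_nonneg_right hK (pow_nonneg (h0 x) m)
  have n₁ := abs_nonneg K₁
  have n₂ := abs_nonneg K₂
  have n₃ := abs_nonneg K₃
  have n₄ := abs_nonneg K₄
  refine ⟨|K₁| + |K₂| + |K₃| + |K₄|, b, hφ, hc, h0, fun x => b.le_one,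
    fun x hx => b.one_of_mem_closedBall (ball_subset_closedBall hx), fun x hx => ?_, by positivity,
    fun x => ?_, fun x => ?_, fun x => ?_, fun x => ?_⟩
  · exact b.zero_of_le_dist (by simpa [b] using hx)
  · rw [e₁]
    exact ((le_abs_self _).trans (hK₁ x)).trans (mono (by linarith [le_abs_self K₁]) _ x)
  · simp only [mul_one] at e₂
    rw [e₂]
    exact (hK₂ x).trans (mono (by linarith [le_abs_self K₂]) _ x)
  · rw [e₁, mul_add, mul_one, e₃]
    exact (hK₃ x).trans (mono (by linarith [le_abs_self K₃]) _ x)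
  · have : (fun y => (b y ^ (k + 2)) ^ 2) = fun y => b y ^ (2 * k + 2) * b y ^ 2 := by
      funext y
      ring
    rw [this, e₄]
    exact (hK₄ x).trans (mono (by linarith [le_abs_self K₄]) _ x)

end Cutoff

section Energy

variable {n k : ℕ} {a p K : ℝ} {φ u : EuclideanSpace ℝ (Fin n) → ℝ}

/-- Young's inequality in the form used to bound the terms `u Δu |∇η|²`. -/
theorem abs_mul_abs_mul_le {δ K s t : ℝ} (hδ : 0 < δ) :
    K * (s * t) ≤ δ * s ^ 2 + K ^ 2 / (4 * δ) * t ^ 2 := by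
  have : δ * s ^ 2 + K ^ 2 / (4 * δ) * t ^ 2 - K * (s * t) = δ * (s - K / (2 * δ) * t) ^ 2 := by
    field_simp
    ring
  nlinarith [mul_nonneg hδ.le (sq_nonneg (s - K / (2 * δ) * t))]

theorem IsPowerCutoff.abs_mul_lap_mul_gradDot_le (hφ : IsPowerCutoff k K φ) {δ : ℝ} (hδ : 0 < δ)
    (x : EuclideanSpace ℝ (Fin n)) :
    |u x * lap n u x * gradDot (fun y => φ y ^ (k + 2)) (fun y => φ y ^ (k + 2)) x| ≤
      δ * ((φ x ^ (k + 2)) ^ 2 * lap n u x ^ 2) +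
        K ^ 2 / (4 * δ) * (u x ^ 2 * φ x ^ (2 * k)) := by
  have hg := gradDot_self_nonneg (fun y => φ y ^ (k + 2)) x
  calc _ = |u x| * |lap n u x| * gradDot (fun y => φ y ^ (k + 2)) (fun y => φ y ^ (k + 2)) x := by
        rw [abs_mul, abs_mul, abs_of_nonneg hg]
    _ ≤ |u x| * |lap n u x| * (K * φ x ^ (2 * k + 2)) :=
        mul_le_mul_of_nonneg_left (hφ.gradDot_le x) (by positivity)
    _ = K * ((φ x ^ (k + 2) * |lap n u x|) * (φ x ^ k * |u x|)) := by ring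
    _ ≤ δ * (φ x ^ (k + 2) * |lap n u x|) ^ 2 + K ^ 2 / (4 * δ) * (φ x ^ k * |u x|) ^ 2 :=
        abs_mul_abs_mul_le hδ
    _ = _ := by
        rw [mul_pow, mul_pow, sq_abs, sq_abs]
        ring

theorem IsPowerCutoff.sq_mul_lap_sq_le (hφ : IsPowerCutoff k K φ) (x : EuclideanSpace ℝ (Fin n)) :
    u x ^ 2 * lap n (fun y => φ y ^ (k + 2)) x ^ 2 ≤ K ^ 2 * (u x ^ 2 * φ x ^ (2 * k)) := by
  have h : lap n (fun y => φ y ^ (k + 2)) x ^ 2 ≤ (K * φ x ^ k) ^ 2 :=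
    sq_le_sq.2 ((hφ.abs_lap_le x).trans (le_abs_self _))
  calc _ ≤ u x ^ 2 * (K * φ x ^ k) ^ 2 := mul_le_mul_of_nonneg_left h (sq_nonneg _)
    _ = _ := by ring

theorem hasCompactSupport_pow {f : EuclideanSpace ℝ (Fin n) → ℝ} (hf : HasCompactSupport f)
    {m : ℕ} (hm : m ≠ 0) : HasCompactSupport fun x => f x ^ m :=
  hf.comp_left (g := fun t : ℝ => t ^ m) (by simp [hm])

theorem lap_mul_sq (hu : ContDiff ℝ (⊤ : ℕ∞) u) {η : EuclideanSpace ℝ (Fin n) → ℝ}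
    (hη : ContDiff ℝ (⊤ : ℕ∞) η) (x : EuclideanSpace ℝ (Fin n)) :
    lap n (fun y => u y * (η y * η y)) x = η x ^ 2 * lap n u x + 4 * η x * gradDot u η x +
      2 * u x * η x * lap n η x + 2 * u x * gradDot η η x := by
  rw [lap_mul hu (hη.mul hη), lap_mul hη hη, gradDot_mul_right hη hη]
  ring

theorem IsPowerCutoff.lap_mul_sq_le (hφ : IsPowerCutoff k K φ) (hu : ContDiff ℝ (⊤ : ℕ∞) u)
    {η : EuclideanSpace ℝ (Fin n) → ℝ} (hη : η = fun y => φ y ^ (k + 2)) {δ : ℝ} (hδ : 0 < δ)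
    (x : EuclideanSpace ℝ (Fin n)) :
    lap n (fun y => u y * η y) x ^ 2 ≤ lap n (fun y => u y * (η y * η y)) x * lap n u x +
      8 * (gradDot u u x * gradDot η η x) +
      (2 * K ^ 2 + 2 * (K ^ 2 / (4 * δ))) * (u x ^ 2 * φ x ^ (2 * k)) +
      2 * δ * (η x ^ 2 * lap n u x ^ 2) := by
  have h1 := (abs_le.1 (hφ.abs_mul_lap_mul_gradDot_le (u := u) hδ x)).1
  have h2 := hφ.sq_mul_lap_sq_le (u := u) x
  have h3 := gradDot_sq_le u η x
  have hs : ContDiff ℝ (⊤ : ℕ∞) η := hη ▸ hφ.contDiff.pow _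
  have h4 : (φ x ^ (k + 2)) ^ 2 = η x ^ 2 := by rw [hη]
  rw [h4] at h1
  rw [← hη] at h1 h2
  rw [lap_mul_sq hu hs, lap_mul hu hs]
  have h5 := sq_nonneg (2 * gradDot u η x - u x * lap n η x)
  generalize K ^ 2 / (4 * δ) = M at *
  linear_combination h5 + 2 * h1 + 8 * h3 + 2 * h2

theorem IsPowerCutoff.le_lap_mul_lap (hφ : IsPowerCutoff k K φ) (hu : ContDiff ℝ (⊤ : ℕ∞) u)
    {η : EuclideanSpace ℝ (Fin n) → ℝ} (hη : η = fun y => φ y ^ (k + 2)) {δ : ℝ} (hδ : 0 < δ)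
    (x : EuclideanSpace ℝ (Fin n)) :
    1 / 2 * (η x ^ 2 * lap n u x ^ 2) ≤ lap n (fun y => u y * (η y * η y)) x * lap n u x +
      16 * (gradDot u u x * gradDot η η x) +
      (4 * K ^ 2 + 2 * (K ^ 2 / (4 * δ))) * (u x ^ 2 * φ x ^ (2 * k)) +
      2 * δ * (η x ^ 2 * lap n u x ^ 2) := by
  have h1 := (abs_le.1 (hφ.abs_mul_lap_mul_gradDot_le (u := u) hδ x)).1
  have h2 := hφ.sq_mul_lap_sq_le (u := u) x
  have h3 := gradDot_sq_le u η x
  have hs : ContDiff ℝ (⊤ : ℕ∞) η := hη ▸ hφ.contDiff.pow _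
  have h4 : (φ x ^ (k + 2)) ^ 2 = η x ^ 2 := by rw [hη]
  rw [h4] at h1
  rw [← hη] at h1 h2
  rw [lap_mul_sq hu hs]
  have h5 := sq_nonneg (1 / 2 * (η x * lap n u x) + 4 * gradDot u η x)
  have h6 := sq_nonneg (1 / 2 * (η x * lap n u x) + 2 * (u x * lap n η x))
  generalize K ^ 2 / (4 * δ) = M at *
  linear_combination h5 + h6 + 2 * h1 + 16 * h3 + 4 * h2

theorem integral_le_linear_combination {A B P U X : EuclideanSpace ℝ (Fin n) → ℝ} {c₁ c₂ c₃ : ℝ}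
    (hA : Integrable A) (hB : Integrable B) (hP : Integrable P) (hU : Integrable U)
    (hX : Integrable X) (h : ∀ x, B x ≤ A x + c₁ * P x + c₂ * U x + c₃ * X x) :
    ∫ x, B x ≤ (∫ x, A x) + c₁ * (∫ x, P x) + c₂ * (∫ x, U x) + c₃ * ∫ x, X x := by
  have h1 := hA.add (hP.const_mul c₁)
  have h2 := h1.add (hU.const_mul c₂)
  refine (integral_mono hB (h2.add (hX.const_mul c₃)) h).trans_eq ?_
  rw [integral_add' h2 (hX.const_mul c₃), integral_add' h1 (hU.const_mul c₂),
    integral_add' hA (hP.const_mul c₁), integral_const_mul, integral_const_mul,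
    integral_const_mul]

theorem exists_energy_constants (hp : 1 < p) (hK : 0 ≤ K) :
    ∃ δ C : ℝ, 0 < δ ∧ 0 ≤ C ∧ ∀ X U E P : ℝ, 0 ≤ U →
      P ≤ δ * X + (K ^ 2 / (4 * δ) + K / 2) * U →
      p * E ≤ E + 8 * P + (2 * K ^ 2 + 2 * (K ^ 2 / (4 * δ))) * U + 2 * δ * X →
      1 / 2 * X ≤ E + 16 * P + (4 * K ^ 2 + 2 * (K ^ 2 / (4 * δ))) * U + 2 * δ * X →
      X ≤ C * U ∧ E ≤ C * U := by
  have hp1 : 0 < p - 1 := by linarith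
  obtain ⟨c, hc⟩ : ∃ c, c = (p - 1)⁻¹ := ⟨_, rfl⟩
  have hc0 : 0 < c := hc ▸ inv_pos.2 hp1
  obtain ⟨δ, hδ_def⟩ : ∃ δ, δ = 1 / (4 * (10 * c + 18)) := ⟨_, rfl⟩
  have hδ : 0 < δ := by rw [hδ_def]; positivity
  have hδ' : (10 * c + 18) * δ = 1 / 4 := by
    rw [hδ_def]
    field_simp
  refine ⟨δ, ?_⟩
  have hM0 : 0 ≤ K ^ 2 / (4 * δ) := by positivity
  generalize K ^ 2 / (4 * δ) = M at *
  obtain ⟨c₁, hc₁⟩ : ∃ c₁, c₁ = 10 * M + 4 * K + 2 * K ^ 2 := ⟨_, rfl⟩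
  obtain ⟨c₂, hc₂⟩ : ∃ c₂, c₂ = 18 * M + 8 * K + 4 * K ^ 2 := ⟨_, rfl⟩
  have hc₁0 : 0 ≤ c₁ := by rw [hc₁]; positivity
  have hc₂0 : 0 ≤ c₂ := by rw [hc₂]; positivity
  obtain ⟨C₁, hC₁⟩ : ∃ C₁, C₁ = 4 * (c * c₁ + c₂) := ⟨_, rfl⟩
  have hC₁0 : 0 ≤ C₁ := by rw [hC₁]; positivity
  refine ⟨C₁ + c * (10 * δ * C₁ + c₁), hδ, by positivity, fun X U E P hU0 eP eB eX => ?_⟩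
  have eE : E ≤ c * (10 * δ * X + c₁ * U) := by
    have : (p - 1) * E ≤ 10 * δ * X + c₁ * U := by
      rw [hc₁]
      linarith
    rw [hc, inv_mul_eq_div, le_div_iff₀ hp1]
    linarith
  have hX1 : X ≤ C₁ * U := by
    have h1 : 1 / 2 * X ≤ ((10 * c + 18) * δ) * X + (c * c₁ + c₂) * U := by
      rw [hc₂]
      linarith
    rw [hδ'] at h1
    rw [hC₁]
    linarith
  have hE1 : E ≤ c * (10 * δ * C₁ + c₁) * U := by
    refine eE.trans ?_
    have := mul_le_mul_of_nonneg_left hX1 (by positivity : 0 ≤ c * (10 * δ))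
    linarith
  have h1 := mul_nonneg hC₁0 hU0
  have h2 : 0 ≤ c * (10 * δ * C₁ + c₁) * U := by positivity
  constructor <;> linarith

theorem IsPowerCutoff.energy_estimate (hφ : IsPowerCutoff k K φ) (hk : k ≠ 0)
    (hp : 1 < p) : ∃ C : ℝ, 0 ≤ C ∧ ∀ u : EuclideanSpace ℝ (Fin n) → ℝ,
      ContDiff ℝ (⊤ : ℕ∞) u → IsSolutionOn n a p u Set.univ → StableOn n a p u Set.univ →
      (∫ x, (φ x ^ (k + 2)) ^ 2 * lap n u x ^ 2) ≤ C * ∫ x, u x ^ 2 * φ x ^ (2 * k) ∧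
      (∫ x, ‖x‖ ^ a * |u x| ^ (p - 1) * (u x * φ x ^ (k + 2)) ^ 2) ≤
        C * ∫ x, u x ^ 2 * φ x ^ (2 * k) := by
  obtain ⟨δ, C, hδ, hC, key⟩ := exists_energy_constants hp hφ.const_nonneg
  refine ⟨C, hC, fun u hu hsol hst => ?_⟩
  obtain ⟨η, hη_def⟩ : ∃ η : EuclideanSpace ℝ (Fin n) → ℝ, η = fun y => φ y ^ (k + 2) := ⟨_, rfl⟩
  have hη : ContDiff ℝ (⊤ : ℕ∞) η := hη_def ▸ hφ.contDiff.pow _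
  have hηc : HasCompactSupport η := hη_def ▸
    hasCompactSupport_pow hφ.hasCompactSupport (by lia)
  have hφc : HasCompactSupport fun y => φ y ^ (2 * k) :=
    hasCompactSupport_pow hφ.hasCompactSupport (by lia)
  obtain ⟨g, hg_def⟩ : ∃ g, g = gradDot η η := ⟨_, rfl⟩
  have hg : ContDiff ℝ (⊤ : ℕ∞) g := hg_def ▸ contDiff_gradDot hη hη
  have hgc : HasCompactSupport g := by
    refine HasCompactSupport.of_support_subset_isCompact hηc fun x hx => ?_
    contrapose! hx
    have (i : Fin n) : partialDeriv i η x = 0 :=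
      image_eq_zero_of_notMem_tsupport fun h => hx (tsupport_fderiv_apply_subset ℝ _ h)
    simp [hg_def, gradDot, this]
  have hLu := contDiff_lap hu
  have huη : ContDiff ℝ (⊤ : ℕ∞) fun x => u x * η x := hu.mul hη
  have huηη : ContDiff ℝ (⊤ : ℕ∞) fun x => u x * (η x * η x) := hu.mul (hη.mul hη)
  have huηc : HasCompactSupport fun x => u x * η x := hηc.mul_left
  have huηηc : HasCompactSupport fun x => u x * (η x * η x) := hηc.mul_left.mul_left
  have iX : Integrable fun x => η x ^ 2 * lap n u x ^ 2 :=
    ((hη.continuous.pow 2).mul (hLu.continuous.pow 2)).integrable_of_hasCompactSupport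
      (hasCompactSupport_pow hηc two_ne_zero).mul_right
  have iU : Integrable fun x => u x ^ 2 * φ x ^ (2 * k) :=
    ((hu.continuous.pow 2).mul (hφ.contDiff.continuous.pow _)).integrable_of_hasCompactSupport
      hφc.mul_left
  have iP : Integrable fun x => gradDot u u x * g x :=
    ((contDiff_gradDot hu hu).continuous.mul hg.continuous).integrable_of_hasCompactSupport
      hgc.mul_left
  have iA : Integrable fun x => lap n (fun y => u y * (η y * η y)) x * lap n u x :=
    ((contDiff_lap huηη).continuous.mul hLu.continuous).integrable_of_hasCompactSupport
      (hasCompactSupport_lap huηη huηηc).mul_right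
  have iB : Integrable fun x => lap n (fun y => u y * η y) x ^ 2 :=
    ((contDiff_lap huη).continuous.pow 2).integrable_of_hasCompactSupport
      (hasCompactSupport_pow (hasCompactSupport_lap huη huηc) two_ne_zero)
  have iQ : Integrable fun x => -(u x * lap n u x * g x) + 1 / 2 * u x ^ 2 * lap n g x := by
    refine Integrable.add (Continuous.integrable_of_hasCompactSupport ?_ ?_)
      (Continuous.integrable_of_hasCompactSupport ?_ ?_)
    · exact ((hu.continuous.mul hLu.continuous).mul hg.continuous).neg
    · exact (hgc.mul_left (f := fun x => u x * lap n u x)).neg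
    · exact (continuous_const.mul (hu.continuous.pow 2)).mul (contDiff_lap hg).continuous
    · exact (hasCompactSupport_lap hg hgc).mul_left
  have eA : ∫ x, ‖x‖ ^ a * |u x| ^ (p - 1) * (u x * η x) ^ 2 =
      ∫ x, lap n (fun y => u y * (η y * η y)) x * lap n u x := by
    rw [← integral_mul_lap huηη hLu huηηc]
    refine integral_congr_ae (ae_of_all _ fun x => ?_)
    simp only [hsol x (Set.mem_univ x)]
    ring
  have eη (x) : φ x ^ (k + 2) = η x := by rw [hη_def]
  simp only [eη]
  refine key _ _ _ (∫ x, gradDot u u x * g x) (integral_nonneg fun x =>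
    mul_nonneg (sq_nonneg _) (pow_nonneg (hφ.nonneg x) _)) ?_
    ((hst _ huη huηc (Set.subset_univ _)).trans ?_) ?_
  · rw [integral_gradDot_self_mul hu hg hgc, ← integral_const_mul,
      ← integral_const_mul, ← integral_add (iX.const_mul _) (iU.const_mul _)]
    refine integral_mono iQ ((iX.const_mul _).add (iU.const_mul _)) fun x => ?_
    have h1 := (abs_le.1 (hφ.abs_mul_lap_mul_gradDot_le (u := u) hδ x)).1
    have h2 : u x ^ 2 * lap n g x ≤ u x ^ 2 * (K * φ x ^ (2 * k)) := by
      rw [hg_def, hη_def]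
      exact mul_le_mul_of_nonneg_left ((le_abs_self _).trans (hφ.abs_lap_gradDot_le x))
        (sq_nonneg _)
    rw [eη, ← hη_def, ← hg_def] at h1
    generalize K ^ 2 / (4 * δ) = M at *
    linear_combination h1 + 1 / 2 * h2
  · rw [eA]
    exact integral_le_linear_combination iA iB iP iU iX fun x =>
      hg_def ▸ hφ.lap_mul_sq_le hu hη_def hδ x
  · rw [eA, ← integral_const_mul (1 / 2 : ℝ)]
    exact integral_le_linear_combination iA (iX.const_mul _) iP iU iX fun x =>
      hg_def ▸ hφ.le_lap_mul_lap hu hη_def hδ x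

end Energy

section UnitBall

variable {n k : ℕ} {a p K : ℝ} {φ : EuclideanSpace ℝ (Fin n) → ℝ}

theorem sq_mul_pow_le_add_rpow {W ε s t : ℝ} (hp : 1 < p) (hk : 4 ≤ k * (p - 1)) (hW : 0 < W)
    (hε : 0 < ε) (ht : 0 ≤ t) (hs0 : 0 ≤ s) (hs1 : s ≤ 1) :
    t ^ 2 * s ^ (2 * k) ≤
      ε * (W * t ^ (p - 1) * (t * s ^ (k + 2)) ^ 2) + (ε * W) ^ (-(2 / (p - 1))) := by
  have hp1 : 0 < p - 1 := by linarith
  have hW' : 0 < ε * W := by positivity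
  by_cases h : 1 ≤ ε * W * (t ^ (p - 1) * s ^ 4)
  · have h1 := mul_le_mul_of_nonneg_left h (by positivity : 0 ≤ t ^ 2 * s ^ (2 * k))
    have h2 : 0 ≤ (ε * W) ^ (-(2 / (p - 1))) := by positivity
    calc _ ≤ t ^ 2 * s ^ (2 * k) * (ε * W * (t ^ (p - 1) * s ^ 4)) := by linarith
      _ = ε * (W * t ^ (p - 1) * (t * s ^ (k + 2)) ^ 2) := by ring
      _ ≤ _ := by linarith
  · have h1 : (t * s ^ k) ^ (p - 1) ≤ (ε * W)⁻¹ := by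
      have h2 : (s ^ k) ^ (p - 1) ≤ s ^ 4 := by
        rcases hs0.eq_or_lt with rfl | hs
        · have : k ≠ 0 := by
            rintro rfl
            norm_num at hk
          simp [this, Real.zero_rpow hp1.ne']
        · rw [← Real.rpow_natCast s k, ← Real.rpow_mul hs0, ← Real.rpow_natCast s 4]
          exact Real.rpow_le_rpow_of_exponent_ge hs hs1 (by simpa using hk)
      rw [Real.mul_rpow ht (by positivity), ← one_div, le_div_iff₀' hW']
      exact (mul_le_mul_of_nonneg_left (mul_le_mul_of_nonneg_left h2 (by positivity)) hW'.le).trans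
        (not_le.1 h).le
    calc t ^ 2 * s ^ (2 * k) = (t * s ^ k) ^ (2 : ℝ) := by
          rw [Real.rpow_two]
          ring
      _ = ((t * s ^ k) ^ (p - 1)) ^ (2 / (p - 1)) := by
          rw [← Real.rpow_mul (by positivity), mul_div_cancel₀ _ hp1.ne']
      _ ≤ ((ε * W)⁻¹) ^ (2 / (p - 1)) := Real.rpow_le_rpow (by positivity) h1 (by positivity)
      _ = (ε * W) ^ (-(2 / (p - 1))) := by rw [Real.inv_rpow hW'.le, Real.rpow_neg hW'.le]
      _ ≤ _ := le_add_of_nonneg_left (by positivity)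

theorem integrableOn_ball_mul_norm_rpow {ε q R : ℝ} (hn : 1 ≤ n) (hε : 0 < ε)
    (hq : a * q < n) :
    IntegrableOn (fun x : EuclideanSpace ℝ (Fin n) => (ε * ‖x‖ ^ a) ^ (-q)) (ball 0 R) := by
  refine integrableOn_ball_of_norm_le_rpow (C := ε ^ (-q)) (α := a * q) (by simpa using hn)
    (by simpa using hq) (ae_of_all _ fun x => ?_) ?_
  · rw [Real.norm_of_nonneg (by positivity), Real.mul_rpow hε.le (by positivity),
      ← Real.rpow_mul (norm_nonneg x), mul_neg]
  · exact (((measurable_norm.pow_const a).const_mul ε).pow_const (-q)).aestronglyMeasurable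

theorem IsPowerCutoff.exists_integral_sq_mul_le (hφ : IsPowerCutoff k K φ) (hn : 1 ≤ n)
    (hk : 4 ≤ k * (p - 1)) (ha : 0 ≤ a) (hp : 1 < p) (hpa : a * (2 / (p - 1)) < n) {ε : ℝ}
    (hε : 0 < ε) : ∃ J : ℝ, ∀ u : EuclideanSpace ℝ (Fin n) → ℝ, Continuous u →
      ∫ x, u x ^ 2 * φ x ^ (2 * k) ≤
        ε * (∫ x, ‖x‖ ^ a * |u x| ^ (p - 1) * (u x * φ x ^ (k + 2)) ^ 2) + J := by
  have hk0 : k ≠ 0 := by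
    rintro rfl
    norm_num at hk
  have hp1 : 0 < p - 1 := by linarith
  let w : EuclideanSpace ℝ (Fin n) → ℝ := fun x => (ε * ‖x‖ ^ a) ^ (-(2 / (p - 1)))
  have hw : Integrable ((ball 0 2).indicator w) :=
    (integrable_indicator_iff measurableSet_ball).2 (integrableOn_ball_mul_norm_rpow hn hε hpa)
  refine ⟨∫ x, (ball 0 2).indicator w x, fun u hu => ?_⟩
  have hφ' := hφ.contDiff.continuous
  have iU : Integrable fun x => u x ^ 2 * φ x ^ (2 * k) :=
    ((hu.pow 2).mul (hφ'.pow _)).integrable_of_hasCompactSupport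
      (hasCompactSupport_pow hφ.hasCompactSupport (by lia)).mul_left
  have iE : Integrable fun x => ‖x‖ ^ a * |u x| ^ (p - 1) * (u x * φ x ^ (k + 2)) ^ 2 := by
    refine Continuous.integrable_of_hasCompactSupport ?_ ?_
    · exact ((continuous_norm.rpow_const fun _ => Or.inr ha).mul
        (hu.abs.rpow_const fun _ => Or.inr hp1.le)).mul ((hu.mul (hφ'.pow _)).pow 2)
    · exact (hasCompactSupport_pow (hasCompactSupport_pow hφ.hasCompactSupport
        (by lia)).mul_left two_ne_zero).mul_left
  rw [← integral_const_mul, ← integral_add (iE.const_mul ε) hw]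
  refine integral_mono_ae iU ((iE.const_mul ε).add hw) ?_
  have : Nonempty (Fin n) := ⟨⟨0, hn⟩⟩
  have h0 : ∀ᵐ x : EuclideanSpace ℝ (Fin n), x ≠ 0 :=
    compl_mem_ae_iff.2 (measure_singleton (0 : EuclideanSpace ℝ (Fin n)))
  filter_upwards [h0] with x hx
  by_cases hxb : x ∈ ball (0 : EuclideanSpace ℝ (Fin n)) 2
  · have := sq_mul_pow_le_add_rpow (W := ‖x‖ ^ a) hp hk (Real.rpow_pos_of_pos (norm_pos_iff.2 hx) a)
      hε (abs_nonneg (u x)) (hφ.nonneg x) (hφ.le_one x)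
    rw [mul_pow |u x|, sq_abs, ← mul_pow] at this
    simpa [hxb, w] using this
  · simp [hxb, hφ.eq_zero x hxb, hk0]

theorem IsPowerCutoff.exists_integral_gradDot_le (hφ : IsPowerCutoff k K φ) (hn : 1 ≤ n)
    (hk : 4 ≤ k * (p - 1)) (ha : 0 ≤ a) (hp : 1 < p) (hpa : a * (2 / (p - 1)) < n) :
    ∃ C : ℝ, 0 < C ∧ ∀ u : EuclideanSpace ℝ (Fin n) → ℝ, ContDiff ℝ (⊤ : ℕ∞) u →
      IsSolutionOn n a p u Set.univ → StableOn n a p u Set.univ →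
      ∫ x in ball (0 : EuclideanSpace ℝ (Fin n)) 1, gradDot u u x ≤ C := by
  have hk0 : k ≠ 0 := by
    rintro rfl
    norm_num at hk
  have hK := hφ.const_nonneg
  obtain ⟨C, hC, hE⟩ := hφ.energy_estimate (a := a) hk0 hp
  obtain ⟨J, hJ⟩ := hφ.exists_integral_sq_mul_le (ε := 1 / (2 * (C + 1))) hn hk ha hp hpa
    (by positivity)
  refine ⟨1 / 2 * (C * (2 * |J|)) + (1 / 2 + K / 2) * (2 * |J|) + 1, by positivity,
    fun u hu hsol hst => ?_⟩
  obtain ⟨hX, hE⟩ := hE u hu hsol hst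
  have hU0 : 0 ≤ ∫ x, u x ^ 2 * φ x ^ (2 * k) :=
    integral_nonneg fun x => mul_nonneg (sq_nonneg _) (pow_nonneg (hφ.nonneg x) _)
  have hU : ∫ x, u x ^ 2 * φ x ^ (2 * k) ≤ 2 * |J| := by
    have h1 := (hJ u hu.continuous).trans
      (add_le_add_left (mul_le_mul_of_nonneg_left hE (by positivity)) J)
    have h2 : 1 / (2 * (C + 1)) * (C * ∫ x, u x ^ 2 * φ x ^ (2 * k)) ≤
        1 / 2 * ∫ x, u x ^ 2 * φ x ^ (2 * k) := by
      rw [← mul_assoc]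
      refine mul_le_mul_of_nonneg_right ?_ hU0
      rw [one_div_mul_eq_div, div_le_div_iff₀ (by positivity) two_pos]
      linarith
    linarith [le_abs_self J]
  have hη : ContDiff ℝ (⊤ : ℕ∞) fun x => (φ x ^ (k + 2)) ^ 2 := (hφ.contDiff.pow _).pow _
  have hηc : HasCompactSupport fun x => (φ x ^ (k + 2)) ^ 2 :=
    hasCompactSupport_pow (hasCompactSupport_pow hφ.hasCompactSupport (by lia)) two_ne_zero
  have hl := (contDiff_lap hu).continuous
  have iG : Integrable fun x => gradDot u u x * (φ x ^ (k + 2)) ^ 2 :=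
    ((contDiff_gradDot hu hu).continuous.mul hη.continuous).integrable_of_hasCompactSupport
      hηc.mul_left
  have iX : Integrable fun x => (φ x ^ (k + 2)) ^ 2 * lap n u x ^ 2 :=
    (hη.continuous.mul (hl.pow 2)).integrable_of_hasCompactSupport hηc.mul_right
  have iU : Integrable fun x => u x ^ 2 * φ x ^ (2 * k) :=
    ((hu.continuous.pow 2).mul (hφ.contDiff.continuous.pow _)).integrable_of_hasCompactSupport
      (hasCompactSupport_pow hφ.hasCompactSupport (by lia)).mul_left
  have iQ : Integrable fun x => -(u x * lap n u x * (φ x ^ (k + 2)) ^ 2) +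
      1 / 2 * u x ^ 2 * lap n (fun y => (φ y ^ (k + 2)) ^ 2) x := by
    refine Integrable.add (Continuous.integrable_of_hasCompactSupport ?_ ?_)
      (Continuous.integrable_of_hasCompactSupport ?_ ?_)
    · exact ((hu.continuous.mul hl).mul hη.continuous).neg
    · exact (hηc.mul_left (f := fun x => u x * lap n u x)).neg
    · exact (continuous_const.mul (hu.continuous.pow 2)).mul (contDiff_lap hη).continuous
    · exact (hasCompactSupport_lap hη hηc).mul_left
  calc ∫ x in ball (0 : EuclideanSpace ℝ (Fin n)) 1, gradDot u u x
      = ∫ x in ball (0 : EuclideanSpace ℝ (Fin n)) 1, gradDot u u x * (φ x ^ (k + 2)) ^ 2 :=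
        setIntegral_congr_fun measurableSet_ball fun x hx => by simp [hφ.eq_one x hx]
    _ ≤ ∫ x, gradDot u u x * (φ x ^ (k + 2)) ^ 2 :=
        setIntegral_le_integral iG
          (ae_of_all _ fun x => mul_nonneg (gradDot_self_nonneg u x) (sq_nonneg _))
    _ = ∫ x, (-(u x * lap n u x * (φ x ^ (k + 2)) ^ 2) +
          1 / 2 * u x ^ 2 * lap n (fun y => (φ y ^ (k + 2)) ^ 2) x) :=
        integral_gradDot_self_mul hu hη hηc
    _ ≤ ∫ x, (1 / 2 * ((φ x ^ (k + 2)) ^ 2 * lap n u x ^ 2) +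
          (1 / 2 + K / 2) * (u x ^ 2 * φ x ^ (2 * k))) := by
        refine integral_mono iQ ((iX.const_mul _).add (iU.const_mul _)) fun x => ?_
        have h1 : u x ^ 2 * lap n (fun y => (φ y ^ (k + 2)) ^ 2) x ≤
            u x ^ 2 * (K * φ x ^ (2 * k)) :=
          mul_le_mul_of_nonneg_left ((le_abs_self _).trans (hφ.abs_lap_sq_le x)) (sq_nonneg _)
        have h2 : u x ^ 2 * (φ x ^ (k + 2)) ^ 2 ≤ u x ^ 2 * φ x ^ (2 * k) := by
          rw [← pow_mul]
          exact mul_le_mul_of_nonneg_left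
            (pow_le_pow_of_le_one (hφ.nonneg x) (hφ.le_one x) (by lia)) (sq_nonneg _)
        have h3 := mul_nonneg (sq_nonneg (φ x ^ (k + 2))) (sq_nonneg (u x + lap n u x))
        linear_combination 1 / 2 * h1 + 1 / 2 * h2 + 1 / 2 * h3
    _ = 1 / 2 * (∫ x, (φ x ^ (k + 2)) ^ 2 * lap n u x ^ 2) +
          (1 / 2 + K / 2) * ∫ x, u x ^ 2 * φ x ^ (2 * k) := by
        rw [integral_add (iX.const_mul _) (iU.const_mul _), integral_const_mul,
          integral_const_mul]
    _ ≤ 1 / 2 * (C * (2 * |J|)) + (1 / 2 + K / 2) * (2 * |J|) := by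
        gcongr
        exact hX.trans (mul_le_mul_of_nonneg_left hU hC)
    _ ≤ _ := by linarith

end UnitBall

section Scaling

variable {n : ℕ} {a p r : ℝ} {u : EuclideanSpace ℝ (Fin n) → ℝ}

theorem partialDeriv_const_mul_comp_smul {f : EuclideanSpace ℝ (Fin n) → ℝ}
    (hf : ContDiff ℝ (⊤ : ℕ∞) f) (c r : ℝ) (i : Fin n) :
    partialDeriv i (fun x => c * f (r • x)) = fun x => c * r * partialDeriv i f (r • x) := by
  funext x
  have hd : DifferentiableAt ℝ (fun y => f (r • y)) x :=
    (hf.comp (contDiff_const_smul r)).contDiffAt.differentiableAt (by simp)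
  rw [partialDeriv, fderiv_const_mul hd, fderiv_comp_smul]
  simp [partialDeriv, mul_assoc]

theorem contDiff_const_mul_comp_smul {f : EuclideanSpace ℝ (Fin n) → ℝ}
    (hf : ContDiff ℝ (⊤ : ℕ∞) f) (c r : ℝ) :
    ContDiff ℝ (⊤ : ℕ∞) fun x => c * f (r • x) :=
  contDiff_const.mul (hf.comp (contDiff_const_smul r))

theorem lap_const_mul_comp_smul {f : EuclideanSpace ℝ (Fin n) → ℝ}
    (hf : ContDiff ℝ (⊤ : ℕ∞) f) (c r : ℝ) :
    lap n (fun x => c * f (r • x)) = fun x => c * r ^ 2 * lap n f (r • x) := by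
  funext x
  rw [lap_eq_sum_partialDeriv (contDiff_const_mul_comp_smul hf c r), lap_eq_sum_partialDeriv hf,
    Finset.mul_sum]
  refine Finset.sum_congr rfl fun i _ => ?_
  rw [partialDeriv_const_mul_comp_smul hf,
    partialDeriv_const_mul_comp_smul (contDiff_partialDeriv hf i)]
  ring

theorem abs_rescale_rpow (hr : 0 < r) (hp : 1 < p) (t : ℝ) :
    |r ^ ((4 + a) / (p - 1)) * t| ^ (p - 1) = r ^ 4 * r ^ a * |t| ^ (p - 1) := by
  have hp1 : p - 1 ≠ 0 := by linarith
  rw [abs_mul, abs_of_pos (Real.rpow_pos_of_pos hr _),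
    Real.mul_rpow (by positivity) (abs_nonneg t), ← Real.rpow_mul hr.le,
    div_mul_cancel₀ _ hp1, Real.rpow_add hr]
  norm_cast

theorem norm_smul_rpow (hr : 0 < r) (x : EuclideanSpace ℝ (Fin n)) :
    ‖r • x‖ ^ a = r ^ a * ‖x‖ ^ a := by
  rw [norm_smul, Real.norm_of_nonneg hr.le, Real.mul_rpow hr.le (norm_nonneg x)]

theorem IsSolutionOn.rescale (hr : 0 < r) (hp : 1 < p) (hu : ContDiff ℝ (⊤ : ℕ∞) u)
    (hsol : IsSolutionOn n a p u Set.univ) :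
    IsSolutionOn n a p (fun x => r ^ ((4 + a) / (p - 1)) * u (r • x)) Set.univ := by
  intro x _
  simp only [lap_const_mul_comp_smul hu, lap_const_mul_comp_smul (contDiff_lap hu)]
  rw [hsol _ (Set.mem_univ _), abs_rescale_rpow hr hp, norm_smul_rpow hr]
  ring

theorem StableOn.rescale (hr : 0 < r) (hp : 1 < p) (hst : StableOn n a p u Set.univ) :
    StableOn n a p (fun x => r ^ ((4 + a) / (p - 1)) * u (r • x)) Set.univ := by
  intro ψ hψ hψc _
  have h := hst (fun x => 1 * ψ (r⁻¹ • x)) (contDiff_const_mul_comp_smul hψ 1 r⁻¹)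
    ((hψc.comp_smul (inv_ne_zero hr.ne')).mul_left (f := fun _ => 1)) (Set.subset_univ _)
  let F : EuclideanSpace ℝ (Fin n) → ℝ := fun y =>
    ‖y‖ ^ a * |r ^ ((4 + a) / (p - 1)) * u (r • y)| ^ (p - 1) * ψ y ^ 2
  let G : EuclideanSpace ℝ (Fin n) → ℝ := fun y => lap n ψ y ^ 2
  have e₁ : ∀ x, ‖x‖ ^ a * |u x| ^ (p - 1) * (1 * ψ (r⁻¹ • x)) ^ 2 =
      (r ^ 4)⁻¹ * F (r⁻¹ • x) := by
    intro x
    simp only [F, abs_rescale_rpow hr hp, smul_inv_smul₀ hr.ne']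
    have : ‖x‖ ^ a = r ^ a * ‖r⁻¹ • x‖ ^ a := by
      rw [← norm_smul_rpow hr, smul_inv_smul₀ hr.ne']
    rw [this]
    field_simp
  have e₂ : ∀ x, (1 * r⁻¹ ^ 2 * lap n ψ (r⁻¹ • x)) ^ 2 = (r ^ 4)⁻¹ * G (r⁻¹ • x) := by
    intro x
    simp only [G]
    ring
  rw [lap_const_mul_comp_smul hψ] at h
  simp only [e₁, e₂] at h
  rw [integral_const_mul, integral_const_mul, Measure.integral_comp_inv_smul_of_nonneg _ F hr.le,
    Measure.integral_comp_inv_smul_of_nonneg _ G hr.le, smul_eq_mul, smul_eq_mul] at h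
  have hc : 0 < (r ^ 4)⁻¹ * r ^ Module.finrank ℝ (EuclideanSpace ℝ (Fin n)) := by positivity
  change p * ∫ x, F x ≤ ∫ x, G x
  refine le_of_mul_le_mul_left ?_ hc
  linarith

theorem integral_ball_gradDot_rescale (hr : 0 < r) (hu : ContDiff ℝ (⊤ : ℕ∞) u) (β : ℝ) :
    ∫ x in ball (0 : EuclideanSpace ℝ (Fin n)) r, gradDot u u x =
      r ^ ((n : ℝ) - 2 * β - 2) * ∫ x in ball (0 : EuclideanSpace ℝ (Fin n)) 1,
        gradDot (fun y => r ^ β * u (r • y)) (fun y => r ^ β * u (r • y)) x := by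
  have e : ∀ x, gradDot (fun y => r ^ β * u (r • y)) (fun y => r ^ β * u (r • y)) x =
      (r ^ β * r) ^ 2 * gradDot u u (r • x) := by
    intro x
    simp only [gradDot, partialDeriv_const_mul_comp_smul hu, Finset.mul_sum]
    exact Finset.sum_congr rfl fun i _ => by ring
  have hrβ := Real.rpow_pos_of_pos hr β
  simp only [e]
  rw [integral_const_mul, Measure.setIntegral_comp_smul_of_pos volume (fun x => gradDot u u x) _ hr,
    smul_unitBall_of_pos hr, finrank_euclideanSpace_fin, smul_eq_mul, Real.rpow_sub hr,
    Real.rpow_sub hr, Real.rpow_natCast, mul_comm 2 β, Real.rpow_mul hr.le, Real.rpow_two,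
    Real.rpow_two]
  field_simp

end Scaling

/-- gradient growth estimate `∫_{B_r(0)} |∇u|² ≤ C r^(n-2β-2)` for
smooth stable solutions in the supercritical range. -/
theorem stmt13 (n : ℕ) (hn : 5 ≤ n) (a p : ℝ) (ha : 0 ≤ a)
    (hpc : ((n : ℝ) + 4 + 2 * a) / ((n : ℝ) - 4) < p) :
    ∃ C : ℝ, 0 < C ∧
      ∀ u : EuclideanSpace ℝ (Fin n) → ℝ, ContDiff ℝ (⊤ : ℕ∞) u →
        IsSolutionOn n a p u Set.univ → StableOn n a p u Set.univ →
        ∀ r : ℝ, 0 < r →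
          (∫ y in ball (0 : EuclideanSpace ℝ (Fin n)) r, ‖gradient u y‖ ^ 2) ≤
            C * r ^ ((n : ℝ) - 2 * ((4 + a) / (p - 1)) - 2) := by
  have hn' : (5 : ℝ) ≤ n := by exact_mod_cast hn
  have hp8 : 8 + 2 * a < (p - 1) * ((n : ℝ) - 4) := by
    rw [div_lt_iff₀ (by linarith)] at hpc
    linarith
  have hp : 1 < p := by
    by_contra! h
    nlinarith
  have hp1 : 0 < p - 1 := by linarith
  have hpa : a * (2 / (p - 1)) < n := by
    rw [← mul_div_assoc, div_lt_iff₀ hp1]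
    nlinarith
  obtain ⟨k, hk⟩ := exists_nat_ge (4 / (p - 1))
  rw [div_le_iff₀ hp1] at hk
  have hk0 : k ≠ 0 := by
    rintro rfl
    norm_num at hk
  obtain ⟨K, φ, hφ⟩ := exists_isPowerCutoff n hk0
  obtain ⟨C, hC, h⟩ := hφ.exists_integral_gradDot_le (by lia) hk ha hp hpa
  refine ⟨C, hC, fun u hu hsol hst r hr => ?_⟩
  simp only [norm_gradient_sq]
  rw [integral_ball_gradDot_rescale hr hu ((4 + a) / (p - 1)), mul_comm C]
  exact mul_le_mul_of_nonneg_left (h _ (contDiff_const_mul_comp_smul hu _ r)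
    (hsol.rescale hr hp hu) (hst.rescale hr hp)) (Real.rpow_nonneg hr.le _)
end

section
/- Let n ≥ 5, a ≥ 0 and p > (n+4+2a)/(n-4) with p·ℓ₁ > n(n-4)/2 and p·ℓ₂ > n²(n-4)²/16, and let u be a smooth stable solution of Δ²u = |x|^a |u|^{p-1} u on ℝ^n. Then lim_{r → +∞} E(r; 0, u) is finite; equivalently (since r ↦ E(r;0,u) is non-decreasing), sup_{r > 0} E(r; 0, u) < +∞. -/
open MeasureTheory Metric Set Filter
open scoped RealInnerProductSpace Topology

noncomputable section

namespace PuncturedSpace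

section

variable {n : ℕ}

/-- The algebra of real functions on `ℝⁿ` that are smooth away from the origin. -/
def smoothAlgebra (n : ℕ) : Subalgebra ℝ (EuclideanSpace ℝ (Fin n) → ℝ) where
  carrier := {f | ∀ x, x ≠ 0 → ContDiffAt ℝ (⊤ : ℕ∞) f x}
  mul_mem' hf hg x hx := (hf x hx).mul (hg x hx)
  add_mem' hf hg x hx := (hf x hx).add (hg x hx)
  algebraMap_mem' _ _ _ := contDiffAt_const

/-- The type of real functions on `ℝⁿ` that are smooth away from the origin. -/
def Sm (n : ℕ) : Type := smoothAlgebra n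

instance : CommRing (Sm n) := inferInstanceAs (CommRing (smoothAlgebra n))
instance : Algebra ℝ (Sm n) := inferInstanceAs (Algebra ℝ (smoothAlgebra n))

lemma Sm.contDiffAt (f : Sm n) {x : EuclideanSpace ℝ (Fin n)} (hx : x ≠ 0) :
    ContDiffAt ℝ (⊤ : ℕ∞) f.1 x := f.2 x hx

lemma Sm.differentiableAt (f : Sm n) {x : EuclideanSpace ℝ (Fin n)} (hx : x ≠ 0) :
    DifferentiableAt ℝ f.1 x :=
  (f.contDiffAt hx).differentiableAt (by simp)

lemma Sm.contDiffAt_fderiv (f : Sm n) {x : EuclideanSpace ℝ (Fin n)} (hx : x ≠ 0) :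
    ContDiffAt ℝ (⊤ : ℕ∞) (fderiv ℝ f.1) x :=
  (f.contDiffAt hx).fderiv_right (by simp)

@[simp] lemma coe_add (f g : Sm n) (x : EuclideanSpace ℝ (Fin n)) :
    (f + g : Sm n).1 x = f.1 x + g.1 x := rfl
@[simp] lemma coe_mul (f g : Sm n) (x : EuclideanSpace ℝ (Fin n)) :
    (f * g : Sm n).1 x = f.1 x * g.1 x := rfl
@[simp] lemma coe_sub (f g : Sm n) (x : EuclideanSpace ℝ (Fin n)) :
    (f - g : Sm n).1 x = f.1 x - g.1 x := rfl
@[simp] lemma coe_neg (f : Sm n) (x : EuclideanSpace ℝ (Fin n)) :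
    (-f : Sm n).1 x = -f.1 x := rfl
@[simp] lemma coe_smul (c : ℝ) (f : Sm n) (x : EuclideanSpace ℝ (Fin n)) :
    (c • f : Sm n).1 x = c * f.1 x := rfl
@[simp] lemma coe_zero (x : EuclideanSpace ℝ (Fin n)) : (0 : Sm n).1 x = 0 := rfl
lemma coe_sum {ι : Type*} (s : Finset ι) (f : ι → Sm n) (x : EuclideanSpace ℝ (Fin n)) :
    (∑ i ∈ s, f i : Sm n).1 x = ∑ i ∈ s, (f i).1 x := by
  induction s using Finset.cons_induction with
  | empty => simp
  | cons i s hi ih => simp [Finset.sum_cons, ih]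

lemma Sm.ext' {f g : Sm n} (h : ∀ x, f.1 x = g.1 x) : f = g := Subtype.ext (funext h)

/-- The derivation along the linear vector field `x ↦ M x`. -/
def vf (M : EuclideanSpace ℝ (Fin n) →L[ℝ] EuclideanSpace ℝ (Fin n)) :
    Derivation ℝ (Sm n) (Sm n) :=
  Derivation.mk'
    { toFun := fun f => ⟨fun x => fderiv ℝ f.1 x (M x), fun _ hx =>
        (f.contDiffAt_fderiv hx).clm_apply M.contDiff.contDiffAt⟩
      map_add' := fun f g => Sm.ext' fun x => by
        rcases eq_or_ne x 0 with rfl | hx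
        · change fderiv ℝ _ (0 : EuclideanSpace ℝ (Fin n)) (M 0) =
            fderiv ℝ f.1 0 (M 0) + fderiv ℝ g.1 0 (M 0)
          simp
        · change fderiv ℝ (f.1 + g.1) x (M x) = fderiv ℝ f.1 x (M x) + fderiv ℝ g.1 x (M x)
          rw [fderiv_add (f.differentiableAt hx) (g.differentiableAt hx)]; rfl
      map_smul' := fun c f => Sm.ext' fun x => by
        rcases eq_or_ne x 0 with rfl | hx
        · change fderiv ℝ _ (0 : EuclideanSpace ℝ (Fin n)) (M 0) = c * fderiv ℝ f.1 0 (M 0)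
          simp
        · change fderiv ℝ (c • f.1) x (M x) = c * fderiv ℝ f.1 x (M x)
          rw [fderiv_const_smul (f.differentiableAt hx)]; rfl }
    (fun f g => Sm.ext' fun x => by
      rcases eq_or_ne x 0 with rfl | hx
      · change fderiv ℝ _ (0 : EuclideanSpace ℝ (Fin n)) (M 0) =
          f.1 0 * fderiv ℝ g.1 0 (M 0) + g.1 0 * fderiv ℝ f.1 0 (M 0)
        simp
      · change fderiv ℝ (f.1 * g.1) x (M x) =
          f.1 x * fderiv ℝ g.1 x (M x) + g.1 x * fderiv ℝ f.1 x (M x)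
        rw [fderiv_mul (f.differentiableAt hx) (g.differentiableAt hx)]; rfl)

variable (M N : EuclideanSpace ℝ (Fin n) →L[ℝ] EuclideanSpace ℝ (Fin n))

lemma vf_apply (f : Sm n) (x : EuclideanSpace ℝ (Fin n)) :
    (vf M f).1 x = fderiv ℝ f.1 x (M x) := rfl

lemma vf_mul (f g : Sm n) : vf M (f * g) = f * vf M g + g * vf M f := by
  rw [Derivation.leibniz]; rfl

lemma vf_vf_apply (f : Sm n) {x : EuclideanSpace ℝ (Fin n)} (hx : x ≠ 0) :
    (vf M (vf N f)).1 x =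
      fderiv ℝ (fderiv ℝ f.1) x (M x) (N x) + fderiv ℝ f.1 x (N (M x)) := by
  have h1 : HasFDerivAt (fun y => fderiv ℝ f.1 y (N y))
      ((fderiv ℝ f.1 x).comp N + (fderiv ℝ (fderiv ℝ f.1) x).flip (N x)) x :=
    ((f.contDiffAt_fderiv hx).differentiableAt (by simp)).hasFDerivAt.clm_apply N.hasFDerivAt
  rw [vf_apply]
  change fderiv ℝ (fun y => fderiv ℝ f.1 y (N y)) x (M x) = _
  rw [h1.fderiv]
  simp [add_comm]

lemma fderiv_fderiv_symm (f : Sm n) {x : EuclideanSpace ℝ (Fin n)} (hx : x ≠ 0)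
    (y z : EuclideanSpace ℝ (Fin n)) :
    fderiv ℝ (fderiv ℝ f.1) x y z = fderiv ℝ (fderiv ℝ f.1) x z y :=
  (f.contDiffAt hx).isSymmSndFDerivAt (by
    simp only [minSmoothness_of_isRCLikeNormedField]
    exact WithTop.coe_le_coe.2 (le_top : (2 : ℕ∞) ≤ ⊤)) y z

/-- The Euler field `x · ∇`. -/
def D : Derivation ℝ (Sm n) (Sm n) := vf (ContinuousLinearMap.id ℝ _)

/-- The generator of rotations in the plane of the coordinates `i`, `j`. -/
def rot (i j : Fin n) : EuclideanSpace ℝ (Fin n) →L[ℝ] EuclideanSpace ℝ (Fin n) :=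
  (EuclideanSpace.proj i : EuclideanSpace ℝ (Fin n) →L[ℝ] ℝ).smulRight (EuclideanSpace.single j 1)
    - (EuclideanSpace.proj j : EuclideanSpace ℝ (Fin n) →L[ℝ] ℝ).smulRight
      (EuclideanSpace.single i 1)

lemma rot_apply (i j : Fin n) (x : EuclideanSpace ℝ (Fin n)) :
    rot i j x = x i • EuclideanSpace.single j 1 - x j • EuclideanSpace.single i 1 := by
  simp [rot]

lemma inner_rot (i j : Fin n) (x : EuclideanSpace ℝ (Fin n)) : ⟪x, rot i j x⟫ = 0 := by
  rw [rot_apply, inner_sub_right, inner_smul_right, inner_smul_right]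
  simp [EuclideanSpace.inner_single_right]
  ring

/-- The angular derivation `x_i ∂_j - x_j ∂_i`. -/
def X (i j : Fin n) : Derivation ℝ (Sm n) (Sm n) := vf (rot i j)

lemma D_mul (f g : Sm n) : D (f * g) = f * D g + g * D f := vf_mul _ f g
lemma X_mul (i j : Fin n) (f g : Sm n) : X i j (f * g) = f * X i j g + g * X i j f := vf_mul _ f g

lemma D_X (i j : Fin n) (f : Sm n) : D (X i j f) = X i j (D f) := Sm.ext' fun x => by
  rcases eq_or_ne x 0 with rfl | hx
  · simp [D, X, vf_apply]
  · rw [D, X, vf_vf_apply _ _ _ hx, vf_vf_apply _ _ _ hx, fderiv_fderiv_symm f hx]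
    rfl

/-- The Laplace–Beltrami operator of the unit sphere, acting on each sphere about the origin. -/
def A (f : Sm n) : Sm n := (1 / 2 : ℝ) • ∑ i, ∑ j, X i j (X i j f)

lemma A_apply (f : Sm n) : A f = (1 / 2 : ℝ) • ∑ i, ∑ j, X i j (X i j f) := rfl

lemma A_add (f g : Sm n) : A (f + g) = A f + A g := by
  simp only [A_apply, map_add, Finset.sum_add_distrib, smul_add]

lemma A_smul (c : ℝ) (f : Sm n) : A (c • f) = c • A f := by
  simp only [A_apply, Derivation.map_smul, ← Finset.smul_sum, smul_comm c]

lemma D_A (f : Sm n) : D (A f) = A (D f) := by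
  simp only [A_apply, Derivation.map_smul, map_sum, D_X]

/-- A function is radial when all angular derivations kill it. -/
def Rad (θ : Sm n) : Prop := ∀ i j, X i j θ = 0

lemma Rad.mul {θ η : Sm n} (h : Rad θ) (h' : Rad η) : Rad (θ * η) := fun i j => by
  simp [h i j, h' i j]

lemma Rad.D {θ : Sm n} (h : Rad θ) : Rad (D θ) := fun i j => by rw [← D_X, h i j, map_zero]

lemma Rad.A_mul {θ : Sm n} (h : Rad θ) (f : Sm n) : A (θ * f) = θ * A f := by
  simp only [A_apply, X_mul, h _ _, mul_zero, add_zero, Algebra.mul_smul_comm, Finset.mul_sum]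

/-- `‖x‖²` times the Laplacian. -/
def Lr (f : Sm n) : Sm n := D (D f) + ((n : ℝ) - 2) • D f + A f

lemma sum_single_smul (x : EuclideanSpace ℝ (Fin n)) :
    ∑ i, x i • (EuclideanSpace.single i (1 : ℝ)) = x := by
  ext k
  simp [Pi.single_apply]

lemma Lr_apply (f : Sm n) {x : EuclideanSpace ℝ (Fin n)} (hx : x ≠ 0) :
    (Lr f).1 x = ‖x‖ ^ 2 * lap n f.1 x := by
  set e : Fin n → EuclideanSpace ℝ (Fin n) := fun i => EuclideanSpace.single i 1 with he
  set H := fderiv ℝ (fderiv ℝ f.1) x with hH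
  set G := fderiv ℝ f.1 x with hG
  have hxe : ∑ i, x i • e i = x := sum_single_smul x
  have hDD : (D (D f)).1 x = H x x + G x := vf_vf_apply _ _ f hx
  have hD : (D f).1 x = G x := rfl
  have hrot2 : ∀ i j, rot i j (rot i j x) = (if i = j then x i • e j else 0) - x j • e j
      - x i • e i + (if i = j then x j • e i else 0) := by
    intro i j
    rw [rot_apply i j (rot i j x), rot_apply]
    by_cases hij : i = j
    · subst hij
      simp [he]
    · have hji : ¬ j = i := fun h => hij h.symm
      simp only [hij, if_false]
      ext k
      simp [he, hij, hji]
  have hX : ∀ i j, (X i j (X i j f)).1 x =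
      x i * x i * H (e j) (e j) - 2 * (x i * x j * H (e i) (e j)) + x j * x j * H (e i) (e i)
      + ((if i = j then x i * G (e j) else 0) - x j * G (e j) - x i * G (e i)
        + (if i = j then x j * G (e i) else 0)) := by
    intro i j
    rw [X, vf_vf_apply _ _ f hx, hrot2]
    have hs : H (e j) (e i) = H (e i) (e j) := fderiv_fderiv_symm f hx _ _
    rw [rot_apply, ← hH, ← hG]
    change H (x i • e j - x j • e i) (x i • e j - x j • e i) + _ = _
    simp only [map_sub, map_smul, map_add, _root_.sub_apply,
      _root_.smul_apply, smul_eq_mul, hs, apply_ite G, map_zero]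
    ring
  have hGx : ∑ i, x i * G (e i) = G x := by
    conv_rhs => rw [← hxe]
    simp [map_sum]
  have hHx : ∑ i, ∑ j, x i * x j * H (e i) (e j) = H x x := by
    conv_rhs => rw [← hxe]
    simp only [map_sum, map_smul, _root_.sum_apply, _root_.smul_apply,
      smul_eq_mul, Finset.mul_sum, mul_assoc]
    rw [Finset.sum_comm]
    refine Finset.sum_congr rfl fun i _ => Finset.sum_congr rfl fun j _ => by ring
  have hn : ∑ i, x i * x i = ‖x‖ ^ 2 := by
    rw [EuclideanSpace.real_norm_sq_eq]
    simp [sq]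
  have hl : lap n f.1 x = ∑ i, H (e i) (e i) := by
    simp [lap, iteratedFDeriv_two_apply, he, hH]
  have hA : (A f).1 x = ‖x‖ ^ 2 * (∑ i, H (e i) (e i)) - H x x + (1 - n) * G x := by
    rw [A_apply, coe_smul, coe_sum]
    simp only [coe_sum, hX, Finset.sum_add_distrib, Finset.sum_sub_distrib, ← Finset.mul_sum,
      Finset.sum_ite_eq, Finset.mem_univ, if_true, hGx, hHx, Finset.sum_const, Finset.card_univ,
      Fintype.card_fin, nsmul_eq_mul]
    have e2 : ∑ i, ∑ j, x j * x j * H (e i) (e i) = ‖x‖ ^ 2 * ∑ i, H (e i) (e i) := by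
      rw [← hn, Finset.sum_mul_sum, Finset.sum_comm]
    have e3 : ∑ i, x i * (n * G (e i)) = n * G x := by
      rw [← hGx, Finset.mul_sum]
      exact Finset.sum_congr rfl fun i _ => by ring
    rw [← Finset.sum_mul, hn, e2, e3]
    ring
  rw [hl, Lr, coe_add, coe_add, coe_smul, hDD, hD, hA]
  ring

end

section

variable {n : ℕ}

/-- The radial function `χ (log ‖x‖)`, set to zero at the origin. -/
def cut (χ : ℝ → ℝ) (h : ContDiff ℝ (⊤ : ℕ∞) χ) : Sm n :=
  ⟨fun x => if x = 0 then 0 else χ (Real.log ‖x‖), fun x hx => by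
    have h1 : ContDiffAt ℝ (⊤ : ℕ∞)
        (fun y : EuclideanSpace ℝ (Fin n) => χ (Real.log ‖y‖)) x :=
      h.contDiffAt.comp x
        ((Real.contDiffAt_log.2 (norm_ne_zero_iff.2 hx)).comp x (contDiffAt_norm ℝ hx))
    refine h1.congr_of_eventuallyEq ?_
    filter_upwards [isOpen_ne.mem_nhds hx] with y hy
    exact if_neg hy⟩

lemma cut_apply {χ : ℝ → ℝ} (h : ContDiff ℝ (⊤ : ℕ∞) χ) {x : EuclideanSpace ℝ (Fin n)}
    (hx : x ≠ 0) : (cut χ h : Sm n).1 x = χ (Real.log ‖x‖) := if_neg hx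

@[simp] lemma cut_zero {χ : ℝ → ℝ} (h : ContDiff ℝ (⊤ : ℕ∞) χ) :
    (cut χ h : Sm n).1 0 = 0 := if_pos rfl

lemma vf_zero (M : EuclideanSpace ℝ (Fin n) →L[ℝ] EuclideanSpace ℝ (Fin n)) (f : Sm n) :
    (vf M f).1 0 = 0 := by
  simp [vf_apply]

lemma contDiff_deriv {χ : ℝ → ℝ} (h : ContDiff ℝ (⊤ : ℕ∞) χ) :
    ContDiff ℝ (⊤ : ℕ∞) (deriv χ) := (contDiff_infty_iff_deriv.1 h).2

lemma vf_cut_apply (M : EuclideanSpace ℝ (Fin n) →L[ℝ] EuclideanSpace ℝ (Fin n))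
    {χ : ℝ → ℝ} (h : ContDiff ℝ (⊤ : ℕ∞) χ) {x : EuclideanSpace ℝ (Fin n)} (hx : x ≠ 0) :
    (vf M (cut χ h)).1 x = deriv χ (Real.log ‖x‖) * (⟪x, M x⟫ / ‖x‖ ^ 2) := by
  have h0 : ‖x‖ ^ 2 ≠ 0 := pow_ne_zero _ (norm_ne_zero_iff.2 hx)
  have h1 : HasFDerivAt (fun y : EuclideanSpace ℝ (Fin n) => Real.log (‖y‖ ^ 2))
      ((‖x‖ ^ 2)⁻¹ • (2 • innerSL ℝ x)) x :=
    ((hasStrictFDerivAt_norm_sq x).hasFDerivAt).log h0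
  have h2 : HasFDerivAt (fun y : EuclideanSpace ℝ (Fin n) => Real.log ‖y‖)
      ((1 / 2 : ℝ) • ((‖x‖ ^ 2)⁻¹ • (2 • innerSL ℝ x))) x := by
    refine (h1.const_smul (1 / 2 : ℝ)).congr_of_eventuallyEq (Eventually.of_forall fun y => ?_)
    simp [Real.log_pow]
  have h3 : HasFDerivAt (fun y : EuclideanSpace ℝ (Fin n) => χ (Real.log ‖y‖))
      (deriv χ (Real.log ‖x‖) • ((1 / 2 : ℝ) • ((‖x‖ ^ 2)⁻¹ • (2 • innerSL ℝ x)))) x :=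
    ((h.differentiable (by simp)).differentiableAt.hasDerivAt).comp_hasFDerivAt x h2
  have h4 : (cut χ h : Sm n).1 =ᶠ[𝓝 x] fun y => χ (Real.log ‖y‖) := by
    filter_upwards [isOpen_ne.mem_nhds hx] with y hy
    exact if_neg hy
  rw [vf_apply, (h3.congr_of_eventuallyEq h4).fderiv]
  simp only [_root_.smul_apply, innerSL_apply_apply, smul_eq_mul, nsmul_eq_mul, Nat.cast_ofNat]
  ring

lemma D_cut {χ : ℝ → ℝ} (h : ContDiff ℝ (⊤ : ℕ∞) χ) :
    D (cut χ h : Sm n) = cut (deriv χ) (contDiff_deriv h) := Sm.ext' fun x => by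
  rcases eq_or_ne x 0 with rfl | hx
  · rw [cut_zero]; exact vf_zero _ _
  · rw [D, vf_cut_apply _ _ hx, cut_apply _ hx]
    have h0 : ‖x‖ ^ 2 ≠ 0 := pow_ne_zero _ (norm_ne_zero_iff.2 hx)
    simp [div_self h0]

lemma rad_cut {χ : ℝ → ℝ} (h : ContDiff ℝ (⊤ : ℕ∞) χ) : Rad (cut χ h : Sm n) :=
  fun i j => Sm.ext' fun x => by
    rcases eq_or_ne x 0 with rfl | hx
    · exact vf_zero _ _
    · rw [X, vf_cut_apply _ _ hx, inner_rot]
      simp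

lemma contDiff_exp_mul (s : ℝ) : ContDiff ℝ (⊤ : ℕ∞) fun t => Real.exp (s * t) :=
  (contDiff_const.mul contDiff_id).exp

/-- The power `‖x‖ ^ s`, set to zero at the origin. -/
def rp (s : ℝ) : Sm n := cut (fun t => Real.exp (s * t)) (contDiff_exp_mul s)

lemma rp_apply (s : ℝ) {x : EuclideanSpace ℝ (Fin n)} (hx : x ≠ 0) :
    (rp s : Sm n).1 x = ‖x‖ ^ s := by
  rw [rp, cut_apply _ hx, Real.rpow_def_of_pos (norm_pos_iff.2 hx), mul_comm]

@[simp] lemma rp_zero (s : ℝ) : (rp s : Sm n).1 0 = 0 := cut_zero _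

lemma rp_nonneg (s : ℝ) (x : EuclideanSpace ℝ (Fin n)) : 0 ≤ (rp s : Sm n).1 x := by
  rcases eq_or_ne x 0 with rfl | hx
  · simp
  · rw [rp_apply s hx]; positivity

lemma rp_mul (s t : ℝ) : (rp s * rp t : Sm n) = rp (s + t) := Sm.ext' fun x => by
  rcases eq_or_ne x 0 with rfl | hx
  · simp
  · rw [coe_mul, rp_apply _ hx, rp_apply _ hx, rp_apply _ hx,
      Real.rpow_add (norm_pos_iff.2 hx)]

lemma D_rp (s : ℝ) : D (rp s : Sm n) = s • rp s := by
  rw [rp, D_cut]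
  refine Sm.ext' fun x => ?_
  rcases eq_or_ne x 0 with rfl | hx
  · simp
  · rw [coe_smul, cut_apply _ hx, cut_apply _ hx]
    have : HasDerivAt (fun t => Real.exp (s * t))
        (Real.exp (s * Real.log ‖x‖) * (s * 1)) (Real.log ‖x‖) :=
      ((hasDerivAt_id _).const_mul s).exp
    rw [this.deriv]
    ring

lemma rad_rp (s : ℝ) : Rad (rp s : Sm n) := rad_cut _

/-- The operator `‖x‖² Δ` conjugated by the power `‖x‖ ^ (-s)`. -/
def Mop (s : ℝ) (f : Sm n) : Sm n :=
  D (D f) + ((n : ℝ) - 2 - 2 * s) • D f - (s * ((n : ℝ) - 2 - s)) • f + A f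

lemma Lr_rp_mul (s : ℝ) (f : Sm n) : Lr (rp (-s) * f) = rp (-s) * Mop s f := by
  have h1 : D (rp (-s) * f) = rp (-s) * (D f - s • f) := by
    rw [D_mul, D_rp]
    refine Sm.ext' fun x => ?_
    simp
    ring
  have h2 : D (D (rp (-s) * f)) = rp (-s) * (D (D f) - (2 * s) • D f + (s ^ 2) • f) := by
    rw [h1, D_mul, D_rp, Derivation.map_sub, Derivation.map_smul]
    refine Sm.ext' fun x => ?_
    simp
    ring
  rw [Lr, h2, h1, (rad_rp (-s)).A_mul, Mop]
  refine Sm.ext' fun x => ?_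
  simp
  ring

/-- Functions supported in a closed annulus about the origin. -/
def Tst (n : ℕ) : Ideal (Sm n) where
  carrier := {f | ∃ ε > 0, ∃ R, ∀ x, x ≠ 0 → f.1 x ≠ 0 → ε ≤ ‖x‖ ∧ ‖x‖ ≤ R}
  add_mem' := by
    rintro f g ⟨ε, hε, R, hf⟩ ⟨ε', hε', R', hg⟩
    refine ⟨min ε ε', lt_min hε hε', max R R', fun x hx h => ?_⟩
    by_cases hfx : f.1 x = 0
    · have := hg x hx (by simpa [hfx] using h)
      exact ⟨(min_le_right _ _).trans this.1, this.2.trans (le_max_right _ _)⟩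
    · have := hf x hx hfx
      exact ⟨(min_le_left _ _).trans this.1, this.2.trans (le_max_left _ _)⟩
  zero_mem' := ⟨1, one_pos, 0, fun x _ h => absurd (coe_zero x) h⟩
  smul_mem' := by
    rintro g f ⟨ε, hε, R, hf⟩
    exact ⟨ε, hε, R, fun x hx h => hf x hx (right_ne_zero_of_mul h)⟩

lemma Tst.mul_left {f : Sm n} (hf : f ∈ Tst n) (g : Sm n) : g * f ∈ Tst n :=
  (Tst n).mul_mem_left g hf

lemma Tst.mul_right {f : Sm n} (hf : f ∈ Tst n) (g : Sm n) : f * g ∈ Tst n :=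
  (Tst n).mul_mem_right g hf

lemma Tst.smul {f : Sm n} (hf : f ∈ Tst n) (c : ℝ) : c • f ∈ Tst n := by
  rw [Algebra.smul_def]
  exact Tst.mul_left hf _

lemma Tst.vf {f : Sm n} (hf : f ∈ Tst n)
    (M : EuclideanSpace ℝ (Fin n) →L[ℝ] EuclideanSpace ℝ (Fin n)) : vf M f ∈ Tst n := by
  obtain ⟨ε, hε, R, hf⟩ := hf
  refine ⟨ε, hε, R, fun x hx h => ?_⟩
  by_contra hc
  have hc' : ‖x‖ < ε ∨ R < ‖x‖ := by
    by_contra! hh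
    exact hc hh
  apply h
  have ho : IsOpen {y : EuclideanSpace ℝ (Fin n) | y ≠ 0 ∧ (‖y‖ < ε ∨ R < ‖y‖)} :=
    isOpen_ne.inter ((isOpen_lt continuous_norm continuous_const).union
      (isOpen_lt continuous_const continuous_norm))
  have : f.1 =ᶠ[𝓝 x] fun _ => 0 := by
    filter_upwards [ho.mem_nhds ⟨hx, hc'⟩] with y hy
    by_contra hne
    have := hf y hy.1 hne
    rcases hy.2 with h | h <;> linarith
  rw [vf_apply, this.fderiv_eq]
  simp

lemma Tst.D {f : Sm n} (hf : f ∈ Tst n) : D f ∈ Tst n := Tst.vf hf _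
lemma Tst.X {f : Sm n} (hf : f ∈ Tst n) (i j : Fin n) : X i j f ∈ Tst n := Tst.vf hf _

lemma Tst.A {f : Sm n} (hf : f ∈ Tst n) : A f ∈ Tst n :=
  Tst.smul (Submodule.sum_mem _ fun i _ => Submodule.sum_mem _ fun j _ =>
    Tst.X (Tst.X hf i j) i j) _

lemma cut_mem {χ : ℝ → ℝ} (h : ContDiff ℝ (⊤ : ℕ∞) χ) (hc : HasCompactSupport χ) :
    (cut χ h : Sm n) ∈ Tst n := by
  obtain ⟨B, hB⟩ := hc.isBounded.exists_norm_le
  refine ⟨Real.exp (-B), Real.exp_pos _, Real.exp B, fun x hx hne => ?_⟩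
  rw [cut_apply _ hx] at hne
  have := abs_le.1 (hB _ (subset_tsupport _ hne))
  have hp : 0 < ‖x‖ := norm_pos_iff.2 hx
  exact ⟨(Real.le_log_iff_exp_le hp).1 this.1, (Real.log_le_iff_le_exp hp).1 this.2⟩

lemma Tst.contDiff {f : Sm n} (hf : f ∈ Tst n) (h0 : f.1 0 = 0) : ContDiff ℝ (⊤ : ℕ∞) f.1 := by
  obtain ⟨ε, hε, R, hf⟩ := hf
  rw [contDiff_iff_contDiffAt]
  intro x
  rcases eq_or_ne x 0 with rfl | hx
  · refine (contDiffAt_const (c := (0 : ℝ))).congr_of_eventuallyEq ?_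
    filter_upwards [Metric.ball_mem_nhds (0 : EuclideanSpace ℝ (Fin n)) hε] with y hy
    by_contra hne
    rcases eq_or_ne y 0 with rfl | hy0
    · exact hne h0
    · have := (hf y hy0 hne).1
      simp at hy
      linarith
  · exact f.contDiffAt hx

lemma Tst.hasCompactSupport {f : Sm n} (hf : f ∈ Tst n) (h0 : f.1 0 = 0) :
    HasCompactSupport f.1 := by
  obtain ⟨ε, hε, R, hf⟩ := hf
  refine HasCompactSupport.intro (isCompact_closedBall 0 R) fun x hx => ?_
  by_contra hne
  rcases eq_or_ne x 0 with rfl | hx0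
  · exact hne h0
  · have := (hf x hx0 hne).2
    simp at hx
    linarith

/-- Integration against the scale invariant measure `‖x‖ ^ (-n) dx`. -/
def I (f : Sm n) : ℝ := ∫ x, (rp (-(n : ℝ)) * f).1 x

lemma integrable_of_mem {f : Sm n} (hf : f ∈ Tst n) :
    Integrable (rp (-(n : ℝ)) * f).1 := by
  have h0 : (rp (-(n : ℝ)) * f).1 0 = 0 := by simp
  exact (Tst.contDiff (Tst.mul_left hf _) h0).continuous.integrable_of_hasCompactSupport
    (Tst.hasCompactSupport (Tst.mul_left hf _) h0)

lemma I_add {f g : Sm n} (hf : f ∈ Tst n) (hg : g ∈ Tst n) : I (f + g) = I f + I g := by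
  rw [I, I, I, ← integral_add (integrable_of_mem hf) (integrable_of_mem hg), mul_add]
  rfl

lemma I_smul (c : ℝ) (f : Sm n) : I (c • f) = c * I f := by
  rw [I, I, ← integral_const_mul, Algebra.mul_smul_comm]
  rfl

lemma I_neg (f : Sm n) : I (-f) = -I f := by
  rw [← neg_one_smul ℝ, I_smul]; ring

lemma I_mono {f g : Sm n} (hf : f ∈ Tst n) (hg : g ∈ Tst n)
    (h : ∀ x, x ≠ 0 → f.1 x ≤ g.1 x) : I f ≤ I g := by
  refine integral_mono (integrable_of_mem hf) (integrable_of_mem hg) fun x => ?_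
  rcases eq_or_ne x 0 with rfl | hx
  · simp
  · exact mul_le_mul_of_nonneg_left (h x hx) (rp_nonneg _ _)

lemma I_nonneg {f : Sm n} (h : ∀ x, x ≠ 0 → 0 ≤ f.1 x) : 0 ≤ I f := by
  refine integral_nonneg fun x => ?_
  rcases eq_or_ne x 0 with rfl | hx
  · simp
  · exact mul_nonneg (rp_nonneg _ _) (h x hx)

lemma integral_coord_mul_fderiv {g : EuclideanSpace ℝ (Fin n) → ℝ}
    (hg : ContDiff ℝ (⊤ : ℕ∞) g) (hc : HasCompactSupport g) (i j : Fin n) :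
    Integrable (fun x => x i * fderiv ℝ g x (EuclideanSpace.single j 1)) ∧
    ∫ x, x i * fderiv ℝ g x (EuclideanSpace.single j 1) = -(if i = j then ∫ x, g x else 0) := by
  set L : EuclideanSpace ℝ (Fin n) →L[ℝ] ℝ := EuclideanSpace.proj i with hL
  have hLd : ∀ x, fderiv ℝ L x = L := fun x => L.fderiv
  have hcont : Continuous fun x => fderiv ℝ g x (EuclideanSpace.single j 1) :=
    (hg.continuous_fderiv (by simp)).clm_apply continuous_const
  have hcs : HasCompactSupport fun x => fderiv ℝ g x (EuclideanSpace.single j 1) :=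
    hc.fderiv_apply (𝕜 := ℝ) _
  have hi1 : Integrable fun x => L x * fderiv ℝ g x (EuclideanSpace.single j 1) :=
    (L.continuous.mul hcont).integrable_of_hasCompactSupport hcs.mul_left
  have hi2 : Integrable fun x => fderiv ℝ L x (EuclideanSpace.single j 1) * g x := by
    simp only [hLd]
    exact (continuous_const.mul hg.continuous).integrable_of_hasCompactSupport hc.mul_left
  have hi3 : Integrable fun x => L x * g x :=
    (L.continuous.mul hg.continuous).integrable_of_hasCompactSupport hc.mul_left
  refine ⟨hi1, ?_⟩
  have := integral_mul_fderiv_eq_neg_fderiv_mul_of_integrable hi2 hi1 hi3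
    (fun x _ => L.differentiableAt) (fun x _ => hg.differentiable (by simp) x)
  refine this.trans ?_
  simp only [hLd]
  by_cases hij : i = j
  · simp [hL, hij]
  · simp [hL, hij]

lemma I_X (i j : Fin n) {f : Sm n} (hf : f ∈ Tst n) : I (X i j f) = 0 := by
  set g : Sm n := rp (-(n : ℝ)) * f with hg
  have hgT : g ∈ Tst n := Tst.mul_left hf _
  have h0 : g.1 0 = 0 := by simp [hg]
  have h1 := integral_coord_mul_fderiv (Tst.contDiff hgT h0) (Tst.hasCompactSupport hgT h0)
  have h2 : rp (-(n : ℝ)) * X i j f = X i j g := by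
    rw [hg, X_mul, rp, rad_cut _ i j]; simp
  have h3 : (X i j g).1 = fun x => x i * fderiv ℝ g.1 x (EuclideanSpace.single j 1)
      - x j * fderiv ℝ g.1 x (EuclideanSpace.single i 1) := by
    funext x
    rw [X, vf_apply, rot_apply, map_sub, map_smul, map_smul]; rfl
  rw [I, h2, h3, integral_sub (h1 i j).1 (h1 j i).1, (h1 i j).2, (h1 j i).2]
  simp [eq_comm]

lemma I_D {f : Sm n} (hf : f ∈ Tst n) : I (D f) = 0 := by
  set g : Sm n := rp (-(n : ℝ)) * f with hg
  have hgT : g ∈ Tst n := Tst.mul_left hf _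
  have h0 : g.1 0 = 0 := by simp [hg]
  have h1 := integral_coord_mul_fderiv (Tst.contDiff hgT h0) (Tst.hasCompactSupport hgT h0)
  have h2 : rp (-(n : ℝ)) * D f = D g + (n : ℝ) • g := by
    rw [hg, D_mul, D_rp]
    refine Sm.ext' fun x => ?_
    simp
    ring
  have h3 : (D g + (n : ℝ) • g).1 =
      fun x => (∑ i, x i * fderiv ℝ g.1 x (EuclideanSpace.single i 1)) + n * g.1 x := by
    funext x
    rw [coe_add, coe_smul, D, vf_apply]
    congr 1
    conv_lhs => rw [ContinuousLinearMap.id_apply, ← sum_single_smul x, map_sum]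
    simp [sum_single_smul]
  have hgi : Integrable g.1 := integrable_of_mem hf
  rw [I, h2, h3, integral_add (integrable_finsetSum _ fun i _ => (h1 i i).1) (hgi.const_mul _),
    integral_finsetSum _ fun i _ => (h1 i i).1, integral_const_mul]
  simp [(h1 _ _).2]

/-- Test functions with vanishing integral. -/
def Ex (n : ℕ) : Submodule ℝ (Sm n) where
  carrier := {f | f ∈ Tst n ∧ I f = 0}
  add_mem' hf hg := ⟨add_mem hf.1 hg.1, by rw [I_add hf.1 hg.1, hf.2, hg.2, add_zero]⟩
  zero_mem' := ⟨zero_mem _, by simp [I]⟩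
  smul_mem' c f hf := ⟨Tst.smul hf.1 c, by rw [I_smul, hf.2, mul_zero]⟩

lemma D_mem_Ex {f : Sm n} (hf : f ∈ Tst n) : D f ∈ Ex n := ⟨Tst.D hf, I_D hf⟩

lemma I_eq_of_sub_mem {f g : Sm n} (hg : g ∈ Tst n) (h : f - g ∈ Ex n) : I f = I g := by
  have := I_add hg h.1
  rw [h.2, add_sub_cancel] at this
  linarith

lemma I_mul_A_nonpos {η : Sm n} (hη : η ∈ Tst n) (hr : Rad η) (f : Sm n) :
    I (η * η * (f * A f)) ≤ 0 := by
  have h1 : η * η * (f * A f) - -((1 / 2 : ℝ) • ∑ i, ∑ j, (η * X i j f) * (η * X i j f)) =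
      (1 / 2 : ℝ) • ∑ i, ∑ j, X i j (η * η * (f * X i j f)) := by
    simp only [A_apply, X_mul, hr _ _, mul_zero, add_zero, sub_neg_eq_add,
      Algebra.mul_smul_comm, Finset.mul_sum, ← smul_add, ← Finset.sum_add_distrib]
    congr 1
    refine Finset.sum_congr rfl fun i _ => Finset.sum_congr rfl fun j _ => by ring
  have hT : ∀ g h, η * g * (η * h) ∈ Tst n := fun g h => Tst.mul_right (Tst.mul_right hη _) _
  have h2 : η * η * (f * A f) - -((1 / 2 : ℝ) • ∑ i, ∑ j, (η * X i j f) * (η * X i j f))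
      ∈ Ex n := by
    rw [h1]
    exact Submodule.smul_mem _ _ (Submodule.sum_mem _ fun i _ => Submodule.sum_mem _ fun j _ =>
      ⟨Tst.X (Tst.mul_right (Tst.mul_right hη _) _) _ _,
        I_X _ _ (Tst.mul_right (Tst.mul_right hη _) _)⟩)
  rw [I_eq_of_sub_mem (neg_mem (Tst.smul (Submodule.sum_mem _ fun i _ =>
    Submodule.sum_mem _ fun j _ => hT _ _) _)) h2, I_neg, neg_nonpos]
  refine I_nonneg fun x _ => ?_
  simp only [coe_smul, coe_sum, coe_mul]
  exact mul_nonneg (by norm_num) (Finset.sum_nonneg fun i _ => Finset.sum_nonneg fun j _ =>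
    mul_self_nonneg _)

end

section

variable {n : ℕ}

lemma exists_linear_extension_I :
    ∃ J : Sm n →ₗ[ℝ] ℝ, ∀ f ∈ Tst n, J f = I f := by
  let S : Submodule ℝ (Sm n) := (Tst n).restrictScalars ℝ
  let L : S →ₗ[ℝ] ℝ :=
    { toFun := fun f => I f.1
      map_add' := fun f g => I_add f.2 g.2
      map_smul' := fun c f => I_smul c f.1 }
  obtain ⟨J, hJ⟩ := L.exists_extend
  exact ⟨J, fun f hf => LinearMap.congr_fun hJ (⟨f, hf⟩ : S)⟩

/-- A linear extension of the invariant integral from test functions to all of `Sm n`. -/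
def J : Sm n →ₗ[ℝ] ℝ := Classical.choose exists_linear_extension_I

lemma J_eq {f : Sm n} (hf : f ∈ Tst n) : J f = I f :=
  Classical.choose_spec exists_linear_extension_I f hf

lemma J_mono {f g : Sm n} (hf : f ∈ Tst n) (hg : g ∈ Tst n)
    (h : ∀ x, x ≠ 0 → f.1 x ≤ g.1 x) : J f ≤ J g := by
  rw [J_eq hf, J_eq hg]; exact I_mono hf hg h

lemma J_nonneg {f : Sm n} (hf : f ∈ Tst n) (h : ∀ x, x ≠ 0 → 0 ≤ f.1 x) : 0 ≤ J f := by
  rw [J_eq hf]; exact I_nonneg h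

lemma J_Ex {f : Sm n} (hf : f ∈ Ex n) : J f = 0 := by rw [J_eq hf.1, hf.2]

lemma J_D {f : Sm n} (hf : f ∈ Tst n) : J (D f) = 0 := J_Ex (D_mem_Ex hf)

lemma J_A_symm {f : Sm n} (hf : f ∈ Tst n) (g : Sm n) : J (f * A g) = J (g * A f) := by
  have h : f * A g - g * A f = (1 / 2 : ℝ) • ∑ i, ∑ j, X i j (f * X i j g - g * X i j f) := by
    simp only [A_apply, X_mul, Derivation.map_sub, Algebra.mul_smul_comm, Finset.mul_sum,
      ← smul_sub, ← Finset.sum_sub_distrib]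
    congr 1
    refine Finset.sum_congr rfl fun i _ => Finset.sum_congr rfl fun j _ => by ring
  have hT : ∀ i j, f * X i j g - g * X i j f ∈ Tst n := fun i j =>
    sub_mem (Tst.mul_right hf _) (Tst.mul_left (Tst.X hf i j) _)
  have h' : f * A g - g * A f ∈ Ex n := by
    rw [h]
    exact Submodule.smul_mem _ _ (Submodule.sum_mem _ fun i _ => Submodule.sum_mem _ fun j _ =>
      ⟨Tst.X (hT i j) _ _, I_X _ _ (hT i j)⟩)
  have := J_Ex h'
  rw [map_sub] at this
  linarith

section Weighted

variable {θ : Sm n} (hθ : θ ∈ Tst n) (v : Sm n)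
include hθ

lemma J_v0_v1 : J (θ * (v * D v)) = -(1 / 2) * J (D θ * (v * v)) := by
  have h := J_D (Tst.mul_right hθ (v * v))
  rw [show D (θ * (v * v)) = (2 : ℝ) • (θ * (v * D v)) + D θ * (v * v) from
    Sm.ext' fun x => by simp; ring, map_add, map_smul, smul_eq_mul] at h
  linarith

lemma J_v0_v2 : J (θ * (v * D (D v))) =
    -J (θ * (D v * D v)) + 1 / 2 * J (D (D θ) * (v * v)) := by
  have h := J_D (Tst.mul_right hθ (v * D v))
  rw [show D (θ * (v * D v)) = θ * (v * D (D v)) + θ * (D v * D v) + D θ * (v * D v) from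
    Sm.ext' fun x => by simp; ring, map_add, map_add] at h
  have h1 := J_v0_v1 (Tst.D hθ) v
  linarith

lemma J_v0_v3 : J (θ * (v * D (D (D v)))) =
    3 / 2 * J (D θ * (D v * D v)) - 1 / 2 * J (D (D (D θ)) * (v * v)) := by
  have h := J_D (Tst.mul_right hθ (v * D (D v)))
  rw [show D (θ * (v * D (D v))) = θ * (v * D (D (D v))) + θ * (D v * D (D v))
    + D θ * (v * D (D v)) from
    Sm.ext' fun x => by simp; ring, map_add, map_add] at h
  have h1 := J_v0_v1 hθ (D v)
  have h2 := J_v0_v2 (Tst.D hθ) v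
  linarith

lemma J_v0_v4 : J (θ * (v * D (D (D (D v))))) = J (θ * (D (D v) * D (D v)))
    - 2 * J (D (D θ) * (D v * D v)) + 1 / 2 * J (D (D (D (D θ))) * (v * v)) := by
  have h := J_D (Tst.mul_right hθ (v * D (D (D v))))
  rw [show D (θ * (v * D (D (D v)))) = θ * (v * D (D (D (D v)))) + θ * (D v * D (D (D v)))
    + D θ * (v * D (D (D v))) from
    Sm.ext' fun x => by simp; ring, map_add, map_add] at h
  have h1 := J_v0_v2 hθ (D v)
  have h2 := J_v0_v3 (Tst.D hθ) v
  linarith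

variable (hr : Rad θ)
include hr

lemma J_A_symm_weight (f g : Sm n) : J (θ * (f * A g)) = J (θ * (g * A f)) := by
  have := J_A_symm (Tst.mul_right hθ f) g
  rw [hr.A_mul] at this
  rw [← mul_assoc, this]
  congr 1
  ring

lemma J_v0_A1 : J (θ * (v * A (D v))) = -(1 / 2) * J (D θ * (v * A v)) := by
  have h := J_D (Tst.mul_right hθ (v * A v))
  rw [show D (θ * (v * A v)) = θ * (v * A (D v)) + θ * (D v * A v) + D θ * (v * A v) from
    Sm.ext' fun x => by simp [D_A]; ring, map_add, map_add] at h
  have h1 := J_A_symm_weight hθ hr v (D v)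
  linarith

lemma J_v1_A0 : J (θ * (D v * A v)) = -(1 / 2) * J (D θ * (v * A v)) := by
  rw [J_A_symm_weight hθ hr, J_v0_A1 hθ v hr]

lemma J_v0_A2 : J (θ * (v * A (D (D v)))) =
    -J (θ * (D v * A (D v))) + 1 / 2 * J (D (D θ) * (v * A v)) := by
  have h := J_D (Tst.mul_right hθ (v * A (D v)))
  rw [show D (θ * (v * A (D v))) = θ * (v * A (D (D v))) + θ * (D v * A (D v))
    + D θ * (v * A (D v)) from
    Sm.ext' fun x => by simp [D_A]; ring, map_add, map_add] at h
  have h1 := J_v0_A1 (Tst.D hθ) v hr.D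
  linarith

lemma J_v1_A1 : J (θ * (D v * A (D v))) =
    -J (θ * (D (D v) * A v)) + 1 / 2 * J (D (D θ) * (v * A v)) := by
  have h1 := J_v0_A2 hθ v hr
  have h2 := J_A_symm_weight hθ hr v (D (D v))
  linarith

lemma J_v0_AA : J (θ * (v * A (A v))) = J (θ * (A v * A v)) := J_A_symm_weight hθ hr v (A v)

lemma J_v1_AA : J (θ * (D v * A (A v))) = -(1 / 2) * J (D θ * (A v * A v)) := by
  rw [J_A_symm_weight hθ hr, ← D_A, J_v0_v1 hθ]

/-- The energy identity: a constant coefficient fourth order operator tested with `θ v`. -/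
lemma J_energy (k₃ k₂ k₁ k₀ kA : ℝ) :
    J (θ * (v * (D (D (D (D v))) + k₃ • D (D (D v)) + k₂ • D (D v) + k₁ • D v + k₀ • v
      + (2 : ℝ) • A (D (D v)) + k₃ • A (D v) + kA • A v + A (A v)))) =
    J (θ * (D (D v) * D (D v))) + J (θ * (A v * A v)) - 2 * J (θ * (D v * A (D v)))
      - k₂ * J (θ * (D v * D v)) + kA * J (θ * (v * A v)) + k₀ * J (θ * (v * v))
      + J (((3 / 2 * k₃) • D θ - (2 : ℝ) • D (D θ)) * (D v * D v))
      + J (((1 / 2 : ℝ) • D (D (D (D θ))) - (k₃ / 2) • D (D (D θ)) + (k₂ / 2) • D (D θ)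
        - (k₁ / 2) • D θ) * (v * v))
      + J ((D (D θ) - (k₃ / 2) • D θ) * (v * A v)) := by
  simp only [mul_add, add_mul, sub_mul, mul_smul_comm, smul_mul_assoc, map_add, map_sub, map_smul,
    smul_eq_mul]
  rw [J_v0_v4 hθ, J_v0_v3 hθ, J_v0_v2 hθ, J_v0_v1 hθ, J_v0_A2 hθ v hr, J_v0_A1 hθ v hr,
    J_v0_AA hθ v hr]
  ring

/-- The dilation identity: the same operator tested with `θ D v`. -/
lemma J_dilation (k₃ k₂ k₁ k₀ kA : ℝ) :
    J (θ * (D v * (D (D (D (D v))) + k₃ • D (D (D v)) + k₂ • D (D v) + k₁ • D v + k₀ • v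
      + (2 : ℝ) • A (D (D v)) + k₃ • A (D v) + kA • A v + A (A v)))) =
    -k₃ * J (θ * (D (D v) * D (D v))) + k₁ * J (θ * (D v * D v)) + k₃ * J (θ * (D v * A (D v)))
      + J (((3 / 2 : ℝ) • D θ) * (D (D v) * D (D v)))
      + J ((-(1 / 2 : ℝ) • D (D (D θ)) + (k₃ / 2) • D (D θ) - (k₂ / 2) • D θ) * (D v * D v))
      + J ((-(k₀ / 2) • D θ) * (v * v)) + J (D θ * (D (D v) * A v))
      + J ((-(1 / 2 : ℝ) • D (D (D θ)) - (kA / 2) • D θ) * (v * A v))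
      + J ((-(1 / 2 : ℝ) • D θ) * (A v * A v)) := by
  have h0 : J (θ * (D v * v)) = -(1 / 2) * J (D θ * (v * v)) := by
    rw [mul_comm (D v), J_v0_v1 hθ]
  simp only [mul_add, add_mul, sub_mul, mul_smul_comm, smul_mul_assoc, map_add, map_sub, map_smul,
    smul_eq_mul]
  rw [J_v0_v3 hθ (D v), J_v0_v2 hθ (D v), J_v0_v1 hθ (D v), h0, J_v0_A1 hθ (D v) hr,
    J_v1_A0 hθ v hr, J_v1_AA hθ v hr, J_v1_A1 (Tst.D hθ) v hr.D]
  ring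

end Weighted

lemma J_sq_expand {f : Sm n} (hf : f ∈ Tst n) (κ : ℝ) :
    J ((D (D f) + (2 : ℝ) • D f - κ • f + A f) * (D (D f) + (2 : ℝ) • D f - κ • f + A f)) =
    J (D (D f) * D (D f)) + (4 + 2 * κ) * J (D f * D f) - 2 * J (D f * A (D f))
      + J (A f * A f) - 2 * κ * J (f * A f) + κ ^ 2 * J (f * f) := by
  have h1 := J_D (Tst.mul_right (Tst.D hf) (D f))
  rw [show D (D f * D f) = (2 : ℝ) • (D (D f) * D f) from
    Sm.ext' fun x => by simp; ring, map_smul, smul_eq_mul] at h1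
  have h2 := J_D (Tst.mul_right hf (D f))
  rw [show D (f * D f) = D (D f) * f + D f * D f from
    Sm.ext' fun x => by simp; ring, map_add] at h2
  have h3 := J_D (Tst.mul_right hf f)
  rw [show D (f * f) = (2 : ℝ) • (D f * f) from
    Sm.ext' fun x => by simp; ring, map_smul, smul_eq_mul] at h3
  have h4 := J_D (Tst.mul_right (Tst.D hf) (A f))
  rw [show D (D f * A f) = D (D f) * A f + D f * A (D f) from
    Sm.ext' fun x => by simp [D_A]; ring, map_add] at h4
  have h5 := J_D (Tst.mul_right hf (A f))
  rw [show D (f * A f) = D f * A f + f * A (D f) from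
    Sm.ext' fun x => by simp [D_A]; ring, map_add, J_A_symm hf] at h5
  rw [show (D (D f) + (2 : ℝ) • D f - κ • f + A f) * (D (D f) + (2 : ℝ) • D f - κ • f + A f) =
    D (D f) * D (D f) + (4 : ℝ) • (D f * D f) + (κ ^ 2) • (f * f) + A f * A f
      + (4 : ℝ) • (D (D f) * D f) - (2 * κ) • (D (D f) * f) + (2 : ℝ) • (D (D f) * A f)
      - (4 * κ) • (D f * f) + (4 : ℝ) • (D f * A f) - (2 * κ) • (f * A f) from
    Sm.ext' fun x => by simp; ring]
  simp only [map_add, map_sub, map_smul, smul_eq_mul]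
  linear_combination 2 * h1 - 2 * κ * h2 - 2 * κ * h3 + 2 * h4 + 2 * h5

/-- The quadratic form of the conjugated Laplacian on a cut off function. -/
lemma J_sq_cutoff {η : Sm n} (hη : η ∈ Tst n) (hr : Rad η) (v : Sm n) (κ : ℝ) :
    J ((D (D (η * v)) + (2 : ℝ) • D (η * v) - κ • (η * v) + A (η * v)) *
      (D (D (η * v)) + (2 : ℝ) • D (η * v) - κ • (η * v) + A (η * v))) =
    J (η * η * (D (D v) * D (D v))) + J (η * η * (A v * A v))
      - 2 * J (η * η * (D v * A (D v))) + (4 + 2 * κ) * J (η * η * (D v * D v))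
      - 2 * κ * J (η * η * (v * A v)) + κ ^ 2 * J (η * η * (v * v))
      + J (((2 : ℝ) • (D η * D η) - (4 : ℝ) • (η * D (D η))) * (D v * D v))
      + J ((η * D (D (D (D η))) - (4 + 2 * κ) • (η * D (D η))) * (v * v))
      + J (((2 : ℝ) • (η * D (D η))) * (v * A v)) := by
  have hf : η * v ∈ Tst n := Tst.mul_right hη v
  have a1 := J_v0_v1 (Tst.mul_right hη (D η)) (D v)
  have a2 := J_v0_v2 (Tst.mul_right hη (D (D η))) v
  have a3 := J_v0_v1 (Tst.mul_right (Tst.D hη) (D (D η))) v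
  have a4 := J_v0_v1 (Tst.mul_right hη (D η)) v
  have a5 := J_v0_A1 (Tst.mul_right hη (D η)) v (hr.mul hr.D)
  have a6 := J_v1_A0 (Tst.mul_right hη (D η)) v (hr.mul hr.D)
  rw [J_sq_expand hf,
    show D (D (η * v)) * D (D (η * v)) = η * η * (D (D v) * D (D v))
      + (4 : ℝ) • (D η * D η * (D v * D v)) + D (D η) * D (D η) * (v * v)
      + (4 : ℝ) • (η * D η * (D v * D (D v))) + (2 : ℝ) • (η * D (D η) * (v * D (D v)))
      + (4 : ℝ) • (D η * D (D η) * (v * D v)) from Sm.ext' fun x => by simp; ring,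
    show D (η * v) * D (η * v) = η * η * (D v * D v) + (2 : ℝ) • (η * D η * (v * D v))
      + D η * D η * (v * v) from Sm.ext' fun x => by simp; ring,
    show D (η * v) * A (D (η * v)) = η * η * (D v * A (D v)) + η * D η * (v * A (D v))
      + η * D η * (D v * A v) + D η * D η * (v * A v) from Sm.ext' fun x => by
        rw [D_mul, A_add, hr.A_mul, mul_comm v, hr.D.A_mul]; simp; ring,
    show A (η * v) * A (η * v) = η * η * (A v * A v) from Sm.ext' fun x => by
        rw [hr.A_mul]; simp; ring,
    show η * v * A (η * v) = η * η * (v * A v) from Sm.ext' fun x => by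
        rw [hr.A_mul]; simp; ring,
    show η * v * (η * v) = η * η * (v * v) by ring]
  rw [show D (η * D η) = D η * D η + η * D (D η) from
    Sm.ext' fun x => by simp; ring] at a1 a4 a5 a6
  rw [show D (D (η * D (D η))) = D (D η) * D (D η) + (2 : ℝ) • (D η * D (D (D η)))
      + η * D (D (D (D η))) from Sm.ext' fun x => by simp; ring] at a2
  rw [show D (D η * D (D η)) = D (D η) * D (D η) + D η * D (D (D η)) from
    Sm.ext' fun x => by simp; ring] at a3
  simp only [mul_add, add_mul, sub_mul, smul_mul_assoc, map_add, map_sub, map_smul,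
    smul_eq_mul] at a1 a2 a3 a4 a5 a6 ⊢
  linear_combination 4 * a1 + 2 * a2 + 4 * a3 + (4 + 2 * κ) * 2 * a4 - 2 * a5 - 2 * a6

end

section

variable {n : ℕ}

/-- The Emden–Fowler profile `v` of a stable solution: `P` is a constant coefficient fourth order
operator applied to `v`, the product `v * P` is the nonnegative density `|v| ^ (p + 1)`, and
stability holds for cutoffs of `v`. -/
structure StableProfile (v P : Sm n) (p k₃ k₂ k₁ k₀ l κ : ℝ) : Prop where
  eq : P = D (D (D (D v))) + k₃ • D (D (D v)) + k₂ • D (D v) + k₁ • D v + k₀ • v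
      + (2 : ℝ) • A (D (D v)) + k₃ • A (D v) + (-l) • A v + A (A v)
  density : ∀ x, x ≠ 0 → (v * P).1 x = |v.1 x| ^ (p + 1)
  D_density : D (v * P) = (p + 1) • (D v * P)
  stable : ∀ η ∈ Tst n, Rad η → p * J (η * η * (v * P)) ≤
    J ((D (D (η * v)) + (2 : ℝ) • D (η * v) - κ • (η * v) + A (η * v)) *
      (D (D (η * v)) + (2 : ℝ) • D (η * v) - κ • (η * v) + A (η * v)))
  one_lt : 1 < p
  k₃_pos : 0 < k₃
  k₁_neg : k₁ < 0
  lt_l : 2 * κ < p * l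
  lt_k₀ : κ ^ 2 < p * k₀

/-- The energy density of a profile. -/
def energyDensity (v P : Sm n) : Sm n :=
  v * v + D v * D v + D (D v) * D (D v) + A v * A v + v * P

lemma mul_le_abs_mul {c t E : ℝ} (h : |t| ≤ E) : c * t ≤ |c| * E :=
  (le_abs_self _).trans (by rw [abs_mul]; exact mul_le_mul_of_nonneg_left h (abs_nonneg c))

lemma abs_mul_le (c : ℝ) {t E : ℝ} (h : |t| ≤ E) : |c * t| ≤ |c| * E := by
  rw [abs_mul]; exact mul_le_mul_of_nonneg_left h (abs_nonneg c)

lemma J_mul_self_nonneg {η : Sm n} (hη : η ∈ Tst n) (f : Sm n) : 0 ≤ J (η * η * (f * f)) :=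
  J_nonneg (Tst.mul_right (Tst.mul_right hη _) _) fun x _ => by
    simp only [coe_mul]; nlinarith [sq_nonneg (η.1 x * f.1 x)]

lemma J_mul_A_nonpos {η : Sm n} (hη : η ∈ Tst n) (hr : Rad η) (f : Sm n) :
    J (η * η * (f * A f)) ≤ 0 := by
  rw [J_eq (Tst.mul_right (Tst.mul_right hη _) _)]
  exact I_mul_A_nonpos hη hr f

variable {v P : Sm n} {p k₃ k₂ k₁ k₀ l κ : ℝ}

/-- The error terms produced by a cutoff `η` are all at most `E`. -/
def ErrorsLE (v η : Sm n) (E : ℝ) : Prop :=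
  ∀ i j : ℕ, 1 ≤ i + j → i + j ≤ 4 →
    |J ((D : Sm n → Sm n)^[i] η * (D : Sm n → Sm n)^[j] η * (v * v))| ≤ E ∧
    |J ((D : Sm n → Sm n)^[i] η * (D : Sm n → Sm n)^[j] η * (D v * D v))| ≤ E ∧
    |J ((D : Sm n → Sm n)^[i] η * (D : Sm n → Sm n)^[j] η * (v * A v))| ≤ E

lemma D_sq (η : Sm n) : D (η * η) = (2 : ℝ) • (η * D η) := Sm.ext' fun x => by simp; ring

lemma D2_sq (η : Sm n) : D (D (η * η)) = (2 : ℝ) • (D η * D η) + (2 : ℝ) • (η * D (D η)) :=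
  Sm.ext' fun x => by simp; ring

lemma D3_sq (η : Sm n) :
    D (D (D (η * η))) = (6 : ℝ) • (D η * D (D η)) + (2 : ℝ) • (η * D (D (D η))) :=
  Sm.ext' fun x => by simp; ring

lemma D4_sq (η : Sm n) : D (D (D (D (η * η)))) = (6 : ℝ) • (D (D η) * D (D η))
    + (8 : ℝ) • (D η * D (D (D η))) + (2 : ℝ) • (η * D (D (D (D η)))) :=
  Sm.ext' fun x => by simp; ring

lemma StableProfile.core (h : StableProfile v P p k₃ k₂ k₁ k₀ l κ) : ∃ C, 0 < C ∧
    ∀ η ∈ Tst n, Rad η → ∀ E, 0 ≤ E → ErrorsLE v η E →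
    J (η * η * (D v * D v)) ≤ E → J (η * η * energyDensity v P) ≤ C * E := by
  have hp := h.one_lt
  have hl := sub_pos.2 h.lt_l
  have hk := sub_pos.2 h.lt_k₀
  obtain ⟨C₁, hC₁⟩ : ∃ C₁, ∀ η ∈ Tst n, Rad η → ∀ E, 0 ≤ E → ErrorsLE v η E →
      |J (η * η * (v * P)) - (J (η * η * (D (D v) * D (D v))) + J (η * η * (A v * A v))
      - 2 * J (η * η * (D v * A (D v))) - k₂ * J (η * η * (D v * D v))
      - l * J (η * η * (v * A v)) + k₀ * J (η * η * (v * v)))| ≤ C₁ * E := by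
    refine ⟨20 + 8 * |k₃| + 2 * |k₂| + |k₁|, fun η hη hr E hE he => ?_⟩
    obtain ⟨b1, b2, b3⟩ := he 0 1 (by norm_num) (by norm_num)
    obtain ⟨b4, b5, b6⟩ := he 1 1 (by norm_num) (by norm_num)
    obtain ⟨b7, b8, b9⟩ := he 0 2 (by norm_num) (by norm_num)
    obtain ⟨b10, -, -⟩ := he 1 2 (by norm_num) (by norm_num)
    obtain ⟨b11, -, -⟩ := he 0 3 (by norm_num) (by norm_num)
    obtain ⟨b12, -, -⟩ := he 2 2 (by norm_num) (by norm_num)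
    obtain ⟨b13, -, -⟩ := he 1 3 (by norm_num) (by norm_num)
    obtain ⟨b14, -, -⟩ := he 0 4 (by norm_num) (by norm_num)
    simp only [Function.iterate_succ, Function.iterate_zero, Function.comp_apply, id_eq]
      at b1 b2 b3 b4 b5 b6 b7 b8 b9 b10 b11 b12 b13 b14
    rw [h.eq, J_energy (Tst.mul_right hη η) v (hr.mul hr), D4_sq, D3_sq, D2_sq, D_sq]
    simp only [add_mul, sub_mul, smul_add, smul_smul, smul_mul_assoc, map_sub, map_add, map_smul,
      smul_eq_mul]
    have c1 := abs_mul_le k₁ b1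
    have c2 := abs_mul_le k₃ b2
    have c3 := abs_mul_le k₃ b3
    have c4 := abs_mul_le k₂ b4
    have c7 := abs_mul_le k₂ b7
    have c10 := abs_mul_le k₃ b10
    have c11 := abs_mul_le k₃ b11
    rw [abs_le] at *
    constructor <;> linarith
  obtain ⟨C₂, hC₂⟩ : ∃ C₂, ∀ η ∈ Tst n, Rad η → ∀ E, 0 ≤ E → ErrorsLE v η E →
      p * J (η * η * (v * P)) ≤ (J (η * η * (D (D v) * D (D v))) + J (η * η * (A v * A v))
      - 2 * J (η * η * (D v * A (D v))) + (4 + 2 * κ) * J (η * η * (D v * D v))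
      - 2 * κ * J (η * η * (v * A v)) + κ ^ 2 * J (η * η * (v * v))) + C₂ * E := by
    refine ⟨2 + 4 + 1 + |4 + 2 * κ| + 2, fun η hη hr E hE he => ?_⟩
    have hs := h.stable η hη hr
    rw [J_sq_cutoff hη hr] at hs
    obtain ⟨-, b1, -⟩ := he 1 1 (by norm_num) (by norm_num)
    obtain ⟨b2, b3, b4⟩ := he 0 2 (by norm_num) (by norm_num)
    obtain ⟨b5, -, -⟩ := he 0 4 (by norm_num) (by norm_num)
    simp only [Function.iterate_succ, Function.iterate_zero, Function.comp_apply, id_eq]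
      at b1 b2 b3 b4 b5
    simp only [sub_mul, smul_mul_assoc, map_sub, map_smul, smul_eq_mul] at hs
    have c2 := mul_le_abs_mul (c := -(4 + 2 * κ)) b2
    rw [abs_neg] at c2
    linarith [(abs_le.1 b1).2, (abs_le.1 b3).1, (abs_le.1 b4).2, (abs_le.1 b5).2]
  set C₃ := |4 + 2 * κ + p * k₂| + C₂ + p * C₁ with hC₃
  refine ⟨|C₃ / (p * k₀ - κ ^ 2) + 1 + 2 * (C₃ / (p - 1)) + |k₂| + |l| * (C₃ / (p * l - 2 * κ))
    + |k₀| * (C₃ / (p * k₀ - κ ^ 2)) + C₁| + 1, by positivity, fun η hη hr E hE he hg => ?_⟩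
  have h1 := hC₁ η hη hr E hE he
  have h2 := hC₂ η hη hr E hE he
  have ha := J_mul_self_nonneg hη (D (D v))
  have hb := J_mul_self_nonneg hη (A v)
  have hf := J_mul_self_nonneg hη v
  have hg0 := J_mul_self_nonneg hη (D v)
  have hd := J_mul_A_nonpos hη hr (D v)
  have he0 := J_mul_A_nonpos hη hr v
  rw [energyDensity]
  simp only [mul_add, map_add]
  generalize J (η * η * (D (D v) * D (D v))) = a at *
  generalize J (η * η * (A v * A v)) = b at *
  generalize J (η * η * (v * v)) = f at *
  generalize J (η * η * (D v * D v)) = g at *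
  generalize J (η * η * (D v * A (D v))) = d at *
  generalize J (η * η * (v * A v)) = e at *
  generalize J (η * η * (v * P)) = w at *
  rw [abs_le] at h1
  have h3 : (p - 1) * (a + b - 2 * d) + (p * l - 2 * κ) * (-e) + (p * k₀ - κ ^ 2) * f
      ≤ C₃ * E := by
    have i1 := mul_le_mul_of_nonneg_left h1.1 (by linarith : 0 ≤ p)
    have i2 : (4 + 2 * κ + p * k₂) * g ≤ |4 + 2 * κ + p * k₂| * E :=
      mul_le_abs_mul (by rwa [abs_of_nonneg hg0])
    rw [hC₃]
    linarith
  have j1 := mul_nonneg (sub_pos.2 hp).le (by linarith : 0 ≤ a + b - 2 * d)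
  have j2 := mul_nonneg hl.le (by linarith : 0 ≤ -e)
  have j3 := mul_nonneg hk.le hf
  have l1 : a + b - 2 * d ≤ C₃ / (p - 1) * E := by
    rw [div_mul_eq_mul_div, le_div_iff₀ (sub_pos.2 hp)]; linarith
  have l2 : -e ≤ C₃ / (p * l - 2 * κ) * E := by
    rw [div_mul_eq_mul_div, le_div_iff₀ hl]; linarith
  have l3 : f ≤ C₃ / (p * k₀ - κ ^ 2) * E := by
    rw [div_mul_eq_mul_div, le_div_iff₀ hk]; linarith
  have m2 : l * (-e) ≤ |l| * (C₃ / (p * l - 2 * κ) * E) :=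
    mul_le_abs_mul (by rwa [abs_of_nonneg (by linarith)])
  have m3 : k₀ * f ≤ |k₀| * (C₃ / (p * k₀ - κ ^ 2) * E) :=
    mul_le_abs_mul (by rwa [abs_of_nonneg hf])
  have m4 : -k₂ * g ≤ |-k₂| * E := mul_le_abs_mul (by rwa [abs_of_nonneg hg0])
  rw [abs_neg] at m4
  have key : f + g + a + b + w ≤ (C₃ / (p * k₀ - κ ^ 2) + 1 + 2 * (C₃ / (p - 1)) + |k₂|
      + |l| * (C₃ / (p * l - 2 * κ)) + |k₀| * (C₃ / (p * k₀ - κ ^ 2)) + C₁) * E := by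
    linarith
  exact key.trans (mul_le_mul_of_nonneg_right ((le_abs_self _).trans (by linarith)) hE)

end

section

variable {n : ℕ}

lemma abs_J_le {r s : Sm n} (hr : r ∈ Tst n) (hs : s ∈ Tst n)
    (h : ∀ x, x ≠ 0 → |r.1 x| ≤ s.1 x) : |J r| ≤ J s := by
  rw [abs_le, ← map_neg]
  exact ⟨J_mono (neg_mem hs) hr fun x hx => (abs_le.1 (h x hx)).1,
    J_mono hr hs fun x hx => (abs_le.1 (h x hx)).2⟩

lemma iterate_D_mem {f : Sm n} (hf : f ∈ Tst n) (i : ℕ) : (D : Sm n → Sm n)^[i] f ∈ Tst n := by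
  induction i with
  | zero => exact hf
  | succ i ih => rw [Function.iterate_succ_apply']; exact Tst.D ih

variable {v P : Sm n} {p k₃ k₂ k₁ k₀ l κ : ℝ}

lemma StableProfile.density_nonneg (h : StableProfile v P p k₃ k₂ k₁ k₀ l κ)
    {x : EuclideanSpace ℝ (Fin n)} (hx : x ≠ 0) : 0 ≤ (v * P).1 x := by
  rw [h.density x hx]; positivity

set_option maxHeartbeats 800000 in
/-- A profile has energy controlled by its energy where the cutoff is not constant. -/
lemma StableProfile.exists_le_of_transition (h : StableProfile v P p k₃ k₂ k₁ k₀ l κ) :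
    ∃ C, 0 < C ∧ ∀ η ∈ Tst n, Rad η → ∀ ρ ∈ Tst n,
    (∀ i j : ℕ, 1 ≤ i + j → i + j ≤ 4 → ∀ x, x ≠ 0 →
      |((D : Sm n → Sm n)^[i] η * (D : Sm n → Sm n)^[j] η).1 x| ≤ ρ.1 x) →
    J (η * η * energyDensity v P) ≤ C * J (ρ * energyDensity v P) := by
  obtain ⟨C₀, hC₀, hcore⟩ := h.core
  have hk := neg_pos.2 h.k₁_neg
  have hp := h.one_lt
  set C₁ := (17 + 2 * |k₃| + |k₂| + |k₀| + |l|) / (-k₁) with hC₁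
  have hC₁' : 0 ≤ C₁ := by positivity
  refine ⟨C₀ * (1 + C₁), by positivity, fun η hη hr ρ hρ hb => ?_⟩
  set E := J (ρ * energyDensity v P) with hE
  have hq : ∀ i j : ℕ, 1 ≤ i + j → i + j ≤ 4 → ∀ q : Sm n,
      (∀ x, x ≠ 0 → |q.1 x| ≤ (energyDensity v P).1 x) →
      |J ((D : Sm n → Sm n)^[i] η * (D : Sm n → Sm n)^[j] η * q)| ≤ E := by
    intro i j h1 h4 q hq
    refine abs_J_le (Tst.mul_right (Tst.mul_right (iterate_D_mem hη i) _) _)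
      (Tst.mul_right hρ _) fun x hx => ?_
    rw [coe_mul, abs_mul, coe_mul ρ]
    exact mul_le_mul (hb i j h1 h4 x hx) (hq x hx) (abs_nonneg _)
      ((abs_nonneg _).trans (hb i j h1 h4 x hx))
  have hF : ∀ x, x ≠ 0 → (energyDensity v P).1 x = v.1 x ^ 2 + (D v).1 x ^ 2
      + (D (D v)).1 x ^ 2 + (A v).1 x ^ 2 + (v * P).1 x ∧ 0 ≤ (v * P).1 x := fun x hx =>
    ⟨by simp [energyDensity, sq], h.density_nonneg hx⟩
  have hE0 : 0 ≤ E := (abs_nonneg _).trans (hq 0 1 le_rfl (by norm_num) 0 fun x hx => by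
    have := (hF x hx).2
    rw [coe_zero, abs_zero, (hF x hx).1]
    positivity)
  have q00 : ∀ x, x ≠ 0 → |(v * v).1 x| ≤ (energyDensity v P).1 x := fun x hx => by
    rw [(hF x hx).1, coe_mul v v, abs_mul_self]
    nlinarith [hF x hx, sq_nonneg ((D v).1 x), sq_nonneg ((D (D v)).1 x), sq_nonneg ((A v).1 x)]
  have q11 : ∀ x, x ≠ 0 → |(D v * D v).1 x| ≤ (energyDensity v P).1 x := fun x hx => by
    rw [(hF x hx).1, coe_mul (D v), abs_mul_self]
    nlinarith [hF x hx, sq_nonneg (v.1 x), sq_nonneg ((D (D v)).1 x), sq_nonneg ((A v).1 x)]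
  have q22 : ∀ x, x ≠ 0 → |(D (D v) * D (D v)).1 x| ≤ (energyDensity v P).1 x := fun x hx => by
    rw [(hF x hx).1, coe_mul (D (D v)), abs_mul_self]
    nlinarith [hF x hx, sq_nonneg (v.1 x), sq_nonneg ((D v).1 x), sq_nonneg ((A v).1 x)]
  have qAA : ∀ x, x ≠ 0 → |(A v * A v).1 x| ≤ (energyDensity v P).1 x := fun x hx => by
    rw [(hF x hx).1, coe_mul (A v), abs_mul_self]
    nlinarith [hF x hx, sq_nonneg (v.1 x), sq_nonneg ((D v).1 x), sq_nonneg ((D (D v)).1 x)]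
  have q0A : ∀ x, x ≠ 0 → |(v * A v).1 x| ≤ (energyDensity v P).1 x := fun x hx => by
    rw [(hF x hx).1, coe_mul v (A v), abs_le]
    constructor <;>
    nlinarith [hF x hx, sq_nonneg (v.1 x - (A v).1 x), sq_nonneg (v.1 x + (A v).1 x),
      sq_nonneg ((D v).1 x), sq_nonneg ((D (D v)).1 x)]
  have q2A : ∀ x, x ≠ 0 → |(D (D v) * A v).1 x| ≤ (energyDensity v P).1 x := fun x hx => by
    rw [(hF x hx).1, coe_mul (D (D v)), abs_le]
    constructor <;>
    nlinarith [hF x hx, sq_nonneg ((D (D v)).1 x - (A v).1 x), sq_nonneg (v.1 x),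
      sq_nonneg ((D (D v)).1 x + (A v).1 x), sq_nonneg ((D v).1 x)]
  have qW : ∀ x, x ≠ 0 → |(v * P).1 x| ≤ (energyDensity v P).1 x := fun x hx => by
    rw [(hF x hx).1, abs_of_nonneg (hF x hx).2]
    nlinarith [sq_nonneg (v.1 x), sq_nonneg ((D v).1 x), sq_nonneg ((D (D v)).1 x),
      sq_nonneg ((A v).1 x)]
  have hθ := Tst.mul_right hη η
  have hdil := J_dilation hθ v (hr.mul hr) k₃ k₂ k₁ k₀ (-l)
  rw [← h.eq] at hdil
  have hW : J (η * η * (D v * P)) = -(1 / (p + 1)) * J (D (η * η) * (v * P)) := by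
    have h1 := J_D (Tst.mul_right hθ (v * P))
    rw [D_mul, h.D_density, map_add, mul_smul_comm, map_smul, smul_eq_mul,
      mul_comm (v * P)] at h1
    have : p + 1 ≠ 0 := by linarith
    field_simp
    linarith
  rw [hW, D3_sq, D2_sq, D_sq] at hdil
  simp only [add_mul, sub_mul, smul_add, smul_smul, smul_mul_assoc, map_sub, map_add, map_smul,
    smul_eq_mul] at hdil
  have hv1 := J_mul_A_nonpos hη hr (D v)
  have hv2 := J_mul_self_nonneg hη (D (D v))
  have e01 := hq 0 1 (by norm_num) (by norm_num)
  have e11 := hq 1 1 (by norm_num) (by norm_num)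
  have e02 := hq 0 2 (by norm_num) (by norm_num)
  have e12 := hq 1 2 (by norm_num) (by norm_num)
  have e03 := hq 0 3 (by norm_num) (by norm_num)
  simp only [Function.iterate_succ, Function.iterate_zero, Function.comp_apply, id_eq]
    at e01 e11 e02 e12 e03
  have b1 := abs_le.1 (e01 _ q22)
  have b2 := abs_le.1 (e12 _ q11)
  have b3 := abs_le.1 (e03 _ q11)
  have b4 := abs_le.1 (abs_mul_le k₃ (e11 _ q11))
  have b5 := abs_le.1 (abs_mul_le k₃ (e02 _ q11))
  have b6 := abs_le.1 (abs_mul_le k₂ (e01 _ q11))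
  have b7 := abs_le.1 (abs_mul_le k₀ (e01 _ q00))
  have b8 := abs_le.1 (e01 _ q2A)
  have b9 := abs_le.1 (e12 _ q0A)
  have b10 := abs_le.1 (e03 _ q0A)
  have b11 := abs_le.1 (abs_mul_le l (e01 _ q0A))
  have b12 := abs_le.1 (e01 _ qAA)
  have b13 := abs_le.1 (abs_mul_le (1 / (p + 1)) (e01 _ qW))
  have hp1 : |1 / (p + 1)| * E ≤ 1 * E := by
    refine mul_le_mul_of_nonneg_right ?_ hE0
    rw [abs_of_pos (by positivity), div_le_one (by positivity)]
    linarith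
  have s1 := mul_nonneg h.k₃_pos.le hv2
  have s2 := mul_nonneg h.k₃_pos.le (neg_nonneg.2 hv1)
  have hg : J (η * η * (D v * D v)) ≤ C₁ * E := by
    rw [hC₁, div_mul_eq_mul_div, le_div_iff₀ hk]
    linear_combination hdil + hE0 + s1 + s2 + 3 * b1.2 + 3 * b2.1 + b3.1 + b4.2 + b5.2
      + b6.1 + b7.1 + 2 * b8.2 + 3 * b9.1 + b10.1 + b11.2 + b12.1 + 2 * b13.2 + 2 * hp1
  have hE1 : E ≤ (1 + C₁) * E := by nlinarith
  have := hcore η hη hr ((1 + C₁) * E) (by positivity) (fun i j h1 h4 =>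
    ⟨(hq i j h1 h4 _ q00).trans hE1, (hq i j h1 h4 _ q11).trans hE1,
      (hq i j h1 h4 _ q0A).trans hE1⟩) (hg.trans (by linarith))
  linarith

lemma abs_mul_mul_le {r s t ρ θ σ δ : ℝ} (hδ : 0 < δ) (hr : |r| ≤ ρ) (hρ : ρ ^ 2 ≤ θ * σ)
    (hθ : 0 ≤ θ) (hσ : 0 ≤ σ) :
    |r * (s * t)| ≤ δ * (θ * (t * t)) + 1 / (2 * δ) * (σ * (s * s)) := by
  have h1 : r ^ 2 ≤ θ * σ := by
    rw [← sq_abs]; exact (pow_le_pow_left₀ (abs_nonneg r) hr 2).trans hρ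
  have h2 : 0 ≤ δ * (θ * (t * t)) := mul_nonneg hδ.le (mul_nonneg hθ (mul_self_nonneg t))
  have h3 : 0 ≤ 1 / (2 * δ) * (σ * (s * s)) :=
    mul_nonneg (by positivity) (mul_nonneg hσ (mul_self_nonneg s))
  refine abs_le_of_sq_le_sq ?_ (by linarith)
  have h4 : (δ * (θ * (t * t))) * (1 / (2 * δ) * (σ * (s * s))) = θ * σ * (s * t) ^ 2 / 2 := by
    field_simp
  nlinarith [mul_le_mul_of_nonneg_right h1 (sq_nonneg (s * t)),
    sq_nonneg (δ * (θ * (t * t)) - 1 / (2 * δ) * (σ * (s * s)))]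

/-- A Caccioppoli inequality for profiles. -/
lemma StableProfile.exists_le_of_weights (h : StableProfile v P p k₃ k₂ k₁ k₀ l κ) :
    ∃ C, 0 < C ∧ ∀ η ∈ Tst n, Rad η → ∀ ρ ∈ Tst n, ∀ σ ∈ Tst n,
    (∀ i j : ℕ, i + j ≤ 4 → ∀ x, x ≠ 0 →
      |((D : Sm n → Sm n)^[i] η * (D : Sm n → Sm n)^[j] η).1 x| ≤ ρ.1 x) →
    (∀ x, x ≠ 0 → ρ.1 x ^ 2 ≤ (η * η).1 x * σ.1 x) → (∀ x, x ≠ 0 → ρ.1 x ≤ σ.1 x) →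
    (∀ x, x ≠ 0 → |(D (D ρ)).1 x| ≤ σ.1 x) →
    J (η * η * energyDensity v P) ≤ C * J (σ * (v * v)) := by
  obtain ⟨C₀, hC₀, hcore⟩ := h.core
  refine ⟨4 * C₀ * (C₀ + 1), by positivity, fun η hη hr ρ hρ σ hσ hb hρσ hle hDD => ?_⟩
  set δ := 1 / (2 * (C₀ + 1)) with hδ
  have hδ0 : 0 < δ := by positivity
  have hδ1 : δ ≤ 1 := by rw [hδ, div_le_one (by positivity)]; linarith
  have hρ0 : ∀ x, x ≠ 0 → 0 ≤ ρ.1 x := fun x hx =>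
    (abs_nonneg _).trans (hb 0 0 (by norm_num) x hx)
  have hσ0 : ∀ x, x ≠ 0 → 0 ≤ σ.1 x := fun x hx => (hρ0 x hx).trans (hle x hx)
  have hθ := Tst.mul_right hη η
  have hTT : ∀ i j (q : Sm n), (D : Sm n → Sm n)^[i] η * (D : Sm n → Sm n)^[j] η * q ∈ Tst n :=
    fun i j q => Tst.mul_right (Tst.mul_right (iterate_D_mem hη i) _) _
  set a := J (η * η * (D (D v) * D (D v))) with ha
  set b := J (η * η * (A v * A v)) with hb'
  set Y := J (σ * (v * v)) with hY
  have ha0 : 0 ≤ a := J_mul_self_nonneg hη _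
  have hb0 : 0 ≤ b := J_mul_self_nonneg hη _
  have hY0 : 0 ≤ Y := J_nonneg (Tst.mul_right hσ _) fun x hx =>
    mul_nonneg (hσ0 x hx) (mul_self_nonneg _)
  set E := δ * (a + b) + 1 / δ * Y with hE
  have hYδ : Y ≤ 1 / δ * Y := le_mul_of_one_le_left hY0 (by rwa [one_le_div hδ0])
  have hYE : Y ≤ E := by nlinarith
  have hYδ2 : 1 / (2 * δ) * Y = 1 / δ * Y / 2 := by field_simp
  have hyoung : ∀ r ∈ Tst n, (∀ x, x ≠ 0 → |r.1 x| ≤ ρ.1 x) → ∀ q : Sm n,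
      |J (r * (v * q))| ≤ δ * J (η * η * (q * q)) + 1 / (2 * δ) * Y := by
    intro r hrT hrb q
    have : δ * J (η * η * (q * q)) + 1 / (2 * δ) * Y =
        J (δ • (η * η * (q * q)) + (1 / (2 * δ)) • (σ * (v * v))) := by
      simp only [map_add, map_smul, smul_eq_mul, hY]
    rw [this]
    refine abs_J_le (Tst.mul_right hrT _) (add_mem (Tst.smul (Tst.mul_right hθ _) _)
      (Tst.smul (Tst.mul_right hσ _) _)) fun x hx => ?_
    exact abs_mul_mul_le hδ0 (hrb x hx) (hρσ x hx) (mul_self_nonneg _) (hσ0 x hx)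
  have hG : J (ρ * (D v * D v)) ≤ E := by
    have h1 := J_v0_v2 hρ v
    have h2 := abs_le.1 (hyoung ρ hρ (fun x hx => (abs_of_nonneg (hρ0 x hx)).le) (D (D v)))
    have h3 : |J (D (D ρ) * (v * v))| ≤ Y :=
      abs_J_le (Tst.mul_right (Tst.D (Tst.D hρ)) _) (Tst.mul_right hσ _) fun x hx => by
        rw [coe_mul, abs_mul, coe_mul v v, abs_mul_self]
        exact mul_le_mul_of_nonneg_right (hDD x hx) (mul_self_nonneg _)
    have h4 := (abs_le.1 h3).2
    rw [hYδ2] at h2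
    have h5 := mul_nonneg hδ0.le hb0
    rw [hE, mul_add]
    linarith [h2.1, h2.2]
  have hsq : ∀ i j, i + j ≤ 4 → ∀ q : Sm n,
      |J ((D : Sm n → Sm n)^[i] η * (D : Sm n → Sm n)^[j] η * (q * q))| ≤ J (ρ * (q * q)) :=
    fun i j h4 q => abs_J_le (hTT i j _) (Tst.mul_right hρ _) fun x hx => by
      rw [coe_mul, abs_mul, coe_mul q q, abs_mul_self]
      exact mul_le_mul_of_nonneg_right (hb i j h4 x hx) (mul_self_nonneg _)
  have hvv : J (ρ * (v * v)) ≤ Y := J_mono (Tst.mul_right hρ _) (Tst.mul_right hσ _)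
    fun x hx => mul_le_mul_of_nonneg_right (hle x hx) (mul_self_nonneg _)
  have key := hcore η hη hr E (hY0.trans hYE) (fun i j _ h4 =>
    ⟨((hsq i j h4 v).trans hvv).trans hYE, (hsq i j h4 (D v)).trans hG, by
      have h2 := hyoung _ (Tst.mul_right (iterate_D_mem hη i) _) (hb i j h4) (A v)
      rw [hYδ2] at h2
      have h5 := mul_nonneg hδ0.le ha0
      rw [hE, mul_add]
      linarith⟩)
    (((le_abs_self _).trans (hsq 0 0 (by norm_num) (D v))).trans hG)
  have hab : a + b ≤ J (η * η * energyDensity v P) := by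
    have h1 := J_mul_self_nonneg hη v
    have h2 := J_mul_self_nonneg hη (D v)
    have h3 : 0 ≤ J (η * η * (v * P)) := J_nonneg (Tst.mul_right hθ _) fun x hx =>
      mul_nonneg (mul_self_nonneg _) (h.density_nonneg hx)
    rw [energyDensity]
    simp only [mul_add, map_add]
    linarith
  have hC : C₀ * δ ≤ 1 / 2 := by
    rw [hδ, mul_one_div, div_le_iff₀ (by positivity)]; linarith
  have h1 : C₀ * δ * (a + b) ≤ 1 / 2 * (a + b) := mul_le_mul_of_nonneg_right hC (by linarith)
  have h2 : C₀ * (1 / δ * Y) = 2 * C₀ * (C₀ + 1) * Y := by rw [hδ]; field_simp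
  rw [hE, mul_add, h2] at key
  linarith

end

section

variable {n : ℕ}

/-- A smooth function with values in `[0, 1]`, equal to `1` on `[0, 1]` and to `0` off `(-1, 2)`. -/
def bump (t : ℝ) : ℝ := Real.smoothTransition (t + 1) * Real.smoothTransition (2 - t)

lemma contDiff_bump : ContDiff ℝ (⊤ : ℕ∞) bump :=
  (Real.smoothTransition.contDiff.comp (contDiff_id.add contDiff_const)).mul
    (Real.smoothTransition.contDiff.comp (contDiff_const.sub contDiff_id))

lemma bump_nonneg (t : ℝ) : 0 ≤ bump t :=
  mul_nonneg (Real.smoothTransition.nonneg _) (Real.smoothTransition.nonneg _)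

lemma bump_le_one (t : ℝ) : bump t ≤ 1 :=
  mul_le_one₀ (Real.smoothTransition.le_one _) (Real.smoothTransition.nonneg _)
    (Real.smoothTransition.le_one _)

lemma bump_eq_one {t : ℝ} (h : t ∈ Icc (0 : ℝ) 1) : bump t = 1 := by
  rw [bump, Real.smoothTransition.one_of_one_le (by linarith [h.1]),
    Real.smoothTransition.one_of_one_le (by linarith [h.2]), one_mul]

lemma bump_eq_zero {t : ℝ} (h : t ∉ Icc (-1 : ℝ) 2) : bump t = 0 := by
  rw [mem_Icc, not_and_or, not_le, not_le] at h
  rcases h with h | h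
  · rw [bump, Real.smoothTransition.zero_of_nonpos (by linarith), zero_mul]
  · rw [bump, Real.smoothTransition.zero_of_nonpos (x := 2 - t) (by linarith), mul_zero]

lemma hasCompactSupport_bump : HasCompactSupport bump :=
  HasCompactSupport.intro isCompact_Icc fun _ => bump_eq_zero

lemma exists_iteratedDeriv_pow {χ : ℝ → ℝ} (h : ContDiff ℝ (⊤ : ℕ∞) χ) (hc : HasCompactSupport χ)
    (i N : ℕ) : ∃ g : ℝ → ℝ, ContDiff ℝ (⊤ : ℕ∞) g ∧ HasCompactSupport g ∧
      iteratedDeriv i (fun t => χ t ^ (N + i + 1)) = fun t => χ t ^ N * g t := by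
  induction i generalizing N with
  | zero => exact ⟨χ, h, hc, by simp [pow_succ]⟩
  | succ i ih =>
    obtain ⟨g, hg, hgc, he⟩ := ih (N + 1)
    refine ⟨fun t => (N + 1) * deriv χ t * g t + χ t * deriv g t,
      ((contDiff_const.mul (contDiff_deriv h)).mul hg).add (h.mul (contDiff_deriv hg)),
      (hgc.mul_left).add (hc.mul_right), ?_⟩
    rw [iteratedDeriv_succ, show N + (i + 1) + 1 = N + 1 + i + 1 by ring, he]
    funext t
    have h1 := ((h.differentiable (by simp)) t).hasDerivAt
    have h2 := ((hg.differentiable (by simp)) t).hasDerivAt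
    have h3 := ((h1.pow (N + 1)).mul h2).deriv
    refine h3.trans ?_
    simp
    ring

lemma exists_iteratedDeriv_bump_pow_le (N : ℕ) : ∃ c : ℝ, 0 < c ∧ ∀ i, i ≤ 4 → ∀ t,
    |iteratedDeriv i (fun t => bump t ^ (N + 5)) t| ≤ c * bump t ^ N := by
  have h1 : ∀ i : ℕ, ∃ c : ℝ, 0 < c ∧ (i ≤ 4 → ∀ t,
      |iteratedDeriv i (fun t => bump t ^ (N + 5)) t| ≤ c * bump t ^ N) := by
    intro i
    by_cases hi : i ≤ 4
    · obtain ⟨g, hg, hgc, he⟩ := exists_iteratedDeriv_pow contDiff_bump hasCompactSupport_bump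
        i (N + (4 - i))
      obtain ⟨c, hc⟩ := hgc.exists_bound_of_continuous hg.continuous
      refine ⟨|c| + 1, by positivity, fun _ t => ?_⟩
      rw [show N + 5 = N + (4 - i) + i + 1 by omega, he, abs_mul,
        abs_of_nonneg (pow_nonneg (bump_nonneg t) _), mul_comm]
      refine mul_le_mul ?_ (pow_le_pow_of_le_one (bump_nonneg t) (bump_le_one t) (by omega))
        (pow_nonneg (bump_nonneg t) _) (by positivity)
      exact (hc t).trans ((le_abs_self c).trans (by linarith))
    · exact ⟨1, one_pos, fun h => absurd h hi⟩
  choose c hc hb using h1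
  refine ⟨∑ i ∈ Finset.range 5, c i, Finset.sum_pos (fun i _ => hc i) ⟨0, by simp⟩, fun i hi t =>
    (hb i hi t).trans ?_⟩
  refine mul_le_mul_of_nonneg_right ?_ (pow_nonneg (bump_nonneg t) _)
  exact Finset.single_le_sum (fun i _ => (hc i).le) (Finset.mem_range.2 (by omega))

lemma iteratedDeriv_smoothTransition_eq_zero {i : ℕ} (hi : 1 ≤ i) {t : ℝ}
    (ht : t ∉ Icc (0 : ℝ) 1) : iteratedDeriv i Real.smoothTransition t = 0 := by
  rw [mem_Icc, not_and_or, not_le, not_le] at ht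
  have hc : ∃ c : ℝ, Real.smoothTransition =ᶠ[𝓝 t] fun _ => c := by
    rcases ht with ht | ht
    · exact ⟨0, by filter_upwards [Iio_mem_nhds ht] with s hs using
        Real.smoothTransition.zero_of_nonpos hs.le⟩
    · exact ⟨1, by filter_upwards [Ioi_mem_nhds ht] with s hs using
        Real.smoothTransition.one_of_one_le hs.le⟩
  obtain ⟨c, hc⟩ := hc
  rw [hc.iteratedDeriv_eq, iteratedDeriv_const, if_neg (by omega)]

lemma exists_iteratedDeriv_smoothTransition_le : ∃ c : ℝ, 0 < c ∧ ∀ i, i ≤ 4 → ∀ t,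
    |iteratedDeriv i Real.smoothTransition t| ≤ c := by
  have h1 : ∀ i : ℕ, ∃ c : ℝ, 0 < c ∧ ∀ t, |iteratedDeriv i Real.smoothTransition t| ≤ c := by
    intro i
    rcases Nat.eq_zero_or_pos i with rfl | hi
    · refine ⟨1, one_pos, fun t => ?_⟩
      rw [iteratedDeriv_zero, abs_of_nonneg (Real.smoothTransition.nonneg t)]
      exact Real.smoothTransition.le_one t
    · have hs : HasCompactSupport (iteratedDeriv i Real.smoothTransition) :=
        HasCompactSupport.intro isCompact_Icc
          fun _ => iteratedDeriv_smoothTransition_eq_zero hi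
      obtain ⟨c, hc⟩ := hs.exists_bound_of_continuous
        ((Real.smoothTransition.contDiff (n := (⊤ : ℕ∞))).continuous_iteratedDeriv i
          (by exact_mod_cast le_top))
      exact ⟨|c| + 1, by positivity, fun t =>
        (hc t).trans ((le_abs_self c).trans (by linarith))⟩
  choose c hc hb using h1
  refine ⟨∑ i ∈ Finset.range 5, c i, Finset.sum_pos (fun i _ => hc i) ⟨0, by simp⟩, fun i hi t =>
    (hb i t).trans ?_⟩
  exact Finset.single_le_sum (fun i _ => (hc i).le) (Finset.mem_range.2 (by omega))

/-- A smooth function that is `1` on `[1 - S, S]` and `0` off `[-S, S + 1]`. -/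
def plateau (S t : ℝ) : ℝ := Real.smoothTransition (t + S) - Real.smoothTransition (t - S)

lemma contDiff_plateau (S : ℝ) : ContDiff ℝ (⊤ : ℕ∞) (plateau S) :=
  (Real.smoothTransition.contDiff.comp (contDiff_id.add contDiff_const)).sub
    (Real.smoothTransition.contDiff.comp (contDiff_id.sub contDiff_const))

lemma plateau_mem {S : ℝ} (hS : 0 ≤ S) (t : ℝ) : plateau S t ∈ Icc (0 : ℝ) 1 := by
  have h1 : Real.smoothTransition (t - S) ≤ Real.smoothTransition (t + S) :=
    Real.smoothTransition.monotone (by linarith)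
  have h2 := Real.smoothTransition.nonneg (t - S)
  have h3 := Real.smoothTransition.le_one (t + S)
  constructor <;> rw [plateau] <;> linarith

lemma plateau_eq_one {S t : ℝ} (h1 : 1 - S ≤ t) (h2 : t ≤ S) : plateau S t = 1 := by
  rw [plateau, Real.smoothTransition.one_of_one_le (by linarith),
    Real.smoothTransition.zero_of_nonpos (by linarith), sub_zero]

lemma plateau_eq_zero {S t : ℝ} (hS : 0 ≤ S) (h : t ≤ -S ∨ S + 1 ≤ t) : plateau S t = 0 := by
  rcases h with h | h
  · rw [plateau, Real.smoothTransition.zero_of_nonpos (by linarith),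
      Real.smoothTransition.zero_of_nonpos (by linarith), sub_zero]
  · rw [plateau, Real.smoothTransition.one_of_one_le (by linarith),
      Real.smoothTransition.one_of_one_le (by linarith), sub_self]

lemma plateau_mono {S S' : ℝ} (h : S ≤ S') (t : ℝ) : plateau S t ≤ plateau S' t :=
  sub_le_sub (Real.smoothTransition.monotone (by linarith))
    (Real.smoothTransition.monotone (by linarith))

lemma hasCompactSupport_plateau {S : ℝ} (hS : 0 ≤ S) : HasCompactSupport (plateau S) :=
  HasCompactSupport.intro (isCompact_Icc (a := -S) (b := S + 1)) fun t ht => by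
    rw [mem_Icc, not_and_or, not_le, not_le] at ht
    exact plateau_eq_zero hS (ht.imp le_of_lt le_of_lt)

lemma iteratedDeriv_plateau (S : ℝ) (i : ℕ) (t : ℝ) :
    iteratedDeriv i (plateau S) t = iteratedDeriv i Real.smoothTransition (t + S)
      - iteratedDeriv i Real.smoothTransition (t - S) := by
  have h1 : ContDiff ℝ i fun t => Real.smoothTransition (t + S) :=
    Real.smoothTransition.contDiff.comp (contDiff_id.add contDiff_const)
  have h2 : ContDiff ℝ i fun t => Real.smoothTransition (t - S) :=
    Real.smoothTransition.contDiff.comp (contDiff_id.sub contDiff_const)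
  have := iteratedDeriv_fun_sub h1.contDiffAt h2.contDiffAt (x := t)
  rw [iteratedDeriv_comp_add_const, iteratedDeriv_comp_sub_const] at this
  exact this

lemma abs_iteratedDeriv_mul_plateau_le :
    ∃ B : ℝ, 0 < B ∧ ∀ K : ℕ, ∀ S : ℝ, ∀ i j : ℕ, 1 ≤ i + j → i + j ≤ 4 →
    ∀ t, |iteratedDeriv i (plateau S) t * iteratedDeriv j (plateau S) t| ≤
      B * (bump (t + S) ^ K + bump (t - S) ^ K) := by
  obtain ⟨c, hc, hb⟩ := exists_iteratedDeriv_smoothTransition_le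
  have hz : ∀ K : ℕ, ∀ i, 1 ≤ i → i ≤ 4 → ∀ t,
      |iteratedDeriv i Real.smoothTransition t| ≤ c * bump t ^ K := by
    intro K i hi hi' t
    by_cases ht : t ∈ Icc (0 : ℝ) 1
    · rw [bump_eq_one ht, one_pow, mul_one]
      exact hb i hi' t
    · rw [iteratedDeriv_smoothTransition_eq_zero hi ht, abs_zero]
      exact mul_nonneg hc.le (pow_nonneg (bump_nonneg t) _)
  have h1 : ∀ K : ℕ, ∀ S : ℝ, ∀ i, 1 ≤ i → i ≤ 4 → ∀ t, |iteratedDeriv i (plateau S) t| ≤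
      c * (bump (t + S) ^ K + bump (t - S) ^ K) := by
    intro K S i hi hi' t
    rw [iteratedDeriv_plateau, mul_add]
    exact (abs_sub _ _).trans (add_le_add (hz K i hi hi' _) (hz K i hi hi' _))
  have h2 : ∀ S : ℝ, ∀ i ≤ 4, ∀ t, |iteratedDeriv i (plateau S) t| ≤ 2 * c := by
    intro S i hi t
    rw [iteratedDeriv_plateau, two_mul]
    exact (abs_sub _ _).trans (add_le_add (hb i hi _) (hb i hi _))
  refine ⟨2 * c * c, by positivity, fun K S i j h h' t => ?_⟩
  have hp : 0 ≤ bump (t + S) ^ K + bump (t - S) ^ K :=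
    add_nonneg (pow_nonneg (bump_nonneg _) _) (pow_nonneg (bump_nonneg _) _)
  rw [abs_mul]
  rcases Nat.eq_zero_or_pos i with hi | hi
  · have := mul_le_mul (h2 S i (by omega) t) (h1 K S j (by omega) (by omega) t) (abs_nonneg _)
      (by positivity)
    linarith
  · have := mul_le_mul (h1 K S i (by omega) (by omega) t) (h2 S j (by omega) t) (abs_nonneg _)
      (by positivity)
    linarith

lemma exists_young {p : ℝ} (hp : 1 < p) : ∃ k : ℕ, ∀ c : ℝ, 0 ≤ c → ∃ C : ℝ, 0 ≤ C ∧
    ∀ z s : ℝ, 0 ≤ z → z ≤ 1 → 0 ≤ s →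
      c * z ^ (2 * k + 2) * s ^ 2 ≤ 1 / 2 * (z ^ (2 * k + 22) * s ^ (p + 1)) + C * z := by
  obtain ⟨k, hk⟩ := exists_nat_ge (20 / (p - 1))
  have hp' : 0 < p - 1 := by linarith
  rw [div_le_iff₀ hp'] at hk
  refine ⟨k, fun c hc => ⟨c * ((2 * c) ^ (1 / (p - 1))) ^ 2, by positivity, ?_⟩⟩
  intro z s hz hz1 hs
  rcases hz.eq_or_lt with rfl | hz0
  · simp
  rcases hs.eq_or_lt with rfl | hs0
  · have : 0 ≤ z ^ (2 * k + 22) * (0 : ℝ) ^ (p + 1) := by positivity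
    have h2 : 0 ≤ c * ((2 * c) ^ (1 / (p - 1))) ^ 2 * z := by positivity
    simp only [ne_eq, OfNat.ofNat_ne_zero, not_false_eq_true, zero_pow, mul_zero]
    linarith
  have hsp : s ^ (p + 1) = s ^ 2 * s ^ (p - 1) := by
    rw [← Real.rpow_natCast s 2, ← Real.rpow_add hs0]; congr 1; push_cast; ring
  rcases le_or_gt (2 * c) (z ^ 20 * s ^ (p - 1)) with h | h
  · have h1 : 0 ≤ c * ((2 * c) ^ (1 / (p - 1))) ^ 2 * z := by positivity
    have h2 : c * z ^ (2 * k + 2) * s ^ 2 ≤ 1 / 2 * (z ^ (2 * k + 22) * s ^ (p + 1)) := by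
      rw [hsp, show z ^ (2 * k + 22) = z ^ (2 * k + 2) * z ^ 20 by rw [← pow_add]]
      have : 0 ≤ z ^ (2 * k + 2) * s ^ 2 := by positivity
      nlinarith [mul_le_mul_of_nonneg_left h this]
    linarith
  · have h1 : (z ^ k * s) ^ (p - 1) ≤ 2 * c := by
      refine le_trans ?_ h.le
      rw [Real.mul_rpow (by positivity) hs, ← Real.rpow_natCast z k, ← Real.rpow_mul hz,
        ← Real.rpow_natCast z 20]
      refine mul_le_mul_of_nonneg_right ?_ (by positivity)
      exact Real.rpow_le_rpow_of_exponent_ge hz0 hz1 (by exact_mod_cast hk)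
    have h2 : z ^ k * s ≤ (2 * c) ^ (1 / (p - 1)) := by
      have h3 := Real.rpow_le_rpow (by positivity) h1 (by positivity : 0 ≤ 1 / (p - 1))
      rwa [← Real.rpow_mul (by positivity), mul_one_div_cancel hp'.ne', Real.rpow_one] at h3
    have h3 : (z ^ k * s) ^ 2 ≤ ((2 * c) ^ (1 / (p - 1))) ^ 2 :=
      pow_le_pow_left₀ (by positivity) h2 2
    have h4 : z ^ 2 ≤ z := by nlinarith
    have h5 : 0 ≤ z ^ (2 * k + 22) * s ^ (p + 1) := by positivity
    calc c * z ^ (2 * k + 2) * s ^ 2 = c * (z ^ k * s) ^ 2 * z ^ 2 := by ring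
      _ ≤ c * ((2 * c) ^ (1 / (p - 1))) ^ 2 * z := by gcongr
      _ ≤ _ := by linarith

end

section

variable {n : ℕ}

lemma iterate_D_cut {χ : ℝ → ℝ} (h : ContDiff ℝ (⊤ : ℕ∞) χ) (i : ℕ)
    {x : EuclideanSpace ℝ (Fin n)} (hx : x ≠ 0) :
    ((D : Sm n → Sm n)^[i] (cut χ h)).1 x = iteratedDeriv i χ (Real.log ‖x‖) := by
  induction i generalizing χ with
  | zero => rw [iteratedDeriv_zero]; exact cut_apply h hx
  | succ i ih => rw [Function.iterate_succ_apply, D_cut, ih, iteratedDeriv_succ']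

lemma J_cut_shift {χ : ℝ → ℝ} (h : ContDiff ℝ (⊤ : ℕ∞) χ) (hc : HasCompactSupport χ) (T : ℝ)
    (hT : ContDiff ℝ (⊤ : ℕ∞) fun t => χ (t - T)) (hcT : HasCompactSupport fun t => χ (t - T)) :
    J (cut (fun t => χ (t - T)) hT : Sm n) = J (cut χ h : Sm n) := by
  rw [J_eq (cut_mem hT hcT), J_eq (cut_mem h hc), I, I]
  have h1 := Measure.integral_comp_smul (volume : Measure (EuclideanSpace ℝ (Fin n)))
    (rp (-(n : ℝ)) * cut χ h : Sm n).1 (Real.exp (-T))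
  have h2 : ∀ x : EuclideanSpace ℝ (Fin n), (rp (-(n : ℝ)) * cut χ h : Sm n).1 (Real.exp (-T) • x)
      = Real.exp (n * T) * (rp (-(n : ℝ)) * cut (fun t => χ (t - T)) hT : Sm n).1 x := by
    intro x
    rcases eq_or_ne x 0 with rfl | hx
    · simp
    have hx' : Real.exp (-T) • x ≠ 0 := smul_ne_zero (Real.exp_pos _).ne' hx
    have hn : ‖Real.exp (-T) • x‖ = Real.exp (-T) * ‖x‖ := by
      rw [norm_smul, Real.norm_eq_abs, abs_of_pos (Real.exp_pos _)]
    rw [coe_mul, coe_mul, rp_apply _ hx, rp_apply _ hx', cut_apply _ hx, cut_apply _ hx', hn,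
      Real.log_mul (Real.exp_pos _).ne' (norm_ne_zero_iff.2 hx), Real.log_exp,
      Real.mul_rpow (Real.exp_pos _).le (norm_nonneg _), ← Real.exp_mul]
    rw [show -T * -(n : ℝ) = n * T by ring, show -T + Real.log ‖x‖ = Real.log ‖x‖ - T by ring]
    ring
  simp only [h2] at h1
  rw [integral_const_mul, finrank_euclideanSpace_fin, ← Real.exp_nat_mul, ← Real.exp_neg,
    abs_of_pos (Real.exp_pos _), smul_eq_mul, show -((n : ℝ) * -T) = n * T by ring] at h1
  exact mul_left_cancel₀ (Real.exp_pos _).ne' h1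

lemma contDiff_window (K : ℕ) (T : ℝ) : ContDiff ℝ (⊤ : ℕ∞) fun t => bump (t - T) ^ K :=
  (contDiff_bump.comp (contDiff_id.sub contDiff_const)).pow K

/-- A power of the bump function, moved to the annulus `‖x‖ ≈ exp T`. -/
def window (n : ℕ) (K : ℕ) (T : ℝ) : Sm n := cut (fun t => bump (t - T) ^ K) (contDiff_window K T)

lemma window_apply (K : ℕ) (T : ℝ) {x : EuclideanSpace ℝ (Fin n)} (hx : x ≠ 0) :
    (window n K T).1 x = bump (Real.log ‖x‖ - T) ^ K := cut_apply _ hx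

lemma hasCompactSupport_window {K : ℕ} (hK : K ≠ 0) (T : ℝ) :
    HasCompactSupport fun t => bump (t - T) ^ K :=
  HasCompactSupport.intro (isCompact_Icc (a := T - 1) (b := T + 2)) fun t ht => by
    rw [bump_eq_zero, zero_pow hK]
    intro h
    exact ht ⟨by linarith [h.1], by linarith [h.2]⟩

lemma window_mem {K : ℕ} (hK : K ≠ 0) (T : ℝ) : window n K T ∈ Tst n :=
  cut_mem _ (hasCompactSupport_window hK T)

lemma iterate_D_window (K : ℕ) (T : ℝ) (i : ℕ) {x : EuclideanSpace ℝ (Fin n)} (hx : x ≠ 0) :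
    ((D : Sm n → Sm n)^[i] (window n K T)).1 x =
      iteratedDeriv i (fun t => bump t ^ K) (Real.log ‖x‖ - T) := by
  rw [window, iterate_D_cut _ _ hx, iteratedDeriv_comp_sub_const i (fun t => bump t ^ K) T]

/-- The radial cutoff to the annulus `exp (-S) ≤ ‖x‖ ≤ exp (S + 1)`. -/
def plateauCut (n : ℕ) (S : ℝ) : Sm n := cut (plateau S) (contDiff_plateau S)

lemma plateauCut_mem {S : ℝ} (hS : 0 ≤ S) : plateauCut n S ∈ Tst n :=
  cut_mem _ (hasCompactSupport_plateau hS)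

lemma plateauCut_apply (S : ℝ) {x : EuclideanSpace ℝ (Fin n)} (hx : x ≠ 0) :
    (plateauCut n S).1 x = plateau S (Real.log ‖x‖) := cut_apply _ hx

variable {v P : Sm n} {p k₃ k₂ k₁ k₀ l κ : ℝ}

lemma sq_add_density_le (v P : Sm n) (x : EuclideanSpace ℝ (Fin n)) :
    v.1 x ^ 2 + (v * P).1 x ≤ (energyDensity v P).1 x := by
  simp only [energyDensity, coe_add, coe_mul]
  nlinarith [sq_nonneg ((D v).1 x), sq_nonneg ((D (D v)).1 x), sq_nonneg ((A v).1 x)]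

lemma StableProfile.energyDensity_nonneg (h : StableProfile v P p k₃ k₂ k₁ k₀ l κ)
    {x : EuclideanSpace ℝ (Fin n)} (hx : x ≠ 0) : 0 ≤ (energyDensity v P).1 x :=
  (add_nonneg (sq_nonneg _) (h.density_nonneg hx)).trans (sq_add_density_le v P x)

/-- The energy of a profile on a dyadic annulus is bounded. -/
lemma StableProfile.exists_window_le (h : StableProfile v P p k₃ k₂ k₁ k₀ l κ) :
    ∃ K : ℕ, K ≠ 0 ∧ ∃ M : ℝ, ∀ T, J (window n K T * energyDensity v P) ≤ M := by
  obtain ⟨k, hk⟩ := exists_young h.one_lt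
  obtain ⟨c₀, hc₀, hb₀⟩ := exists_iteratedDeriv_bump_pow_le (k + 6)
  obtain ⟨c₂, hc₂, hb₂⟩ := exists_iteratedDeriv_bump_pow_le (2 * k + 7)
  obtain ⟨C, hC, hw⟩ := h.exists_le_of_weights
  set c₁ := c₀ ^ 2 + c₀ ^ 4 + c₀ ^ 2 * c₂ with hc₁
  have hc₁' : 0 < c₁ := by positivity
  obtain ⟨C', hC', hy⟩ := hk (C * c₁) (by positivity)
  refine ⟨(k + 6 + 5) + (k + 6 + 5), by omega, 2 * C' * J (window n 1 0), fun T => ?_⟩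
  have hp0 : ∀ x : EuclideanSpace ℝ (Fin n), 0 ≤ bump (Real.log ‖x‖ - T) := fun x => bump_nonneg _
  have hp1 : ∀ x : EuclideanSpace ℝ (Fin n), bump (Real.log ‖x‖ - T) ≤ 1 := fun x => bump_le_one _
  have hsq : window n (k + 6 + 5) T * window n (k + 6 + 5) T * energyDensity v P =
      window n (k + 6 + 5 + (k + 6 + 5)) T * energyDensity v P := by
    congr 1
    refine Sm.ext' fun x => ?_
    rcases eq_or_ne x 0 with rfl | hx
    · simp [window]
    · rw [coe_mul, window_apply _ _ hx, window_apply _ _ hx, pow_add _ (k + 6 + 5)]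
  have hmain := hw (window n (k + 6 + 5) T) (window_mem (by omega) T) (rad_cut _)
    (c₀ ^ 2 • window n (2 * k + 7 + 5) T) (Tst.smul (window_mem (by omega) T) _)
    (c₁ • window n (2 * k + 2) T) (Tst.smul (window_mem (by omega) T) _)
    (by
      intro i j hij x hx
      rw [coe_mul, iterate_D_window _ _ _ hx, iterate_D_window _ _ _ hx, coe_smul,
        window_apply _ _ hx, abs_mul]
      refine (mul_le_mul (hb₀ i (by omega) _) (hb₀ j (by omega) _) (abs_nonneg _)
        (mul_nonneg hc₀.le (pow_nonneg (hp0 x) _))).trans (le_of_eq ?_)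
      ring)
    (by
      intro x hx
      rw [coe_mul, coe_smul, coe_smul, window_apply _ _ hx, window_apply _ _ hx,
        window_apply _ _ hx]
      have h1 : c₀ ^ 4 ≤ c₁ := by
        rw [hc₁]
        nlinarith [sq_nonneg c₀, mul_nonneg (sq_nonneg c₀) hc₂.le]
      have h2 := mul_le_mul_of_nonneg_right h1 (pow_nonneg (hp0 x) (4 * k + 24))
      refine le_trans (le_of_eq ?_) (h2.trans (le_of_eq ?_)) <;> ring)
    (by
      intro x hx
      rw [coe_smul, coe_smul, window_apply _ _ hx, window_apply _ _ hx]
      have h1 : c₀ ^ 2 ≤ c₁ := by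
        rw [hc₁]
        nlinarith [sq_nonneg (c₀ ^ 2), mul_nonneg (sq_nonneg c₀) hc₂.le]
      exact mul_le_mul h1 (pow_le_pow_of_le_one (hp0 x) (hp1 x) (by omega))
        (pow_nonneg (hp0 x) _) hc₁'.le)
    (by
      intro x hx
      have h0 := iterate_D_window (n := n) (2 * k + 7 + 5) T 2 hx
      simp only [Function.iterate_succ_apply, Function.iterate_zero_apply] at h0
      rw [Derivation.map_smul, Derivation.map_smul, coe_smul, coe_smul, window_apply _ _ hx, h0,
        abs_mul, abs_of_nonneg (sq_nonneg c₀)]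
      have h1 : c₀ ^ 2 * c₂ ≤ c₁ := by
        rw [hc₁]
        nlinarith [sq_nonneg (c₀ ^ 2), sq_nonneg c₀]
      have h2 := hb₂ 2 (by norm_num) (Real.log ‖x‖ - T)
      have h3 : bump (Real.log ‖x‖ - T) ^ (2 * k + 7) ≤ bump (Real.log ‖x‖ - T) ^ (2 * k + 2) :=
        pow_le_pow_of_le_one (hp0 x) (hp1 x) (by omega)
      calc _ ≤ c₀ ^ 2 * (c₂ * bump (Real.log ‖x‖ - T) ^ (2 * k + 7)) :=
            mul_le_mul_of_nonneg_left h2 (sq_nonneg c₀)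
        _ = c₀ ^ 2 * c₂ * bump (Real.log ‖x‖ - T) ^ (2 * k + 7) := by ring
        _ ≤ _ := mul_le_mul h1 h3 (pow_nonneg (hp0 x) _) hc₁'.le)
  rw [hsq] at hmain
  have hyoung : J (C • (c₁ • window n (2 * k + 2) T * (v * v))) ≤
      J ((1 / 2 : ℝ) • (window n (k + 6 + 5 + (k + 6 + 5)) T * energyDensity v P)
        + C' • window n 1 T) := by
    refine J_mono (Tst.smul (Tst.mul_right (Tst.smul (window_mem (by omega) T) _) _) _)
      (add_mem (Tst.smul (Tst.mul_right (window_mem (by omega) T) _) _)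
        (Tst.smul (window_mem one_ne_zero T) _)) fun x hx => ?_
    simp only [coe_add, coe_smul, coe_mul, window_apply _ _ hx]
    have h1 := hy (bump (Real.log ‖x‖ - T)) |v.1 x| (hp0 x) (hp1 x) (abs_nonneg _)
    have h2 : |v.1 x| ^ (p + 1) ≤ (energyDensity v P).1 x := by
      rw [← h.density x hx]
      linarith [sq_add_density_le v P x, sq_nonneg (v.1 x)]
    have h3 := mul_le_mul_of_nonneg_left h2 (pow_nonneg (hp0 x) (2 * k + 22))
    rw [sq_abs] at h1
    rw [show k + 6 + 5 + (k + 6 + 5) = 2 * k + 22 by ring]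
    nlinarith [h1, h3]
  rw [map_smul, map_add, map_smul, map_smul, smul_eq_mul, smul_eq_mul, smul_eq_mul] at hyoung
  have hshift : J (window n 1 T) = J (window n 1 0) := by
    have e : ∀ T', J (window n 1 T') = J (cut bump contDiff_bump : Sm n) := by
      intro T'
      rw [← J_cut_shift contDiff_bump hasCompactSupport_bump T'
        (contDiff_bump.comp (contDiff_id.sub contDiff_const))
        (by simpa using hasCompactSupport_window one_ne_zero T')]
      simp [window]
    rw [e, e]
  rw [hshift] at hyoung
  linarith

/-- A bounded sequence that is dominated by its forward differences vanishes. -/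
lemma eq_zero_of_le_sub {a : ℕ → ℝ} {C M : ℝ} (hC : 0 ≤ C) (h0 : ∀ N, 0 ≤ a N)
    (hM : ∀ N, a N ≤ M) (h : ∀ N, a N ≤ C * (a (N + 3) - a N)) (N : ℕ) : a N = 0 := by
  have hbdd : BddAbove (range a) := ⟨M, by rintro _ ⟨N, rfl⟩; exact hM N⟩
  have h1 : ∀ N, a N ≤ C / (1 + C) * ⨆ N, a N := fun N => by
    have h2 := le_ciSup hbdd (N + 3)
    rw [div_mul_eq_mul_div, le_div_iff₀ (by positivity)]
    nlinarith [h N, mul_le_mul_of_nonneg_left h2 hC]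
  have h2 : (⨆ N, a N) ≤ C / (1 + C) * ⨆ N, a N := ciSup_le h1
  have h3 : (⨆ N, a N) ≤ 0 := by
    rw [div_mul_eq_mul_div, le_div_iff₀ (by positivity)] at h2
    linarith
  exact le_antisymm ((le_ciSup hbdd N).trans h3) (h0 N)

lemma window_add_window_le {K : ℕ} (hK : K ≠ 0) {S : ℝ} (hS : 3 ≤ S) (t : ℝ) :
    bump (t + S) ^ K + bump (t - S) ^ K ≤
      plateau (S + 6) t * plateau (S + 6) t - plateau (S - 3) t * plateau (S - 3) t := by
  have hb := fun s => bump_nonneg s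
  have hle : plateau (S - 3) t * plateau (S - 3) t ≤ plateau (S + 6) t * plateau (S + 6) t :=
    mul_self_le_mul_self (plateau_mem (by linarith) t).1 (plateau_mono (by linarith) t)
  have h1 : ∀ s, bump s ^ K ≤ 1 := fun s => pow_le_one₀ (hb s) (bump_le_one s)
  by_cases ha : t + S ∈ Icc (-1 : ℝ) 2
  · rw [bump_eq_zero (t := t - S) (fun h => by linarith [ha.2, h.1]), zero_pow hK,
      plateau_eq_one (by linarith [ha.1]) (by linarith [ha.2]),
      plateau_eq_zero (by linarith) (Or.inl (by linarith [ha.2]))]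
    linarith [h1 (t + S)]
  · rw [bump_eq_zero ha, zero_pow hK]
    by_cases hb : t - S ∈ Icc (-1 : ℝ) 2
    · rw [plateau_eq_one (by linarith [hb.1]) (by linarith [hb.2]),
        plateau_eq_zero (by linarith) (Or.inr (by linarith [hb.1]))]
      linarith [h1 (t - S)]
    · rw [bump_eq_zero hb, zero_pow hK]
      linarith

lemma StableProfile.energy_eq_zero (h : StableProfile v P p k₃ k₂ k₁ k₀ l κ) (N : ℕ) :
    J (plateauCut n (3 * N) * plateauCut n (3 * N) * energyDensity v P) = 0 := by
  obtain ⟨K, hK, M, hM⟩ := h.exists_window_le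
  obtain ⟨C, hC, ht⟩ := h.exists_le_of_transition
  obtain ⟨B, hB, hpl⟩ := abs_iteratedDeriv_mul_plateau_le
  have hmem : ∀ S : ℝ, 0 ≤ S → plateauCut n S * plateauCut n S * energyDensity v P ∈ Tst n :=
    fun S hS => Tst.mul_right (Tst.mul_right (plateauCut_mem hS) _) _
  have hstep : ∀ S : ℝ, 0 ≤ S → J (plateauCut n S * plateauCut n S * energyDensity v P) ≤
      C * B * (J (window n K (-S) * energyDensity v P) + J (window n K S * energyDensity v P)) := by
    intro S hS
    have h1 := ht (plateauCut n S) (plateauCut_mem hS) (rad_cut _)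
      (B • (window n K (-S) + window n K S))
      (Tst.smul (add_mem (window_mem hK _) (window_mem hK _)) _) (by
        intro i j h1 h4 x hx
        rw [coe_mul, plateauCut, iterate_D_cut _ _ hx, iterate_D_cut _ _ hx, coe_smul, coe_add,
          window_apply _ _ hx, window_apply _ _ hx, sub_neg_eq_add]
        exact hpl K S i j h1 h4 _)
    rwa [smul_mul_assoc, add_mul, map_smul, map_add, smul_eq_mul, ← mul_assoc] at h1
  have hnn : ∀ S : ℝ, 0 ≤ S → 0 ≤ J (plateauCut n S * plateauCut n S * energyDensity v P) :=
    fun S hS => J_nonneg (hmem S hS) fun x hx => by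
      rw [coe_mul, coe_mul]
      exact mul_nonneg (mul_self_nonneg _) (h.energyDensity_nonneg hx)
  have hCB : 0 < C * B := mul_pos hC hB
  refine eq_zero_of_le_sub (a := fun N : ℕ =>
      J (plateauCut n (3 * N) * plateauCut n (3 * N) * energyDensity v P)) (C := C * B)
      (M := C * B * (M + M)) hCB.le (fun N => hnn _ (by positivity)) (fun N => ?_) (fun N => ?_) N
  · refine (hstep _ (by positivity)).trans ?_
    exact mul_le_mul_of_nonneg_left (add_le_add (hM _) (hM _)) hCB.le
  · have hmono : J (plateauCut n (3 * N) * plateauCut n (3 * N) * energyDensity v P) ≤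
        J (plateauCut n (3 * N + 3) * plateauCut n (3 * N + 3) * energyDensity v P) := by
      refine J_mono (hmem _ (by positivity)) (hmem _ (by positivity)) fun x hx => ?_
      simp only [coe_mul, plateauCut_apply _ hx]
      exact mul_le_mul_of_nonneg_right (mul_self_le_mul_self (plateau_mem (by positivity) _).1
        (plateau_mono (by linarith) _)) (h.energyDensity_nonneg hx)
    refine hmono.trans ((hstep _ (by positivity)).trans (mul_le_mul_of_nonneg_left ?_ hCB.le))
    rw [← map_add, ← map_sub]
    refine J_mono (add_mem (Tst.mul_right (window_mem hK _) _) (Tst.mul_right (window_mem hK _) _))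
      (sub_mem (hmem _ (by positivity)) (hmem _ (by positivity))) fun x hx => ?_
    simp only [coe_add, coe_sub, coe_mul, plateauCut_apply _ hx, window_apply _ _ hx]
    have h1 := mul_le_mul_of_nonneg_right (window_add_window_le hK (S := 3 * N + 3)
      (by linarith [(Nat.cast_nonneg N : (0 : ℝ) ≤ N)]) (Real.log ‖x‖)) (h.energyDensity_nonneg hx)
    have e1 : (3 : ℝ) * N + 3 + 6 = 3 * ((N + 3 : ℕ) : ℝ) := by push_cast; ring
    have e2 : (3 : ℝ) * N + 3 - 3 = 3 * N := by ring
    rw [e1, e2] at h1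
    rw [sub_neg_eq_add]
    linarith

/-- A stable profile vanishes away from the origin. -/
lemma StableProfile.eq_zero (h : StableProfile v P p k₃ k₂ k₁ k₀ l κ)
    {x : EuclideanSpace ℝ (Fin n)} (hx : x ≠ 0) : v.1 x = 0 := by
  by_contra hv
  obtain ⟨N, hN⟩ := exists_nat_ge (1 + |Real.log ‖x‖|)
  have hS : (0 : ℝ) ≤ 3 * N := by positivity
  set f : Sm n := plateauCut n (3 * N) * plateauCut n (3 * N) * energyDensity v P with hf
  have hfm : f ∈ Tst n := Tst.mul_right (Tst.mul_right (plateauCut_mem hS) _) _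
  have h0 : (rp (-(n : ℝ)) * f).1 0 = 0 := by simp
  have hg := Tst.mul_left hfm (rp (-(n : ℝ)))
  have hpos : 0 < ∫ y, (rp (-(n : ℝ)) * f).1 y := by
    refine Continuous.integral_pos_of_hasCompactSupport_nonneg_nonzero
      (Tst.contDiff hg h0).continuous (Tst.hasCompactSupport hg h0) (fun y => ?_) (x := x) ?_
    · rcases eq_or_ne y 0 with rfl | hy
      · rw [h0]; rfl
      · rw [hf, coe_mul, coe_mul, coe_mul]
        exact mul_nonneg (rp_nonneg _ _) (mul_nonneg (mul_self_nonneg _) (h.energyDensity_nonneg hy))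
    · rw [hf, coe_mul, coe_mul, coe_mul, rp_apply _ hx, plateauCut_apply _ hx, plateau_eq_one]
      · have h1 := sq_add_density_le v P x
        have h2 := h.density_nonneg hx
        have h3 : 0 < ‖x‖ ^ (-(n : ℝ)) := Real.rpow_pos_of_pos (norm_pos_iff.2 hx) _
        have h4 : 0 < (energyDensity v P).1 x := by
          have : 0 < v.1 x ^ 2 := by positivity
          linarith
        rw [one_mul, one_mul]
        exact (mul_pos h3 h4).ne'
      · linarith [neg_abs_le (Real.log ‖x‖)]
      · linarith [le_abs_self (Real.log ‖x‖), abs_nonneg (Real.log ‖x‖)]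
  have := h.energy_eq_zero N
  rw [← hf, J_eq hfm, I] at this
  linarith

end

section

variable {n : ℕ}

lemma lap_congr {f g : EuclideanSpace ℝ (Fin n) → ℝ} {x : EuclideanSpace ℝ (Fin n)}
    (h : f =ᶠ[𝓝 x] g) : lap n f x = lap n g x := by
  simp only [lap]
  rw [(h.iteratedFDeriv ℝ 2).eq_of_nhds]

lemma lap_const (c : ℝ) (x : EuclideanSpace ℝ (Fin n)) : lap n (fun _ => c) x = 0 := by
  simp [lap, iteratedFDeriv_const_of_ne]

/-- The Laplacian of a function that agrees with `‖x‖ ^ (-s) * f x` away from the origin. -/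
lemma lap_eq_of_eq {u : EuclideanSpace ℝ (Fin n) → ℝ} {s : ℝ} {f : Sm n}
    (h : ∀ x, x ≠ 0 → u x = (rp (-s) * f).1 x) {x : EuclideanSpace ℝ (Fin n)} (hx : x ≠ 0) :
    lap n u x = (rp (-(s + 2)) * Mop s f).1 x := by
  have h1 : u =ᶠ[𝓝 x] (rp (-s) * f : Sm n).1 := by
    filter_upwards [isOpen_ne.mem_nhds hx] with y hy using h y hy
  have h2 := Lr_apply (rp (-s) * f) hx
  have hx' : 0 < ‖x‖ := norm_pos_iff.2 hx
  rw [Lr_rp_mul, coe_mul, rp_apply _ hx] at h2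
  rw [lap_congr h1, coe_mul, rp_apply _ hx, neg_add, Real.rpow_add hx', Real.rpow_neg hx'.le 2,
    Real.rpow_two]
  field_simp
  linarith

lemma lap_zero_of_mem {f : Sm n} (hf : f ∈ Tst n) (h0 : f.1 0 = 0) : lap n f.1 0 = 0 := by
  obtain ⟨ε, hε, R, hR⟩ := hf
  have h : f.1 =ᶠ[𝓝 0] fun _ => 0 := by
    filter_upwards [ball_mem_nhds (0 : EuclideanSpace ℝ (Fin n)) hε] with x hx
    by_contra hne
    rcases eq_or_ne x 0 with rfl | hx0
    · exact hne h0
    · rw [mem_ball_zero_iff] at hx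
      linarith [(hR x hx0 hne).1]
  rw [lap_congr h, lap_const]

lemma A_sub (f g : Sm n) : A (f - g) = A f - A g := by
  rw [sub_eq_add_neg, sub_eq_add_neg, A_add, ← neg_one_smul ℝ g, A_smul, neg_one_smul]

lemma Mop_Mop (s t : ℝ) (f : Sm n) : Mop s (Mop t f) =
    D (D (D (D f))) + (2 * (n : ℝ) - 4 - 2 * s - 2 * t) • D (D (D f))
      + (((n : ℝ) - 2 - 2 * s) * ((n : ℝ) - 2 - 2 * t) - s * ((n : ℝ) - 2 - s)
        - t * ((n : ℝ) - 2 - t)) • D (D f)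
      + (-(((n : ℝ) - 2 - 2 * s) * (t * ((n : ℝ) - 2 - t))
        + ((n : ℝ) - 2 - 2 * t) * (s * ((n : ℝ) - 2 - s)))) • D f
      + (s * ((n : ℝ) - 2 - s) * (t * ((n : ℝ) - 2 - t))) • f
      + (2 : ℝ) • A (D (D f)) + (2 * (n : ℝ) - 4 - 2 * s - 2 * t) • A (D f)
      + (-(s * ((n : ℝ) - 2 - s) + t * ((n : ℝ) - 2 - t))) • A f + A (A f) := by
  simp only [Mop, A_add, A_sub, A_smul, Derivation.map_add, Derivation.map_sub,
    Derivation.map_smul, D_A, smul_add, smul_sub, smul_smul]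
  module

lemma D_eq_of_abs_rpow {v P : Sm n} {p : ℝ} (hp : 0 < p)
    (h : ∀ x, x ≠ 0 → P.1 x = |v.1 x| ^ (p - 1) * v.1 x)
    (hd : ∀ x, x ≠ 0 → (v * P).1 x = |v.1 x| ^ (p + 1)) :
    D (v * P) = (p + 1) • (D v * P) := Sm.ext' fun x => by
  rcases eq_or_ne x 0 with rfl | hx
  · rw [coe_smul, coe_mul, D, vf_zero, vf_zero, zero_mul, mul_zero]
  have he : (v * P).1 =ᶠ[𝓝 x] fun y => |v.1 y| ^ (p + 1) := by
    filter_upwards [isOpen_ne.mem_nhds hx] with y hy using hd y hy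
  have h1 := (hasDerivAt_abs_rpow (v.1 x) (by linarith : 1 < p + 1)).comp_hasFDerivAt x
    (v.differentiableAt hx).hasFDerivAt
  rw [coe_smul, coe_mul, h x hx, D, vf_apply, vf_apply, he.fderiv_eq]
  have h2 : fderiv ℝ (fun y => |v.1 y| ^ (p + 1)) x = _ := h1.fderiv
  rw [h2, show p + 1 - 2 = p - 1 by ring]
  simp
  ring

variable {a p : ℝ} {u : EuclideanSpace ℝ (Fin n) → ℝ}

/-- The Emden–Fowler profile of a smooth stable solution. -/
lemma exists_stableProfile (hn : 5 ≤ n) (ha : 0 ≤ a)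
    (hpc : ((n : ℝ) + 4 + 2 * a) / ((n : ℝ) - 4) < p)
    (hl1 : p * ell1 n a p > (n : ℝ) * ((n : ℝ) - 4) / 2)
    (hl2 : p * ell2 n a p > (n : ℝ) ^ 2 * ((n : ℝ) - 4) ^ 2 / 16)
    (hu : ContDiff ℝ (⊤ : ℕ∞) u) (hsol : IsSolutionOn n a p u Set.univ)
    (hstab : StableOn n a p u Set.univ) :
    ∃ (v P : Sm n) (k₃ k₂ k₁ k₀ l κ s : ℝ), StableProfile v P p k₃ k₂ k₁ k₀ l κ ∧
      ∀ x, x ≠ 0 → u x = (rp s * v).1 x := by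
  have hn' : (5 : ℝ) ≤ n := by exact_mod_cast hn
  have hn4 : 0 < (n : ℝ) - 4 := by linarith
  rw [div_lt_iff₀ hn4] at hpc
  have hp : 1 < p := by
    by_contra hp
    nlinarith
  have hp1 : 0 < p - 1 := by linarith
  set β := (4 + a) / (p - 1) with hβ
  have hβp : β * (p - 1) = 4 + a := div_mul_cancel₀ _ hp1.ne'
  have hβ0 : 0 < β := by positivity
  have hm : 2 * β < n - 4 := by
    by_contra hm
    nlinarith
  have e1 : ell1 n a p = (β + 2) * ((n : ℝ) - 4 - β) + β * ((n : ℝ) - 2 - β) := rfl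
  have e2 : ell2 n a p = β * (β + 2) * ((n : ℝ) - 4 - β) * ((n : ℝ) - 2 - β) := rfl
  set U : Sm n := ⟨u, fun x _ => hu.contDiffAt⟩ with hU
  set v : Sm n := rp β * U with hv
  have hu0 : ∀ x, x ≠ 0 → u x = (rp (-β) * v).1 x := fun x hx => by
    rw [hv, ← mul_assoc, rp_mul, coe_mul, rp_apply _ hx, neg_add_cancel, Real.rpow_zero, one_mul]
  have hv0 : ∀ x, x ≠ 0 → v.1 x = ‖x‖ ^ β * u x := fun x hx => by
    rw [hv, coe_mul, rp_apply _ hx]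
  clear_value v
  set P := Mop (β + 2) (Mop β v) with hP
  have hP0 : ∀ x, x ≠ 0 → P.1 x = ‖x‖ ^ (β + 4) * (‖x‖ ^ a * |u x| ^ (p - 1) * u x) := by
    intro x hx
    have h1 := lap_eq_of_eq (fun y hy => lap_eq_of_eq hu0 hy) hx
    rw [hsol x (mem_univ x), coe_mul, rp_apply _ hx, ← hP] at h1
    have hx' : 0 < ‖x‖ := norm_pos_iff.2 hx
    rw [h1, ← mul_assoc, ← Real.rpow_add hx', show β + 4 + -(β + 2 + 2) = 0 by ring,
      Real.rpow_zero, one_mul]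
  have hPv : ∀ x, x ≠ 0 → P.1 x = |v.1 x| ^ (p - 1) * v.1 x := by
    intro x hx
    have hx' : 0 < ‖x‖ := norm_pos_iff.2 hx
    rw [hP0 x hx, hv0 x hx, abs_mul, abs_of_pos (Real.rpow_pos_of_pos hx' _),
      Real.mul_rpow (Real.rpow_pos_of_pos hx' _).le (abs_nonneg _), ← Real.rpow_mul hx'.le, hβp,
      show β + 4 = β + (4 + a) - a by ring, Real.rpow_sub hx', Real.rpow_add hx']
    have : ‖x‖ ^ a ≠ 0 := (Real.rpow_pos_of_pos hx' _).ne'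
    field_simp
  have hd : ∀ x, x ≠ 0 → (v * P).1 x = |v.1 x| ^ (p + 1) := by
    intro x hx
    rw [coe_mul, hPv x hx]
    rcases eq_or_ne (v.1 x) 0 with h0 | h0
    · rw [h0, zero_mul, abs_zero, Real.zero_rpow (by linarith)]
    · rw [show p + 1 = p - 1 + 2 by ring, Real.rpow_add (abs_pos.2 h0), Real.rpow_two, sq_abs]
      ring
  refine ⟨v, P, _, _, _, _, _, n * ((n : ℝ) - 4) / 4, -β,
    ⟨Mop_Mop (β + 2) β v, hd, D_eq_of_abs_rpow (by linarith) hPv hd, ?_, hp, ?_, ?_, ?_, ?_⟩, hu0⟩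
  · intro η hη hr
    set h := ((n : ℝ) - 4) / 2 with hh
    set f := η * v with hf
    set M := D (D f) + (2 : ℝ) • D f - ((n : ℝ) * ((n : ℝ) - 4) / 4) • f + A f with hM
    have hMop : Mop h f = M := by
      rw [Mop, hM, show (n : ℝ) - 2 - 2 * h = 2 by rw [hh]; ring,
        show h * ((n : ℝ) - 2 - h) = n * ((n : ℝ) - 4) / 4 by rw [hh]; ring]
    have hfm : f ∈ Tst n := Tst.mul_right hη v
    have hMm : M ∈ Tst n := add_mem (sub_mem (add_mem (Tst.D (Tst.D hfm)) (Tst.smul (Tst.D hfm) _))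
      (Tst.smul hfm _)) (Tst.A hfm)
    set ψ := rp (-h) * f with hψ
    have hψm : ψ ∈ Tst n := Tst.mul_left hfm _
    have hψ0 : ψ.1 0 = 0 := by rw [hψ, coe_mul, rp_zero, zero_mul]
    have key := hstab ψ.1 (Tst.contDiff hψm hψ0) (Tst.hasCompactSupport hψm hψ0) (subset_univ _)
    have hden : ∀ x, (rp (-(n : ℝ)) * (η * η * (v * P))).1 x =
        ‖x‖ ^ a * |u x| ^ (p - 1) * ψ.1 x ^ 2 := by
      intro x
      rcases eq_or_ne x 0 with rfl | hx
      · rw [hψ0, coe_mul, rp_zero]; simp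
      have hx' : 0 < ‖x‖ := norm_pos_iff.2 hx
      rw [coe_mul, coe_mul, coe_mul η η, coe_mul v P, hP0 x hx, hψ, coe_mul, hf, coe_mul, hv0 x hx,
        rp_apply _ hx, rp_apply _ hx, show -(n : ℝ) = -h + -h - 4 by rw [hh]; ring,
        Real.rpow_sub hx', Real.rpow_add hx', Real.rpow_add hx']
      have : ‖x‖ ^ (4 : ℝ) ≠ 0 := (Real.rpow_pos_of_pos hx' _).ne'
      field_simp
    have hlap : ∀ x, (rp (-(n : ℝ)) * (M * M)).1 x = lap n ψ.1 x ^ 2 := by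
      intro x
      rcases eq_or_ne x 0 with rfl | hx
      · rw [lap_zero_of_mem hψm hψ0, coe_mul, rp_zero]; simp
      have hx' : 0 < ‖x‖ := norm_pos_iff.2 hx
      rw [lap_eq_of_eq (fun y _ => rfl) hx, hMop, coe_mul, coe_mul, coe_mul, rp_apply _ hx,
        rp_apply _ hx, show -(n : ℝ) = -(h + 2) + -(h + 2) by rw [hh]; ring, Real.rpow_add hx']
      ring
    rw [J_eq (Tst.mul_right (Tst.mul_right hη _) _), J_eq (Tst.mul_right hMm _), I, I]
    simpa only [hden, hlap] using key
  · linarith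
  · have hpos : 0 < p * ell1 n a p := by
      refine lt_trans ?_ hl1
      positivity
    have h1 : 0 < ell1 n a p := pos_of_mul_pos_right hpos (by linarith)
    have h2 : 0 < ((n : ℝ) - 4 - 2 * β) * (ell1 n a p + 4) := mul_pos (by linarith) (by linarith)
    rw [e1] at h2
    nlinarith
  · rw [e1] at hl1
    refine lt_of_eq_of_lt ?_ (hl1.trans_eq ?_) <;> ring
  · rw [e2] at hl2
    refine lt_of_eq_of_lt ?_ (hl2.trans_eq ?_) <;> ring

/-- Smooth stable solutions vanish identically. -/
theorem eq_zero_of_stableOn (hn : 5 ≤ n) (ha : 0 ≤ a)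
    (hpc : ((n : ℝ) + 4 + 2 * a) / ((n : ℝ) - 4) < p)
    (hl1 : p * ell1 n a p > (n : ℝ) * ((n : ℝ) - 4) / 2)
    (hl2 : p * ell2 n a p > (n : ℝ) ^ 2 * ((n : ℝ) - 4) ^ 2 / 16)
    (hu : ContDiff ℝ (⊤ : ℕ∞) u) (hsol : IsSolutionOn n a p u Set.univ)
    (hstab : StableOn n a p u Set.univ) : u = fun _ => 0 := by
  obtain ⟨v, P, k₃, k₂, k₁, k₀, l, κ, s, hv, hs⟩ :=
    exists_stableProfile hn ha hpc hl1 hl2 hu hsol hstab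
  have : Nonempty (Fin n) := ⟨⟨0, by omega⟩⟩
  refine hu.continuous.ext_on (dense_compl_singleton 0) continuous_const fun x hx => ?_
  rw [hs x hx, coe_mul, hv.eq_zero hx, mul_zero]

end

end PuncturedSpace

end

lemma energyE_zero (n : ℕ) (a p : ℝ) (hp : p + 1 ≠ 0) (x : EuclideanSpace ℝ (Fin n)) (r : ℝ) :
    energyE n a p (fun _ => 0) x r = 0 := by
  simp [energyE, sphInt, radDeriv, PuncturedSpace.lap_const, Real.zero_rpow hp]

/-- Lemma 4.1: for a smooth stable solution in the supercritical
range `(n+4+2a)/(n-4) < p < p_a(n)`, the (non-decreasing) energy `E(r;0,u)` stays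
bounded: `sup_{r>0} E(r;0,u) < ∞`. -/
theorem stmt14 (n : ℕ) (hn : 5 ≤ n) (a p : ℝ) (ha : 0 ≤ a)
    (hpc : ((n : ℝ) + 4 + 2 * a) / ((n : ℝ) - 4) < p)
    (hl1 : p * ell1 n a p > (n : ℝ) * ((n : ℝ) - 4) / 2)
    (hl2 : p * ell2 n a p > (n : ℝ) ^ 2 * ((n : ℝ) - 4) ^ 2 / 16)
    (u : EuclideanSpace ℝ (Fin n) → ℝ) (hu : ContDiff ℝ (⊤ : ℕ∞) u)
    (hsol : IsSolutionOn n a p u Set.univ)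
    (hstab : StableOn n a p u Set.univ) :
    ∃ C : ℝ, ∀ r : ℝ, 0 < r → energyE n a p u 0 r ≤ C := by
  have hn' : (5 : ℝ) ≤ n := by exact_mod_cast hn
  have hp : 0 < p := lt_trans (div_pos (by linarith) (by linarith)) hpc
  refine ⟨0, fun r _ => ?_⟩
  rw [PuncturedSpace.eq_zero_of_stableOn hn ha hpc hl1 hl2 hu hsol hstab,
    energyE_zero n a p (by linarith)]
end
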